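/- arXiv:2001.04119 — 2 statements merged into one kernel-verified Lean document; each statement's English description precedes it below -/
import Mathlib

section
/- (Schur–Weyl duality for Ů(ε)) Assume ε_1 = 0 and fix ℓ ≥ 2. Then End_{ℋ_ℓ(q^{−2})}(𝒱^{⊗ℓ}) = Φ_ℓ(Ů(ε)) and End_{Ů(ε)}(𝒱^{⊗ℓ}) = Ψ_ℓ(ℋ_ℓ(q^{−2})); that is, the images of the actions of Ů(ε) and of the Iwahori–Hecke algebra on 𝒱^{⊗ℓ} are mutual centralizers. -/
/-! Generalized quantum group of affine type A (Kwon–Yu), common definitions.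

Conventions:
* The base field is `K = ℚ(q)` with `qq = q`.
* The index set `𝕀 = {1,…,n}` is modeled 0-based by `Fin n`: the position `p : Fin n`
  represents the letter `p+1`; `ε : Fin n → Bool` with `ε p = true` meaning `ε_{p+1} = 1`.
* The affine index set `I = {0,1,…,n-1}` is modeled by `Fin n` (with cyclic arithmetic);
  for `i : Fin n`, the simple root is `α_i = δ_i - δ_{i+1}` (letters mod n), whose
  letters have 0-based positions `i - 1` and `i` (`Fin` subtraction is cyclic).
-/

set_option synthInstance.maxHeartbeats 1000000
set_option maxHeartbeats 1600000

noncomputable section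
open scoped TensorProduct

abbrev K : Type := RatFunc ℚ

/-- The indeterminate `q`. -/
def qq : K := RatFunc.X

/-- `q_p = (-1)^{ε_p} q^{(-1)^{ε_p}}` for the letter at (0-based) position `p`. -/
def qv {n : ℕ} (ε : Fin n → Bool) (p : Fin n) : K := if ε p then -qq⁻¹ else qq

/-- `(-1)^{ε_p}` as an integer. -/
def sgn {n : ℕ} (ε : Fin n → Bool) (p : Fin n) : ℤ := if ε p then -1 else 1

/-- `⟨α_i, δ_{p+1}^∨⟩`, where `i ∈ I` and `p` is a 0-based letter position. -/
def apair {n : ℕ} [NeZero n] (i p : Fin n) : ℤ :=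
  (if p = i - 1 then 1 else 0) - (if p = i then 1 else 0)

/-- the exponent of `ω_{p+1} = q^{(-1)^{ε_{p+1}} δ_{p+1}^∨}` as an element of `P^∨ = ℤ^n`. -/
def ωexp {n : ℕ} (ε : Fin n → Bool) (p : Fin n) : Fin n → ℤ :=
  fun r => if r = p then sgn ε p else 0

/-- the exponent of `k_i = ω_i ω_{i+1}^{-1}` in `P^∨`. -/
def κe {n : ℕ} [NeZero n] (ε : Fin n → Bool) (i : Fin n) : Fin n → ℤ :=
  ωexp ε (i - 1) - ωexp ε i

/-- `D_{ij} = q_i^{⟨α_j,δ_i^∨⟩} q_{i+1}^{-⟨α_j,δ_{i+1}^∨⟩}`. -/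
def Dc {n : ℕ} [NeZero n] (ε : Fin n → Bool) (i j : Fin n) : K :=
  qv ε (i - 1) ^ apair j (i - 1) * qv ε i ^ (-apair j i)

/-- `[2] = q + q⁻¹`. -/
def brk2 : K := qq + qq⁻¹

/-- `i ∈ I_odd`, i.e. `(α_i|α_i) = 0`, i.e. `ε_i ≠ ε_{i+1}`. -/
def oddI {n : ℕ} [NeZero n] (ε : Fin n → Bool) (i : Fin n) : Prop := ε (i - 1) ≠ ε i

/-- `(-1)^{ε_i}` for `i ∈ I`, as a scalar. -/
def signI {n : ℕ} [NeZero n] (ε : Fin n → Bool) (i : Fin n) : K := if ε (i - 1) then -1 else 1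

/-- cyclic adjacency in the affine Dynkin diagram of `I = ℤ/n`. -/
def adjI {n : ℕ} [NeZero n] (i j : Fin n) : Prop := j = i + 1 ∨ i = j + 1

/-! ### The natural module `𝒱` and its tensor powers, concretely.

`𝒱^{⊗ℓ}` is modeled as the space `Vl n ℓ = (Fin ℓ → Fin n) → K` of coefficient functions on
multi-indices; the basis vector `v_{m_0} ⊗ ⋯ ⊗ v_{m_{ℓ-1}}` is `Pi.single m 1`.  The action of
the generators of `Ů(ε)` (and of `U(ε)`) obtained from the comultiplication
`Δ(e_i) = e_i ⊗ 1 + k_i^{-1} ⊗ e_i`, `Δ(f_i) = f_i ⊗ k_i + 1 ⊗ f_i`, `Δ(q^h) = q^h ⊗ q^h`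
is written out explicitly below. -/

/-- A linear endomorphism of a coefficient space `M → K` given by
`g ↦ (m ↦ c₁ m * g m + c₂ m * g (σ m))`. -/
def twoTerm {M : Type} (c₁ c₂ : M → K) (σ : M → M) : Module.End K (M → K) where
  toFun g := fun m => c₁ m * g m + c₂ m * g (σ m)
  map_add' g h := by funext m; simp only [Pi.add_apply]; ring
  map_smul' a g := by
    funext m; simp only [Pi.smul_apply, smul_eq_mul, RingHom.id_apply]; ring

abbrev Vl (n ℓ : ℕ) : Type := (Fin ℓ → Fin n) → K

/-- diagonal entry of `k_i` at a letter position `p`. -/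
def kEntry {n : ℕ} [NeZero n] (ε : Fin n → Bool) (i p : Fin n) : K :=
  (if p = i - 1 then qv ε (i - 1) else 1) * (if p = i then (qv ε i)⁻¹ else 1)

/-- diagonal entry of `k_i^{-1}` at a letter position `p`. -/
def kinvEntry {n : ℕ} [NeZero n] (ε : Fin n → Bool) (i p : Fin n) : K :=
  (if p = i - 1 then (qv ε (i - 1))⁻¹ else 1) * (if p = i then qv ε i else 1)

/-- diagonal entry of `q^h` at a letter position `p` (recall `ω_p = q^{(-1)^{ε_p} δ_p^∨}`
acts on `v_p` by `q_p`). -/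
def qhEntry {n : ℕ} (ε : Fin n → Bool) (h : Fin n → ℤ) (p : Fin n) : K :=
  qv ε p ^ (sgn ε p * h p)

/-- the action of `e_i` on `𝒱^{⊗ℓ}` via `Δ`. -/
def eOpL (n ℓ : ℕ) [NeZero n] (ε : Fin n → Bool) (i : Fin n) : Module.End K (Vl n ℓ) :=
  ∑ t : Fin ℓ, twoTerm 0
    (fun m => if m t = i - 1 then ∏ s ∈ Finset.univ.filter (fun s => s < t), kinvEntry ε i (m s) else 0)
    (fun m => Function.update m t i)

/-- the action of `f_i` on `𝒱^{⊗ℓ}` via `Δ`. -/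
def fOpL (n ℓ : ℕ) [NeZero n] (ε : Fin n → Bool) (i : Fin n) : Module.End K (Vl n ℓ) :=
  ∑ t : Fin ℓ, twoTerm 0
    (fun m => if m t = i then ∏ s ∈ Finset.univ.filter (fun s => t < s), kEntry ε i (m s) else 0)
    (fun m => Function.update m t (i - 1))

/-- the action of `q^h` on `𝒱^{⊗ℓ}` via `Δ`. -/
def qhOpL (n ℓ : ℕ) (ε : Fin n → Bool) (h : Fin n → ℤ) : Module.End K (Vl n ℓ) :=
  twoTerm (fun m => ∏ t : Fin ℓ, qhEntry ε h (m t)) 0 id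

/-- The `R` matrix of (3.1) acting on the tensor factors `t, t+1` of `𝒱^{⊗ℓ}`:
`R(v_i ⊗ v_j) = q⁻¹ q_i⁻¹ v_i ⊗ v_j` (`i = j`), `q⁻¹ v_j ⊗ v_i` (`i > j`),
`(q⁻² − 1) v_i ⊗ v_j + q⁻¹ v_j ⊗ v_i` (`i < j`). -/
def Rsite (n ℓ : ℕ) [NeZero n] (ε : Fin n → Bool) (t : Fin (ℓ - 1)) :
    Module.End K (Vl n ℓ) :=
  have h1 : (t : ℕ) + 1 < ℓ := by have := t.isLt; omega
  have h0 : (t : ℕ) < ℓ := by omega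
  twoTerm
    (fun m => if m ⟨t, h0⟩ = m ⟨t + 1, h1⟩ then qq⁻¹ * (qv ε (m ⟨t, h0⟩))⁻¹
      else if m ⟨t, h0⟩ < m ⟨t + 1, h1⟩ then qq⁻¹ * qq⁻¹ - 1 else 0)
    (fun m => if m ⟨t, h0⟩ = m ⟨t + 1, h1⟩ then 0 else qq⁻¹)
    (fun m => fun s => if s = ⟨t, h0⟩ then m ⟨t + 1, h1⟩
      else if s = ⟨t + 1, h1⟩ then m ⟨t, h0⟩ else m s)

/-- The image `Φ_ℓ(Ů(ε)) ⊆ End(𝒱^{⊗ℓ})` of the subalgebra `Ů(ε)` of `U(ε)` generated by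
`q^h (h ∈ P^∨)` and `e_i, f_i (i ∈ I∖{0})`: it is the subalgebra generated by the images
of these generators. -/
def UimageL (n ℓ : ℕ) [NeZero n] (ε : Fin n → Bool) : Subalgebra K (Module.End K (Vl n ℓ)) :=
  Algebra.adjoin K
    ({x | ∃ h : Fin n → ℤ, x = qhOpL n ℓ ε h} ∪
     {x | ∃ i : Fin n, i ≠ 0 ∧ (x = eOpL n ℓ ε i ∨ x = fOpL n ℓ ε i)})

/-- The image `Ψ_ℓ(ℋ_ℓ(q^{-2})) ⊆ End(𝒱^{⊗ℓ})` of the Iwahori–Hecke algebra: the subalgebra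
generated by the operators `Ψ_ℓ(h_i)`. -/
def HimageL (n ℓ : ℕ) [NeZero n] (ε : Fin n → Bool) : Subalgebra K (Module.End K (Vl n ℓ)) :=
  Algebra.adjoin K {x | ∃ t : Fin (ℓ - 1), x = Rsite n ℓ ε t}


/-! ### Sums of squares and the double centralizer theorem -/

theorem qq_ne : qq ≠ 0 := RatFunc.X_ne_zero

theorem sum_sq_zero {M : Type} [Fintype M] (x : M → K) (h : ∑ m, x m * x m = 0) : x = 0 := by
  obtain ⟨b, hb⟩ := IsLocalization.exist_integer_multiples_of_finite
    (nonZeroDivisors (Polynomial ℚ)) x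
  choose p hp using hb
  have hb0 : algebraMap (Polynomial ℚ) K (b : Polynomial ℚ) ≠ 0 := by
    have : (b : Polynomial ℚ) ≠ 0 := nonZeroDivisors.coe_ne_zero b
    simp [this]
  have hp' : ∀ i, algebraMap (Polynomial ℚ) K (p i) = algebraMap (Polynomial ℚ) K b * x i := by
    intro i; rw [hp i, Algebra.smul_def]
  have h1 : algebraMap (Polynomial ℚ) K (∑ i, p i * p i) = 0 := by
    rw [map_sum]
    simp only [map_mul, hp']
    have : ∀ i, algebraMap (Polynomial ℚ) K b * x i * (algebraMap (Polynomial ℚ) K b * x i)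
      = (algebraMap (Polynomial ℚ) K b)^2 * (x i * x i) := fun i => by ring
    simp only [this, ← Finset.mul_sum, h, mul_zero]
  have h2 : ∑ i, p i * p i = 0 := 
    (map_eq_zero_iff _ (IsFractionRing.injective (Polynomial ℚ) K)).1 h1
  have h3 : ∀ i, p i = 0 := by
    intro i
    apply Polynomial.funext
    intro r
    have := congrArg (Polynomial.eval r) h2
    rw [Polynomial.eval_finsetSum] at this
    simp only [Polynomial.eval_mul, Polynomial.eval_zero] at this
    rw [Finset.sum_eq_zero_iff_of_nonneg (fun i _ => mul_self_nonneg _)] at this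
    simpa using this i (Finset.mem_univ i)
  funext i
  have := hp' i
  rw [h3 i, map_zero] at this
  rcases mul_eq_zero.1 this.symm with h | h
  · exact absurd h hb0
  · exact h

/-- the standard bilinear pairing -/
def dotp {M : Type} [Fintype M] (x y : M → K) : K := ∑ m, x m * y m

theorem dotp_comm {M : Type} [Fintype M] (x y : M → K) : dotp x y = dotp y x := by
  simp only [dotp, mul_comm]

theorem dotp_add_left {M : Type} [Fintype M] (x x' y : M → K) :
    dotp (x + x') y = dotp x y + dotp x' y := by
  simp only [dotp, Pi.add_apply, add_mul, Finset.sum_add_distrib]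

theorem dotp_smul_left {M : Type} [Fintype M] (c : K) (x y : M → K) :
    dotp (c • x) y = c * dotp x y := by
  simp only [dotp, Pi.smul_apply, smul_eq_mul, mul_assoc, Finset.mul_sum]

theorem dotp_add_right {M : Type} [Fintype M] (x y y' : M → K) :
    dotp x (y + y') = dotp x y + dotp x y' := by
  rw [dotp_comm, dotp_add_left, dotp_comm y, dotp_comm y']

theorem dotp_smul_right {M : Type} [Fintype M] (c : K) (x y : M → K) :
    dotp x (c • y) = c * dotp x y := by
  rw [dotp_comm, dotp_smul_left, dotp_comm]

theorem dotp_ext {M : Type} [Fintype M] {x x' : M → K} (h : ∀ y, dotp x y = dotp x' y) :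
    x = x' := by
  classical
  funext m
  simpa [dotp, Pi.single_apply] using h (Pi.single m 1)

/-- `a` and `b` are adjoint for the standard pairings. -/
def IsAdj {M M' : Type} [Fintype M] [Fintype M'] (a : (M → K) →ₗ[K] (M' → K))
    (b : (M' → K) →ₗ[K] (M → K)) : Prop := ∀ x y, dotp (a x) y = dotp x (b y)

theorem IsAdj.symm {M M' : Type} [Fintype M] [Fintype M'] {a : (M → K) →ₗ[K] (M' → K)}
    {b : (M' → K) →ₗ[K] (M → K)} (h : IsAdj a b) : IsAdj b a := fun x y => by
  rw [dotp_comm, ← h, dotp_comm]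

theorem IsAdj.mul {M : Type} [Fintype M] {a a' b b' : Module.End K (M → K)}
    (h : IsAdj a b) (h' : IsAdj a' b') : IsAdj (a * a') (b' * b) := fun x y => by
  rw [Module.End.mul_apply, h, h', Module.End.mul_apply]

theorem IsAdj.add {M : Type} [Fintype M] {a a' b b' : Module.End K (M → K)}
    (h : IsAdj a b) (h' : IsAdj a' b') : IsAdj (a + a') (b + b') := fun x y => by
  rw [LinearMap.add_apply, LinearMap.add_apply, dotp_add_left, dotp_add_right, h, h']

theorem IsAdj.smul {M : Type} [Fintype M] {a b : Module.End K (M → K)}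
    (c : K) (h : IsAdj a b) : IsAdj (c • a) (c • b) := fun x y => by
  rw [LinearMap.smul_apply, LinearMap.smul_apply, dotp_smul_left, dotp_smul_right, h]

theorem IsAdj.algebraMap {M : Type} [Fintype M] (c : K) :
    IsAdj (algebraMap K (Module.End K (M → K)) c) (algebraMap K (Module.End K (M → K)) c) :=
  fun x y => by
  rw [Module.algebraMap_end_apply, Module.algebraMap_end_apply, dotp_smul_left, dotp_smul_right]

theorem IsAdj.unique {M M' : Type} [Fintype M] [Fintype M'] {a a' : (M → K) →ₗ[K] (M' → K)}
    {b : (M' → K) →ₗ[K] (M → K)} (h : IsAdj a b) (h' : IsAdj a' b) : a = a' := by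
  ext1 x
  exact dotp_ext fun y => by rw [h, h']

/-- If generators have adjoints in `B`, so do all elements. -/
theorem adjoin_adj {M : Type} [Fintype M] (S : Set (Module.End K (M → K)))
    (B : Subalgebra K (Module.End K (M → K))) (h : ∀ a ∈ S, ∃ b ∈ B, IsAdj a b)
    (a : Module.End K (M → K)) (ha : a ∈ Algebra.adjoin K S) : ∃ b ∈ B, IsAdj a b := by
  induction ha using Algebra.adjoin_induction with
  | mem x hx => exact h x hx
  | algebraMap r => exact ⟨_, B.algebraMap_mem r, IsAdj.algebraMap r⟩
  | add x y _ _ hx hy =>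
    obtain ⟨b, hb, h1⟩ := hx
    obtain ⟨b', hb', h2⟩ := hy
    exact ⟨_, B.add_mem hb hb', h1.add h2⟩
  | mul x y _ _ hx hy =>
    obtain ⟨b, hb, h1⟩ := hx
    obtain ⟨b', hb', h2⟩ := hy
    exact ⟨_, B.mul_mem hb' hb, h1.mul h2⟩

def dotB (M : Type) [Fintype M] : LinearMap.BilinForm K (M → K) :=
  LinearMap.mk₂ K dotp dotp_add_left dotp_smul_left dotp_add_right dotp_smul_right

theorem double_centralizer {M : Type} [Fintype M] (A : Subalgebra K (Module.End K (M → K)))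
    (hA : ∀ a ∈ A, ∃ b ∈ A, IsAdj a b) (T : Module.End K (M → K))
    (hT : ∀ C : Module.End K (M → K), (∀ a ∈ A, a * C = C * a) → C * T = T * C) : T ∈ A := by
  classical
  have : IsSemisimpleModule A (M → K) := by
    have : ComplementedLattice (Submodule A (M → K)) := by
      refine ⟨fun W => ?_⟩
      let W0 : Submodule K (M → K) := W.restrictScalars K
      have hdisj : Disjoint W0 ((dotB M).orthogonal W0) := by
        rw [Submodule.disjoint_def]
        intro x hx hx'
        exact sum_sq_zero x (hx' x hx)
      have hc := (LinearMap.BilinForm.isCompl_orthogonal_iff_disjoint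
        (B := dotB M) (W := W0) (fun x y h => by
          change dotp y x = 0
          rw [dotp_comm]; exact h)).2 hdisj
      let W' : Submodule A (M → K) :=
        { carrier := {x | ∀ y ∈ W, dotp y x = 0}
          add_mem' := fun {a b} ha hb y hy => by rw [dotp_add_right, ha y hy, hb y hy, add_zero]
          zero_mem' := fun y hy => by simp [dotp]
          smul_mem' := fun c x hx y hy => by
            obtain ⟨b, hb, hab⟩ := hA c.1 c.2
            have : dotp y (c.1 x) = dotp (b y) x := (hab.symm y x).symm
            change dotp y (c.1 x) = 0
            rw [this]
            exact hx _ (W.smul_mem ⟨b, hb⟩ hy) }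
      have hW' : ∀ x, x ∈ W' ↔ x ∈ (dotB M).orthogonal W0 := fun x => Iff.rfl
      refine ⟨W', ?_, ?_⟩
      · rw [Submodule.disjoint_def]
        intro x hx hx'
        exact sum_sq_zero x (hx' x hx)
      · rw [codisjoint_iff, eq_top_iff]
        intro x _
        have : x ∈ W0 ⊔ (dotB M).orthogonal W0 := by rw [hc.sup_eq_top]; trivial
        obtain ⟨y, hy, z, hz, rfl⟩ := Submodule.mem_sup.1 this
        exact Submodule.mem_sup.2 ⟨y, hy, z, hz, rfl⟩
    exact { }
  let f : Module.End (Module.End A (M → K)) (M → K) :=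
    { toFun := T
      map_add' := T.map_add
      map_smul' := fun C x => by
        let C' : Module.End K (M → K) := C.restrictScalars K
        have := hT C' (fun a ha => by
          apply LinearMap.ext
          intro v
          exact (C.map_smul ⟨a, ha⟩ v).symm)
        exact (LinearMap.congr_fun this x).symm }
  obtain ⟨r, hr⟩ := jacobson_density (R := A) (M := M → K) f (Finset.univ.image fun m : M => (Pi.single m 1 : M → K))
  have : T = r.1 := by
    apply LinearMap.pi_ext'
    intro m
    apply LinearMap.ext_ring
    exact hr (Pi.single m 1) (Finset.mem_image_of_mem _ (Finset.mem_univ m))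
  rw [this]
  exact r.2



/-! ### Explicit formulas for the operators -/

theorem qv_ne {n : ℕ} (ε : Fin n → Bool) (p : Fin n) : qv ε p ≠ 0 := by
  unfold qv; split_ifs
  · exact neg_ne_zero.2 (inv_ne_zero qq_ne)
  · exact qq_ne

theorem pred_ne {n : ℕ} [NeZero n] {i : Fin n} (hi : i ≠ 0) : i - 1 ≠ i := by
  intro h
  have h1 : (1 : Fin n) = 0 := by
    have := sub_eq_self.1 h
    exact this
  have : n = 1 := by
    rcases n with _ | _ | n
    · exact absurd rfl (NeZero.ne 0)
    · rfl
    · simp at h1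
  subst this
  exact hi (Subsingleton.elim _ _)

theorem pred_val {n : ℕ} [NeZero n] {i : Fin n} (hi : i ≠ 0) : ((i - 1 : Fin n) : ℕ) + 1 = i := by
  have h0 : (i : ℕ) ≠ 0 := fun h => hi (Fin.ext (by simpa using h))
  rw [Fin.val_sub_one_of_ne_zero hi]
  omega

theorem kinv_mul_k {n : ℕ} [NeZero n] (ε : Fin n → Bool) (i p : Fin n) :
    kinvEntry ε i p * kEntry ε i p = 1 := by
  have := qv_ne ε i
  have := qv_ne ε (i - 1)
  unfold kinvEntry kEntry
  split_ifs <;> field_simp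

theorem kinv_ne {n : ℕ} [NeZero n] (ε : Fin n → Bool) (i p : Fin n) : kinvEntry ε i p ≠ 0 :=
  left_ne_zero_of_mul_eq_one (kinv_mul_k ε i p)

theorem k_ne {n : ℕ} [NeZero n] (ε : Fin n → Bool) (i p : Fin n) : kEntry ε i p ≠ 0 :=
  right_ne_zero_of_mul_eq_one (kinv_mul_k ε i p)

def Pe {n ℓ : ℕ} [NeZero n] (ε : Fin n → Bool) (i : Fin n) (m : Fin ℓ → Fin n) (t : Fin ℓ) : K :=
  ∏ s ∈ Finset.univ.filter (fun s => s < t), kinvEntry ε i (m s)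

def Pf {n ℓ : ℕ} [NeZero n] (ε : Fin n → Bool) (i : Fin n) (m : Fin ℓ → Fin n) (t : Fin ℓ) : K :=
  ∏ s ∈ Finset.univ.filter (fun s => t < s), kEntry ε i (m s)

theorem Pe_ne {n ℓ : ℕ} [NeZero n] (ε : Fin n → Bool) (i : Fin n) (m : Fin ℓ → Fin n)
    (t : Fin ℓ) : Pe ε i m t ≠ 0 := Finset.prod_ne_zero_iff.2 fun _ _ => kinv_ne _ _ _

theorem Pf_ne {n ℓ : ℕ} [NeZero n] (ε : Fin n → Bool) (i : Fin n) (m : Fin ℓ → Fin n)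
    (t : Fin ℓ) : Pf ε i m t ≠ 0 := Finset.prod_ne_zero_iff.2 fun _ _ => k_ne _ _ _

theorem Pe_update {n ℓ : ℕ} [NeZero n] (ε : Fin n → Bool) (i : Fin n) (m : Fin ℓ → Fin n)
    (t : Fin ℓ) (x : Fin n) : Pe ε i (Function.update m t x) t = Pe ε i m t := by
  unfold Pe
  refine Finset.prod_congr rfl fun s hs => ?_
  rw [Function.update_of_ne (ne_of_lt (Finset.mem_filter.1 hs).2)]

theorem Pf_update {n ℓ : ℕ} [NeZero n] (ε : Fin n → Bool) (i : Fin n) (m : Fin ℓ → Fin n)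
    (t : Fin ℓ) (x : Fin n) : Pf ε i (Function.update m t x) t = Pf ε i m t := by
  unfold Pf
  refine Finset.prod_congr rfl fun s hs => ?_
  rw [Function.update_of_ne (ne_of_gt (Finset.mem_filter.1 hs).2)]

theorem e_apply {n ℓ : ℕ} [NeZero n] (ε : Fin n → Bool) (i : Fin n) (g : Vl n ℓ)
    (m : Fin ℓ → Fin n) : eOpL n ℓ ε i g m =
      ∑ t, (if m t = i - 1 then Pe ε i m t else 0) * g (Function.update m t i) := by
  simp [eOpL, twoTerm, Pe, LinearMap.sum_apply]

theorem f_apply {n ℓ : ℕ} [NeZero n] (ε : Fin n → Bool) (i : Fin n) (g : Vl n ℓ)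
    (m : Fin ℓ → Fin n) : fOpL n ℓ ε i g m =
      ∑ t, (if m t = i then Pf ε i m t else 0) * g (Function.update m t (i - 1)) := by
  simp [fOpL, twoTerm, Pf, LinearMap.sum_apply]

theorem qh_apply {n ℓ : ℕ} (ε : Fin n → Bool) (h : Fin n → ℤ) (g : Vl n ℓ)
    (m : Fin ℓ → Fin n) : qhOpL n ℓ ε h g m = (∏ t, qhEntry ε h (m t)) * g m := by
  simp [qhOpL, twoTerm]

/-! ### Adjoints -/

theorem qh_adj {n ℓ : ℕ} (ε : Fin n → Bool) (h : Fin n → ℤ) :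
    IsAdj (qhOpL n ℓ ε h) (qhOpL n ℓ ε h) := fun x y => by
  unfold dotp
  refine Finset.sum_congr rfl fun m _ => ?_
  rw [qh_apply, qh_apply]; ring

theorem qh_mul {n ℓ : ℕ} (ε : Fin n → Bool) (h h' : Fin n → ℤ) :
    qhOpL n ℓ ε h * qhOpL n ℓ ε h' = qhOpL n ℓ ε (h + h') := by
  apply LinearMap.ext; intro g; funext m
  rw [Module.End.mul_apply, qh_apply, qh_apply, qh_apply, ← mul_assoc, ← Finset.prod_mul_distrib]
  congr 1
  refine Finset.prod_congr rfl fun t _ => ?_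
  unfold qhEntry
  rw [← zpow_add₀ (qv_ne _ _), Pi.add_apply, mul_add]

theorem qh_zero {n ℓ : ℕ} (ε : Fin n → Bool) : qhOpL n ℓ ε 0 = 1 := by
  apply LinearMap.ext; intro g; funext m
  rw [qh_apply]; simp [qhEntry]

theorem sgn_mul_self {n : ℕ} (ε : Fin n → Bool) (p : Fin n) : sgn ε p * sgn ε p = 1 := by
  unfold sgn; split_ifs <;> rfl

theorem qhEntry_k {n : ℕ} [NeZero n] (ε : Fin n → Bool) (i p : Fin n) (hi : i ≠ 0) :
    qhEntry ε (κe ε i) p = kEntry ε i p := by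
  have hne := pred_ne hi
  unfold qhEntry κe kEntry ωexp
  rw [Pi.sub_apply]
  by_cases h1 : p = i - 1
  · have h2 : p ≠ i := h1 ▸ hne
    subst h1
    simp [h2, sgn_mul_self]
  · by_cases h2 : p = i
    · subst h2
      simp [h1, sgn_mul_self]
    · simp [h1, h2]

theorem qhEntry_kinv {n : ℕ} [NeZero n] (ε : Fin n → Bool) (i p : Fin n) (hi : i ≠ 0) :
    qhEntry ε (-κe ε i) p = kinvEntry ε i p := by
  rw [eq_comm, ← mul_right_inj' (k_ne ε i p), mul_comm, kinv_mul_k, ← qhEntry_k ε i p hi]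
  unfold qhEntry
  rw [← zpow_add₀ (qv_ne _ _), Pi.neg_apply, ← mul_add, add_neg_cancel, mul_zero, zpow_zero]

theorem Pe_of_Pf {n ℓ : ℕ} [NeZero n] (ε : Fin n → Bool) (i : Fin n) (m : Fin ℓ → Fin n)
    (t : Fin ℓ) : Pe ε i m t * kinvEntry ε i (m t) = (∏ s, kinvEntry ε i (m s)) * Pf ε i m t := by
  have h1 : ∏ s, kinvEntry ε i (m s) =
      Pe ε i m t * (kinvEntry ε i (m t) *
        ∏ s ∈ Finset.univ.filter (fun s => t < s), kinvEntry ε i (m s)) := by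
    rw [← Finset.prod_filter_mul_prod_filter_not Finset.univ (fun s => s < t)]
    congr 1
    have : Finset.univ.filter (fun s : Fin ℓ => ¬ s < t)
        = insert t (Finset.univ.filter (fun s => t < s)) := by
      ext s; simp [le_iff_eq_or_lt, eq_comm]
    rw [this, Finset.prod_insert (by simp)]
  have h2 : (∏ s ∈ Finset.univ.filter (fun s => t < s), kinvEntry ε i (m s)) * Pf ε i m t = 1 := by
    unfold Pf
    rw [← Finset.prod_mul_distrib]
    exact Finset.prod_eq_one fun s _ => kinv_mul_k _ _ _
  rw [h1, mul_assoc, mul_assoc, h2, mul_one]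

/-- explicit adjoint of `e_i` -/
theorem e_adj {n ℓ : ℕ} [NeZero n] (ε : Fin n → Bool) (i : Fin n) (hi : i ≠ 0) :
    IsAdj (eOpL n ℓ ε i) ((qv ε i)⁻¹ • (qhOpL n ℓ ε (-κe ε i) * fOpL n ℓ ε i)) := fun x y => by
  have hne := pred_ne hi
  have hR : ∀ m, ((qv ε i)⁻¹ • (qhOpL n ℓ ε (-κe ε i) * fOpL n ℓ ε i)) y m =
      ∑ t, (if m t = i then Pe ε i m t else 0) * y (Function.update m t (i - 1)) := by
    intro m
    rw [LinearMap.smul_apply, Pi.smul_apply, Module.End.mul_apply, qh_apply, f_apply, smul_eq_mul,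
      Finset.mul_sum, Finset.mul_sum]
    refine Finset.sum_congr rfl fun t _ => ?_
    split_ifs with h
    · have := Pe_of_Pf ε i m t
      have hk : kinvEntry ε i (m t) = qv ε i := by
        rw [h]; simp [kinvEntry, hne.symm]
      rw [hk] at this
      simp only [qhEntry_kinv ε i _ hi]
      have hq := qv_ne ε i
      rw [← mul_assoc (∏ s, kinvEntry ε i (m s)), ← this]
      field_simp
    · simp
  unfold dotp
  simp only [hR, e_apply, Finset.sum_mul, Finset.mul_sum]
  rw [Finset.sum_comm, Finset.sum_comm (s := (Finset.univ : Finset (Fin ℓ → Fin n)))]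
  refine Finset.sum_congr rfl fun t _ => ?_
  have hL : ∀ m : Fin ℓ → Fin n, (if m t = i - 1 then Pe ε i m t else 0) *
      x (Function.update m t i) * y m = if m t = i - 1 then Pe ε i m t *
      x (Function.update m t i) * y m else 0 := fun m => by split_ifs <;> simp
  have hL' : ∀ m : Fin ℓ → Fin n, x m * ((if m t = i then Pe ε i m t else 0) *
      y (Function.update m t (i - 1))) = if m t = i then x m * (Pe ε i m t *
      y (Function.update m t (i - 1))) else 0 := fun m => by split_ifs <;> simp
  simp only [hL, hL']
  rw [← Finset.sum_filter, ← Finset.sum_filter]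
  refine Finset.sum_nbij' (fun m => Function.update m t i) (fun m => Function.update m t (i - 1))
    ?_ ?_ ?_ ?_ ?_
  · intro m hm; simp
  · intro m hm; simp
  · intro m hm
    have : m t = i - 1 := by simpa using hm
    simp [← this]
  · intro m hm
    have : m t = i := by simpa using hm
    simp [← this]
  · intro m hm
    have : m t = i - 1 := by simpa using hm
    rw [Pe_update, Function.update_idem, ← this, Function.update_eq_self]
    ring

theorem f_adj {n ℓ : ℕ} [NeZero n] (ε : Fin n → Bool) (i : Fin n) (hi : i ≠ 0) :
    IsAdj (fOpL n ℓ ε i) (qv ε i • (eOpL n ℓ ε i * qhOpL n ℓ ε (κe ε i))) := by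
  have h1 := (qh_adj (ℓ := ℓ) ε (κe ε i)).mul (e_adj (ℓ := ℓ) ε i hi).symm
  have h2 := h1.smul (qv ε i)
  have h3 : qv ε i • (qhOpL n ℓ ε (κe ε i) * ((qv ε i)⁻¹ •
      (qhOpL n ℓ ε (-κe ε i) * fOpL n ℓ ε i))) = fOpL n ℓ ε i := by
    rw [mul_smul_comm, smul_smul, mul_inv_cancel₀ (qv_ne _ _), one_smul, ← mul_assoc, qh_mul,
      add_neg_cancel, qh_zero, one_mul]
  rwa [h3] at h2

theorem U_qh {n ℓ : ℕ} [NeZero n] (ε : Fin n → Bool) (h : Fin n → ℤ) :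
    qhOpL n ℓ ε h ∈ UimageL n ℓ ε := Algebra.subset_adjoin (Or.inl ⟨h, rfl⟩)

theorem U_e {n ℓ : ℕ} [NeZero n] (ε : Fin n → Bool) (i : Fin n) (hi : i ≠ 0) :
    eOpL n ℓ ε i ∈ UimageL n ℓ ε := Algebra.subset_adjoin (Or.inr ⟨i, hi, Or.inl rfl⟩)

theorem U_f {n ℓ : ℕ} [NeZero n] (ε : Fin n → Bool) (i : Fin n) (hi : i ≠ 0) :
    fOpL n ℓ ε i ∈ UimageL n ℓ ε := Algebra.subset_adjoin (Or.inr ⟨i, hi, Or.inr rfl⟩)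

theorem U_adj {n ℓ : ℕ} [NeZero n] (ε : Fin n → Bool) (a : Module.End K (Vl n ℓ))
    (ha : a ∈ UimageL n ℓ ε) : ∃ b ∈ UimageL n ℓ ε, IsAdj a b := by
  refine adjoin_adj _ _ ?_ a ha
  rintro a (⟨h, rfl⟩ | ⟨i, hi, rfl | rfl⟩)
  · exact ⟨_, U_qh ε h, qh_adj ε h⟩
  · exact ⟨_, Subalgebra.smul_mem _ (mul_mem (U_qh ε _) (U_f ε i hi)) _, e_adj ε i hi⟩
  · exact ⟨_, Subalgebra.smul_mem _ (mul_mem (U_e ε i hi) (U_qh ε _)) _, f_adj ε i hi⟩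

/-! ### The operators `R` -/

def r1 {n : ℕ} (ε : Fin n → Bool) (a b : Fin n) : K :=
  if a = b then qq⁻¹ * (qv ε a)⁻¹ else if a < b then qq⁻¹ * qq⁻¹ - 1 else 0

def r2 {n : ℕ} (a b : Fin n) : K := if a = b then 0 else qq⁻¹

/-- `R` acting on the factors `t0`, `t1`. -/
def Rgen {n ℓ : ℕ} (ε : Fin n → Bool) (t0 t1 : Fin ℓ) : Module.End K (Vl n ℓ) :=
  twoTerm (fun m => r1 ε (m t0) (m t1)) (fun m => r2 (m t0) (m t1))
    (fun m => m ∘ Equiv.swap t0 t1)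

theorem Rsite_eq {n ℓ : ℕ} [NeZero n] (ε : Fin n → Bool) (t : Fin (ℓ - 1)) (t0 t1 : Fin ℓ)
    (h0 : t0.1 = t.1) (h1 : t1.1 = t.1 + 1) : Rsite n ℓ ε t = Rgen ε t0 t1 := by
  obtain ⟨t0, ht0⟩ := t0
  obtain ⟨t1, ht1⟩ := t1
  dsimp only at h0 h1
  subst h0 h1
  have key : (fun (m : Fin ℓ → Fin n) => m ∘ Equiv.swap (⟨t.1, ht0⟩ : Fin ℓ) ⟨t.1 + 1, ht1⟩) =
      fun m s => if s = ⟨t.1, ht0⟩ then m ⟨t.1 + 1, ht1⟩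
        else if s = ⟨t.1 + 1, ht1⟩ then m ⟨t.1, ht0⟩ else m s := by
    funext m s
    simp only [Function.comp, Equiv.swap_apply_def]
    split_ifs <;> rfl
  unfold Rgen
  rw [key]
  rfl

theorem Rgen_apply {n ℓ : ℕ} (ε : Fin n → Bool) (t0 t1 : Fin ℓ) (g : Vl n ℓ)
    (m : Fin ℓ → Fin n) : Rgen ε t0 t1 g m =
      r1 ε (m t0) (m t1) * g m + r2 (m t0) (m t1) * g (m ∘ Equiv.swap t0 t1) := rfl

theorem r2_comm {n : ℕ} (a b : Fin n) : r2 a b = r2 b a := by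
  unfold r2; simp only [eq_comm]

theorem R_adj {n ℓ : ℕ} (ε : Fin n → Bool) (t0 t1 : Fin ℓ) :
    IsAdj (Rgen (n := n) ε t0 t1) (Rgen ε t0 t1) := fun x y => by
  unfold dotp
  simp only [Rgen_apply, add_mul, mul_add, Finset.sum_add_distrib]
  congr 1
  · exact Finset.sum_congr rfl fun m _ => by ring
  · refine Fintype.sum_equiv (Equiv.arrowCongr (Equiv.swap t0 t1) (Equiv.refl _)) _ _ fun m => ?_
    have : (Equiv.arrowCongr (Equiv.swap t0 t1) (Equiv.refl (Fin n))) m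
      = m ∘ Equiv.swap t0 t1 := by
      funext s; simp [Equiv.arrowCongr]
    rw [this]
    have h2 : (m ∘ Equiv.swap t0 t1) ∘ Equiv.swap t0 t1 = m := by
      funext s; simp
    rw [h2]
    simp only [Function.comp, Equiv.swap_apply_left, Equiv.swap_apply_right]
    rw [r2_comm]; ring

theorem H_adj {n ℓ : ℕ} [NeZero n] (ε : Fin n → Bool) (a : Module.End K (Vl n ℓ))
    (ha : a ∈ HimageL n ℓ ε) : ∃ b ∈ HimageL n ℓ ε, IsAdj a b := by
  refine adjoin_adj _ _ ?_ a ha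
  rintro a ⟨t, rfl⟩
  refine ⟨_, Algebra.subset_adjoin ⟨t, rfl⟩, ?_⟩
  rw [Rsite_eq ε t ⟨t.1, by have := t.isLt; omega⟩ ⟨t.1 + 1, by have := t.isLt; omega⟩ rfl rfl]
  exact R_adj _ _ _



/-! ### The two actions commute -/

theorem two_letter {n : ℕ} [NeZero n] (ε : Fin n → Bool) (i : Fin n) (hi : i ≠ 0) (a b : Fin n)
    (G : Fin n → Fin n → K) :
    r1 ε a b * ((if a = i - 1 then 1 else 0) * G i b +
      (if b = i - 1 then kinvEntry ε i a else 0) * G a i) +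
    r2 a b * ((if b = i - 1 then 1 else 0) * G i a +
      (if a = i - 1 then kinvEntry ε i b else 0) * G b i) =
    (if a = i - 1 then 1 else 0) * (r1 ε i b * G i b + r2 i b * G b i) +
    (if b = i - 1 then kinvEntry ε i a else 0) * (r1 ε a i * G a i + r2 a i * G i a) := by
  have hq := qq_ne
  have hne := pred_ne hi
  have hv := pred_val hi
  have hlt : i - 1 < i := by rw [Fin.lt_def]; omega
  have hnlt : ¬ i < i - 1 := not_lt_of_gt hlt
  by_cases ha : a = i - 1
  · subst ha
    by_cases hb : b = i - 1
    · subst hb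
      simp only [r1, r2, kinvEntry, hne, hne.symm, hlt, hnlt, if_true, if_false]
      unfold qv
      split_ifs <;> field_simp <;> ring
    · by_cases hb' : b = i
      · subst hb'
        simp only [r1, r2, kinvEntry, hne, hne.symm, hlt, hnlt, if_true, if_false]
        unfold qv
        split_ifs <;> field_simp <;> ring
      · have h1 : (i - 1 < b) ↔ (i < b) := by
          rw [Fin.lt_def, Fin.lt_def]
          have : (b : ℕ) ≠ i := fun h => hb' (Fin.ext h)
          omega
        simp only [r1, r2, kinvEntry, hb, Ne.symm hb, Ne.symm hb', hb', h1, if_true, if_false]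
        ring
  · by_cases hb : b = i - 1
    · subst hb
      by_cases ha' : a = i
      · subst ha'
        simp only [r1, r2, kinvEntry, hne, hne.symm, hlt, hnlt, if_true, if_false]
        unfold qv
        split_ifs <;> field_simp <;> ring
      · have h1 : (a < i - 1) ↔ (a < i) := by
          rw [Fin.lt_def, Fin.lt_def]
          have : (a : ℕ) ≠ ((i - 1 : Fin n) : ℕ) := fun h => ha (Fin.ext h)
          omega
        simp only [r1, r2, kinvEntry, ha, ha', h1, if_true, if_false]
        ring
    · simp only [ha, hb, if_false]
      ring

theorem qh_swap {n ℓ : ℕ} (ε : Fin n → Bool) (h : Fin n → ℤ) (m : Fin ℓ → Fin n)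
    (σ : Equiv.Perm (Fin ℓ)) : ∏ t, qhEntry ε h ((m ∘ σ) t) = ∏ t, qhEntry ε h (m t) :=
  Equiv.prod_comp σ (fun t => qhEntry ε h (m t))

theorem qh_comm_R {n ℓ : ℕ} (ε : Fin n → Bool) (h : Fin n → ℤ) (t0 t1 : Fin ℓ) :
    Rgen ε t0 t1 * qhOpL n ℓ ε h = qhOpL n ℓ ε h * Rgen ε t0 t1 := by
  apply LinearMap.ext; intro g; funext m
  rw [Module.End.mul_apply, Module.End.mul_apply, Rgen_apply, qh_apply, qh_apply, qh_apply,
    Rgen_apply, qh_swap]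
  ring

theorem sum_split_two {ℓ : ℕ} (t0 t1 : Fin ℓ) (h : t0 ≠ t1) (F : Fin ℓ → K) :
    ∑ t, F t = F t0 + F t1 + ∑ t ∈ Finset.univ.filter (fun t => t ≠ t0 ∧ t ≠ t1), F t := by
  rw [← Finset.sum_filter_add_sum_filter_not Finset.univ (fun t => t ≠ t0 ∧ t ≠ t1), add_comm]
  congr 1
  have : Finset.univ.filter (fun t : Fin ℓ => ¬ (t ≠ t0 ∧ t ≠ t1)) = {t0, t1} := by
    ext t; simp; tauto
  rw [this, Finset.sum_pair h]

theorem Pe_swap {n ℓ : ℕ} [NeZero n] (ε : Fin n → Bool) (i : Fin n) (m : Fin ℓ → Fin n)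
    (t0 t1 t : Fin ℓ) (h01 : t1.1 = t0.1 + 1) (ht : t ≠ t1) :
    Pe ε i (m ∘ Equiv.swap t0 t1) t = Pe ε i m t := by
  unfold Pe
  refine Finset.prod_equiv (Equiv.swap t0 t1) (fun s => ?_) (fun s _ => rfl)
  simp only [Finset.mem_filter, Finset.mem_univ, true_and]
  have ht' : t.1 ≠ t1.1 := fun h => ht (Fin.ext h)
  rw [Equiv.swap_apply_def]
  split_ifs with h1 h2
  · subst h1; rw [Fin.lt_def, Fin.lt_def]; omega
  · subst h2; rw [Fin.lt_def, Fin.lt_def]; omega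
  · rfl

theorem Pe_succ {n ℓ : ℕ} [NeZero n] (ε : Fin n → Bool) (i : Fin n) (m : Fin ℓ → Fin n)
    (t0 t1 : Fin ℓ) (h01 : t1.1 = t0.1 + 1) :
    Pe ε i m t1 = Pe ε i m t0 * kinvEntry ε i (m t0) := by
  unfold Pe
  have : Finset.univ.filter (fun s : Fin ℓ => s < t1)
      = insert t0 (Finset.univ.filter (fun s => s < t0)) := by
    ext s
    simp only [Finset.mem_filter, Finset.mem_univ, true_and, Finset.mem_insert, Fin.ext_iff,
      Fin.lt_def]
    omega
  rw [this, Finset.prod_insert (by simp), mul_comm]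

theorem e_comm_R {n ℓ : ℕ} [NeZero n] (ε : Fin n → Bool) (i : Fin n) (hi : i ≠ 0)
    (t0 t1 : Fin ℓ) (h01 : t1.1 = t0.1 + 1) :
    Rgen ε t0 t1 * eOpL n ℓ ε i = eOpL n ℓ ε i * Rgen ε t0 t1 := by
  have hne : t0 ≠ t1 := fun h => by rw [h] at h01; omega
  apply LinearMap.ext; intro g; funext m
  rw [Module.End.mul_apply, Module.End.mul_apply, Rgen_apply, e_apply, e_apply, e_apply,
    sum_split_two t0 t1 hne, sum_split_two t0 t1 hne, sum_split_two t0 t1 hne]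
  -- the other factors
  have hO : ∑ t ∈ Finset.univ.filter (fun t => t ≠ t0 ∧ t ≠ t1),
      (if m t = i - 1 then Pe ε i m t else 0) * (Rgen ε t0 t1 g) (Function.update m t i) =
      r1 ε (m t0) (m t1) * ∑ t ∈ Finset.univ.filter (fun t => t ≠ t0 ∧ t ≠ t1),
        (if m t = i - 1 then Pe ε i m t else 0) * g (Function.update m t i) +
      r2 (m t0) (m t1) * ∑ t ∈ Finset.univ.filter (fun t => t ≠ t0 ∧ t ≠ t1),
        (if (m ∘ Equiv.swap t0 t1) t = i - 1 then Pe ε i (m ∘ Equiv.swap t0 t1) t else 0) *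
          g (Function.update (m ∘ Equiv.swap t0 t1) t i) := by
    rw [Finset.mul_sum, Finset.mul_sum, ← Finset.sum_add_distrib]
    refine Finset.sum_congr rfl fun t ht => ?_
    have ht' : t ≠ t0 ∧ t ≠ t1 := by simpa using ht
    obtain ⟨h0, h1⟩ := ht'
    rw [Rgen_apply, Function.update_of_ne h0.symm, Function.update_of_ne h1.symm,
      Pe_swap ε i m t0 t1 t h01 h1]
    have e1 : (m ∘ Equiv.swap t0 t1) t = m t := by
      simp [Equiv.swap_apply_of_ne_of_ne h0 h1]
    have e2 : Function.update m t i ∘ Equiv.swap t0 t1 =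
        Function.update (m ∘ Equiv.swap t0 t1) t i := by
      funext s
      by_cases hs : s = t
      · subst hs; simp [Equiv.swap_apply_of_ne_of_ne h0 h1]
      · rw [Function.update_of_ne hs, Function.comp_apply, Function.update_of_ne]
        · rfl
        · intro h
          apply hs
          rw [← Equiv.swap_apply_of_ne_of_ne h0 h1] at h
          exact (Equiv.swap t0 t1).injective h
    rw [e1, e2]
    ring
  rw [hO]
  let G : Fin n → Fin n → K := fun x y => g (Function.update (Function.update m t0 x) t1 y)
  have g1 : g (Function.update m t0 i) = G i (m t1) := by
    change _ = g _
    congr 1; funext s; simp only [Function.update_apply]; split_ifs <;> simp_all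
  have g2 : g (Function.update m t1 i) = G (m t0) i := by
    change _ = g _
    congr 1; funext s; simp only [Function.update_apply]; split_ifs <;> simp_all
  have g3 : g (Function.update (m ∘ Equiv.swap t0 t1) t0 i) = G i (m t0) := by
    change _ = g _
    congr 1; funext s
    simp only [Function.update_apply, Function.comp_apply, Equiv.swap_apply_def]
    split_ifs <;> simp_all
  have g4 : g (Function.update (m ∘ Equiv.swap t0 t1) t1 i) = G (m t1) i := by
    change _ = g _
    congr 1; funext s
    simp only [Function.update_apply, Function.comp_apply, Equiv.swap_apply_def]
    split_ifs <;> simp_all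
  have g5 : g (Function.update m t0 i ∘ Equiv.swap t0 t1) = G (m t1) i := by
    change _ = g _
    congr 1; funext s
    simp only [Function.update_apply, Function.comp_apply, Equiv.swap_apply_def]
    split_ifs <;> simp_all
  have g6 : g (Function.update m t1 i ∘ Equiv.swap t0 t1) = G i (m t0) := by
    change _ = g _
    congr 1; funext s
    simp only [Function.update_apply, Function.comp_apply, Equiv.swap_apply_def]
    split_ifs <;> simp_all
  have m0 : (m ∘ Equiv.swap t0 t1) t0 = m t1 := by simp
  have m1 : (m ∘ Equiv.swap t0 t1) t1 = m t0 := by simp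
  rw [Rgen_apply, Rgen_apply, g1, g2, g3, g4, g5, g6, Function.update_self, Function.update_self,
    Function.update_of_ne hne, Function.update_of_ne hne.symm, Pe_succ ε i m t0 t1 h01,
    Pe_succ ε i (m ∘ Equiv.swap t0 t1) t0 t1 h01, Pe_swap ε i m t0 t1 t0 h01 hne, m0, m1]
  have key := congrArg (fun z => Pe ε i m t0 * z) (two_letter ε i hi (m t0) (m t1) G)
  have c1 : ∀ (p : Prop) [Decidable p] (x : K), (if p then Pe ε i m t0 * x else 0)
      = Pe ε i m t0 * (if p then x else 0) := fun p _ x => by split_ifs <;> simp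
  have c2 : ∀ (p : Prop) [Decidable p], (if p then Pe ε i m t0 else 0)
      = Pe ε i m t0 * (if p then 1 else 0) := fun p _ => by split_ifs <;> simp
  rw [c1, c1, c2, c2]
  linear_combination key

theorem f_comm_R {n ℓ : ℕ} [NeZero n] (ε : Fin n → Bool) (i : Fin n) (hi : i ≠ 0)
    (t0 t1 : Fin ℓ) (h01 : t1.1 = t0.1 + 1) :
    Rgen ε t0 t1 * fOpL n ℓ ε i = fOpL n ℓ ε i * Rgen ε t0 t1 := by
  have hR := R_adj (n := n) ε t0 t1
  have hf := f_adj (ℓ := ℓ) ε i hi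
  refine (hR.mul hf).unique ?_
  have := hf.mul hR
  rw [mul_smul_comm, ← mul_assoc, e_comm_R ε i hi t0 t1 h01, mul_assoc, qh_comm_R, ← mul_assoc,
    ← smul_mul_assoc] at this
  exact this

theorem U_comm_H {n ℓ : ℕ} [NeZero n] (ε : Fin n → Bool) (x y : Module.End K (Vl n ℓ))
    (hx : x ∈ UimageL n ℓ ε) (hy : y ∈ HimageL n ℓ ε) : x * y = y * x := by
  have h1 : UimageL n ℓ ε ≤ Subalgebra.centralizer K {x | ∃ t : Fin (ℓ - 1), x = Rsite n ℓ ε t} := by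
    refine Algebra.adjoin_le ?_
    rintro a ha
    rw [SetLike.mem_coe, Subalgebra.mem_centralizer_iff]
    rintro _ ⟨t, rfl⟩
    rw [Rsite_eq ε t ⟨t.1, by have := t.isLt; omega⟩ ⟨t.1 + 1, by have := t.isLt; omega⟩ rfl rfl]
    rcases ha with ⟨h, rfl⟩ | ⟨i, hi, rfl | rfl⟩
    · exact qh_comm_R _ _ _ _
    · exact e_comm_R _ _ hi _ _ rfl
    · exact f_comm_R _ _ hi _ _ rfl
  have h2 : HimageL n ℓ ε ≤ Subalgebra.centralizer K {x} := by
    refine Algebra.adjoin_le ?_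
    rintro a ha
    rw [SetLike.mem_coe, Subalgebra.mem_centralizer_iff]
    rintro _ rfl
    exact ((Subalgebra.mem_centralizer_iff K).1 (h1 hx) a ha).symm
  exact (Subalgebra.mem_centralizer_iff K).1 (h2 hy) x rfl



/-! ### Commutation relations and triangular decomposition -/

theorem kk_s2 {n : ℕ} [NeZero n] (ε : Fin n → Bool) (i j : Fin n) :
    kEntry ε j i * kinvEntry ε i j = kEntry ε j (i - 1) * kinvEntry ε i (j - 1) := by
  by_cases h : i = j
  · subst h
    rw [mul_comm, kinv_mul_k, mul_comm, kinv_mul_k]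
  · have h' : j ≠ i := Ne.symm h
    have A : (if j - 1 = i then qv ε i else 1) = (if i = j - 1 then qv ε (j - 1) else 1) := by
      by_cases h5 : i = j - 1
      · rw [if_pos h5.symm, if_pos h5, ← h5]
      · rw [if_neg (Ne.symm h5), if_neg h5]
    have B : (if i - 1 = j then (qv ε j)⁻¹ else 1) =
        (if j = i - 1 then (qv ε (i - 1))⁻¹ else 1) := by
      by_cases h5 : j = i - 1
      · rw [if_pos h5.symm, if_pos h5, ← h5]
      · rw [if_neg (Ne.symm h5), if_neg h5]
    unfold kEntry kinvEntry
    simp only [sub_left_inj, h, h', if_false, mul_one, one_mul]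
    rw [A, B, mul_comm]

theorem offdiag {n ℓ : ℕ} [NeZero n] (ε : Fin n → Bool) (i j : Fin n) (m : Fin ℓ → Fin n)
    (t s : Fin ℓ) (hts : s ≠ t) :
    (if m t = i - 1 then Pe ε i m t else 0) *
      (if Function.update m t i s = j then Pf ε j (Function.update m t i) s else 0) =
    (if m s = j then Pf ε j m s else 0) *
      (if Function.update m s (j - 1) t = i - 1 then Pe ε i (Function.update m s (j - 1)) t
        else 0) := by
  rw [Function.update_of_ne hts, Function.update_of_ne hts.symm]
  by_cases ht : m t = i - 1
  swap
  · simp [ht]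
  by_cases hs : m s = j
  swap
  · simp [hs]
  rw [if_pos ht, if_pos hs, if_pos hs, if_pos ht]
  rcases lt_or_gt_of_ne hts with h | h
  · -- s < t
    have e1 : Pf ε j (Function.update m t i) s * kEntry ε j (i - 1) =
        Pf ε j m s * kEntry ε j i := by
      have hmem : t ∈ Finset.univ.filter (fun r => s < r) := by simpa using h
      unfold Pf
      rw [← Finset.mul_prod_erase _ _ hmem, ← Finset.mul_prod_erase _ _ hmem, ht,
        Function.update_self]
      have : ∏ x ∈ (Finset.univ.filter (fun r => s < r)).erase t,
          kEntry ε j (Function.update m t i x) =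
          ∏ x ∈ (Finset.univ.filter (fun r => s < r)).erase t, kEntry ε j (m x) :=
        Finset.prod_congr rfl fun x hx => by
          rw [Function.update_of_ne (Finset.ne_of_mem_erase hx)]
      rw [this]; ring
    have e2 : Pe ε i (Function.update m s (j - 1)) t * kinvEntry ε i j =
        Pe ε i m t * kinvEntry ε i (j - 1) := by
      have hmem : s ∈ Finset.univ.filter (fun r => r < t) := by simpa using h
      unfold Pe
      rw [← Finset.mul_prod_erase _ _ hmem, ← Finset.mul_prod_erase _ _ hmem, hs,
        Function.update_self]
      have : ∏ x ∈ (Finset.univ.filter (fun r => r < t)).erase s,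
          kinvEntry ε i (Function.update m s (j - 1) x) =
          ∏ x ∈ (Finset.univ.filter (fun r => r < t)).erase s, kinvEntry ε i (m x) :=
        Finset.prod_congr rfl fun x hx => by
          rw [Function.update_of_ne (Finset.ne_of_mem_erase hx)]
      rw [this]; ring
    have e3 := kk_s2 ε i j
    have n1 := k_ne ε j (i - 1)
    have n2 := kinv_ne ε i j
    apply mul_right_cancel₀ n1
    apply mul_right_cancel₀ n2
    linear_combination (Pe ε i m t * kinvEntry ε i j) * e1 -
      (Pf ε j m s * kEntry ε j (i - 1)) * e2 + Pe ε i m t * Pf ε j m s * e3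
  · have e1 : Pf ε j (Function.update m t i) s = Pf ε j m s := by
      unfold Pf
      refine Finset.prod_congr rfl fun r hr => ?_
      have : s < r := by simpa using hr
      rw [Function.update_of_ne (ne_of_gt (h.trans this))]
    have e2 : Pe ε i (Function.update m s (j - 1)) t = Pe ε i m t := by
      unfold Pe
      refine Finset.prod_congr rfl fun r hr => ?_
      have : r < t := by simpa using hr
      rw [Function.update_of_ne (ne_of_lt (this.trans h))]
    rw [e1, e2, mul_comm]

theorem qqinv_ne : qq - qq⁻¹ ≠ 0 := by
  intro h
  have h1 : qq * qq = 1 := by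
    have := congrArg (fun z => qq * z) h
    simp only [mul_sub, mul_inv_cancel₀ qq_ne, mul_zero] at this
    exact sub_eq_zero.1 this
  have h2 : algebraMap (Polynomial ℚ) K (Polynomial.X ^ 2) = algebraMap (Polynomial ℚ) K 1 := by
    rw [map_pow, map_one, RatFunc.algebraMap_X, pow_two]; exact h1
  have h3 := IsFractionRing.injective (Polynomial ℚ) K h2
  have := congrArg Polynomial.natDegree h3
  simp at this

theorem k_sub {n : ℕ} [NeZero n] (ε : Fin n → Bool) (i p : Fin n) (hi : i ≠ 0) :
    kEntry ε i p - kinvEntry ε i p =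
      (qq - qq⁻¹) * ((if p = i - 1 then 1 else 0) - (if p = i then 1 else 0)) := by
  have hne := pred_ne hi
  have hq := qq_ne
  by_cases h : p = i - 1
  · subst h
    simp only [kEntry, kinvEntry, hne, if_true, if_false]
    unfold qv; split_ifs <;> field_simp <;> ring
  · by_cases h' : p = i
    · subst h'
      simp only [kEntry, kinvEntry, hne.symm, if_true, if_false]
      unfold qv; split_ifs <;> field_simp <;> ring
    · simp [kEntry, kinvEntry, h, h']

theorem e_f_rel {n ℓ : ℕ} [NeZero n] (ε : Fin n → Bool) (i j : Fin n) (hi : i ≠ 0) :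
    eOpL n ℓ ε i * fOpL n ℓ ε j = fOpL n ℓ ε j * eOpL n ℓ ε i +
      (if i = j then (qq - qq⁻¹)⁻¹ • (qhOpL n ℓ ε (κe ε i) - qhOpL n ℓ ε (-κe ε i)) else 0) := by
  have hne := pred_ne hi
  apply LinearMap.ext; intro g; funext m
  rw [LinearMap.add_apply, Pi.add_apply, Module.End.mul_apply, Module.End.mul_apply, e_apply,
    f_apply]
  simp only [f_apply, e_apply, Finset.mul_sum]
  rw [Finset.sum_comm (f := fun (x : Fin ℓ) (i_1 : Fin ℓ) => (if m x = j then Pf ε j m x else 0) *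
    ((if Function.update m x (j - 1) i_1 = i - 1 then
      Pe ε i (Function.update m x (j - 1)) i_1 else 0) *
      g (Function.update (Function.update m x (j - 1)) i_1 i)))]
  have hterm : ∀ t s : Fin ℓ, (if m t = i - 1 then Pe ε i m t else 0) *
      ((if Function.update m t i s = j then Pf ε j (Function.update m t i) s else 0) *
        g (Function.update (Function.update m t i) s (j - 1))) =
      (if m s = j then Pf ε j m s else 0) *
      ((if Function.update m s (j - 1) t = i - 1 then Pe ε i (Function.update m s (j - 1)) t
        else 0) * g (Function.update (Function.update m s (j - 1)) t i)) +
      (if s = t then (if i = j then ((if m t = i - 1 then 1 else 0) - (if m t = i then 1 else 0)) *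
        Pe ε i m t * Pf ε i m t * g m else 0) else 0) := by
    intro t s
    by_cases hst : s = t
    · subst hst
      rw [if_pos rfl, Function.update_self, Function.update_self, Pf_update, Pe_update,
        Function.update_idem, Function.update_idem]
      by_cases hij : i = j
      · subst hij
        rw [if_pos rfl, if_pos rfl, if_pos rfl]
        by_cases h1 : m s = i - 1
        · have h2 : m s ≠ i := h1 ▸ hne
          have h3 : Function.update m s (i - 1) = m := by rw [← h1, Function.update_eq_self]
          rw [h3]
          simp [h1, hne]; ring
        · by_cases h2 : m s = i
          · have h3 : Function.update m s i = m := by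
              nth_rewrite 1 [← h2]; rw [Function.update_eq_self]
            rw [h3]
            simp [h2, hne.symm]; ring
          · simp [h1, h2]
      · have hij' : j ≠ i := Ne.symm hij
        simp [hij, hij', sub_left_inj]
    · rw [if_neg hst, add_zero, ← mul_assoc, ← mul_assoc, offdiag ε i j m t s hst,
        Function.update_comm hst]
  simp only [hterm, Finset.sum_add_distrib]
  congr 1
  simp only [Finset.sum_ite_eq', Finset.mem_univ, if_true]
  by_cases hij : i = j
  · rw [if_pos hij]
    simp only [if_pos hij]
    rw [LinearMap.smul_apply, LinearMap.sub_apply, Pi.smul_apply, Pi.sub_apply, qh_apply, qh_apply,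
      smul_eq_mul, ← sub_mul, ← Finset.sum_mul, ← mul_assoc]
    congr 1
    simp only [qhEntry_k ε i _ hi, qhEntry_kinv ε i _ hi]
    have h1 := Finset.prod_add_ordered Finset.univ (fun t => kEntry ε i (m t))
      (fun t => kinvEntry ε i (m t) - kEntry ε i (m t))
    simp only [add_sub_cancel] at h1
    rw [h1, eq_inv_mul_iff_mul_eq₀ qqinv_ne, Finset.mul_sum, sub_add_cancel_left,
      ← Finset.sum_neg_distrib]
    refine Finset.sum_congr rfl fun t _ => ?_
    have h2 := k_sub ε i (m t) hi
    change _ = -((kinvEntry ε i (m t) - kEntry ε i (m t)) * Pe ε i m t * Pf ε i m t)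
    linear_combination -(Pe ε i m t * Pf ε i m t) * h2
  · simp [hij]

theorem qhEntry_ne {n : ℕ} (ε : Fin n → Bool) (h : Fin n → ℤ) (p : Fin n) :
    qhEntry ε h p ≠ 0 := zpow_ne_zero _ (qv_ne _ _)

theorem e_qh_rel {n ℓ : ℕ} [NeZero n] (ε : Fin n → Bool) (i : Fin n) (h : Fin n → ℤ) :
    eOpL n ℓ ε i * qhOpL n ℓ ε h =
      (qhEntry ε h i * (qhEntry ε h (i - 1))⁻¹) • (qhOpL n ℓ ε h * eOpL n ℓ ε i) := by
  apply LinearMap.ext; intro g; funext m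
  rw [LinearMap.smul_apply, Pi.smul_apply, Module.End.mul_apply, Module.End.mul_apply, e_apply,
    qh_apply, e_apply, smul_eq_mul, Finset.mul_sum, Finset.mul_sum]
  refine Finset.sum_congr rfl fun t _ => ?_
  rw [qh_apply]
  split_ifs with ht
  · have hmem := Finset.mem_univ t
    rw [← Finset.mul_prod_erase _ _ hmem, ← Finset.mul_prod_erase _ _ hmem, ht,
        Function.update_self]
    have : ∏ x ∈ Finset.univ.erase t,
        qhEntry ε h (Function.update m t i x) =
        ∏ x ∈ Finset.univ.erase t, qhEntry ε h (m x) :=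
      Finset.prod_congr rfl fun x hx => by
        rw [Function.update_of_ne (Finset.ne_of_mem_erase hx)]
    rw [this]
    have := qhEntry_ne ε h (i - 1)
    field_simp
  · simp

def Bm (n ℓ : ℕ) [NeZero n] (ε : Fin n → Bool) : Subalgebra K (Module.End K (Vl n ℓ)) :=
  Algebra.adjoin K ({x | ∃ h : Fin n → ℤ, x = qhOpL n ℓ ε h} ∪
     {x | ∃ i : Fin n, i ≠ 0 ∧ x = fOpL n ℓ ε i})

def Bp (n ℓ : ℕ) [NeZero n] (ε : Fin n → Bool) : Subalgebra K (Module.End K (Vl n ℓ)) :=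
  Algebra.adjoin K ({x | ∃ h : Fin n → ℤ, x = qhOpL n ℓ ε h} ∪
     {x | ∃ i : Fin n, i ≠ 0 ∧ x = eOpL n ℓ ε i})

theorem e_Bm {n ℓ : ℕ} [NeZero n] (ε : Fin n → Bool) (i : Fin n) (hi : i ≠ 0)
    (b : Module.End K (Vl n ℓ)) (hb : b ∈ Bm n ℓ ε) :
    ∃ b' ∈ Bm n ℓ ε, ∃ b'' ∈ Bm n ℓ ε, eOpL n ℓ ε i * b = b' + b'' * eOpL n ℓ ε i := by
  have hqh : ∀ h, qhOpL n ℓ ε h ∈ Bm n ℓ ε := fun h => Algebra.subset_adjoin (Or.inl ⟨h, rfl⟩)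
  unfold Bm at hb
  induction hb using Algebra.adjoin_induction with
  | mem x hx =>
    rcases hx with ⟨h, rfl⟩ | ⟨j, hj, rfl⟩
    · exact ⟨0, zero_mem _, _, Subalgebra.smul_mem _ (hqh h) _, by
        rw [e_qh_rel, zero_add, smul_mul_assoc]⟩
    · refine ⟨_, ?_, _, Algebra.subset_adjoin (Or.inr ⟨j, hj, rfl⟩), by
        rw [e_f_rel ε i j hi, add_comm]⟩
      split_ifs
      · exact Subalgebra.smul_mem _ (sub_mem (hqh _) (hqh _)) _
      · exact zero_mem _
  | algebraMap r =>
    exact ⟨0, zero_mem _, _, Subalgebra.algebraMap_mem _ r, by rw [zero_add, Algebra.commutes]⟩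
  | add x y _ _ hx hy =>
    obtain ⟨a, ha, b, hb, h1⟩ := hx
    obtain ⟨a', ha', b', hb', h2⟩ := hy
    exact ⟨_, add_mem ha ha', _, add_mem hb hb', by rw [mul_add, h1, h2, add_mul]; abel⟩
  | mul x y hx0 hy0 hx hy =>
    obtain ⟨a, ha, b, hb, h1⟩ := hx
    obtain ⟨a', ha', b', hb', h2⟩ := hy
    refine ⟨a * y + b * a', add_mem (mul_mem ha hy0) (mul_mem hb ha'), b * b', mul_mem hb hb', ?_⟩
    rw [← mul_assoc, h1, add_mul, mul_assoc, h2, mul_add, add_assoc, ← mul_assoc b b']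

theorem triangular {n ℓ : ℕ} [NeZero n] (ε : Fin n → Bool)
    (x : Module.End K (Vl n ℓ)) (hx : x ∈ UimageL n ℓ ε) :
    x ∈ Subalgebra.toSubmodule (Bm n ℓ ε) * Subalgebra.toSubmodule (Bp n ℓ ε) := by
  suffices h : ∀ y ∈ Subalgebra.toSubmodule (Bm n ℓ ε) * Subalgebra.toSubmodule (Bp n ℓ ε),
      x * y ∈ Subalgebra.toSubmodule (Bm n ℓ ε) * Subalgebra.toSubmodule (Bp n ℓ ε) by
    have h1 := h 1 (by
      have : (1 : Module.End K (Vl n ℓ)) = 1 * 1 := (mul_one 1).symm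
      rw [this]
      exact Submodule.mul_mem_mul (one_mem (Bm n ℓ ε)) (one_mem (Bp n ℓ ε)))
    rwa [mul_one] at h1
  unfold UimageL at hx
  induction hx using Algebra.adjoin_induction with
  | mem x hx =>
    have hm : ∀ a ∈ Bm n ℓ ε, ∀ y ∈ Subalgebra.toSubmodule (Bm n ℓ ε) *
        Subalgebra.toSubmodule (Bp n ℓ ε),
        a * y ∈ Subalgebra.toSubmodule (Bm n ℓ ε) * Subalgebra.toSubmodule (Bp n ℓ ε) := by
      intro a ha y hy
      induction hy using Submodule.mul_induction_on' with
      | mem_mul_mem b hb c hc =>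
        rw [← mul_assoc]
        exact Submodule.mul_mem_mul (mul_mem (S := Subalgebra K _) ha hb) hc
      | add y _ z _ h1 h2 => rw [mul_add]; exact add_mem h1 h2
    rcases hx with ⟨h, rfl⟩ | ⟨i, hi, rfl | rfl⟩
    · exact hm _ (Algebra.subset_adjoin (Or.inl ⟨h, rfl⟩))
    · intro y hy
      induction hy using Submodule.mul_induction_on' with
      | mem_mul_mem b hb c hc =>
        obtain ⟨b', hb', b'', hb'', h1⟩ := e_Bm ε i hi b hb
        rw [← mul_assoc, h1, add_mul, mul_assoc]
        refine add_mem (Submodule.mul_mem_mul hb' hc) (Submodule.mul_mem_mul hb'' ?_)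
        exact mul_mem (S := Subalgebra K _) (Algebra.subset_adjoin (Or.inr ⟨i, hi, rfl⟩)) hc
      | add y _ z _ h1 h2 => rw [mul_add]; exact add_mem h1 h2
    · exact hm _ (Algebra.subset_adjoin (Or.inr ⟨i, hi, rfl⟩))
  | algebraMap r =>
    intro y hy
    rw [← Algebra.smul_def]
    exact Submodule.smul_mem _ _ hy
  | add x y _ _ hx hy => intro z hz; rw [add_mul]; exact add_mem (hx z hz) (hy z hz)
  | mul x y _ _ hx hy => intro z hz; rw [mul_assoc]; exact hx _ (hy z hz)

theorem Bp_adj {n ℓ : ℕ} [NeZero n] (ε : Fin n → Bool) (a : Module.End K (Vl n ℓ))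
    (ha : a ∈ Bp n ℓ ε) : ∃ b ∈ Bm n ℓ ε, IsAdj a b := by
  refine adjoin_adj _ _ ?_ a ha
  have hqh : ∀ h, qhOpL n ℓ ε h ∈ Bm n ℓ ε := fun h => Algebra.subset_adjoin (Or.inl ⟨h, rfl⟩)
  rintro a (⟨h, rfl⟩ | ⟨i, hi, rfl⟩)
  · exact ⟨_, hqh h, qh_adj ε h⟩
  · exact ⟨_, Subalgebra.smul_mem _ (mul_mem (hqh _) (Algebra.subset_adjoin
      (Or.inr ⟨i, hi, rfl⟩))) _, e_adj ε i hi⟩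



/-! ### Truncation to a smaller set of letters -/

/-- restriction of coefficient functions to words in the letters from the image of `j` -/
def piT {n N : ℕ} (ℓ : ℕ) (j : Fin n → Fin N) : Vl N ℓ →ₗ[K] Vl n ℓ :=
  LinearMap.funLeft K K (fun m : Fin ℓ → Fin n => j ∘ m)

/-- extension by zero -/
def iotaT {n N : ℕ} (ℓ : ℕ) (j : Fin n → Fin N) : Vl n ℓ →ₗ[K] Vl N ℓ where
  toFun g := fun m' => ∑ m, if j ∘ m = m' then g m else 0
  map_add' g h := by
    funext m'
    simp only [Pi.add_apply, ← Finset.sum_add_distrib]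
    exact Finset.sum_congr rfl fun m _ => by split_ifs <;> simp
  map_smul' c g := by
    funext m'
    simp only [Pi.smul_apply, smul_eq_mul, RingHom.id_apply, Finset.mul_sum]
    exact Finset.sum_congr rfl fun m _ => by split_ifs <;> simp

theorem iota_adj {n N : ℕ} (ℓ : ℕ) (j : Fin n → Fin N) : IsAdj (iotaT ℓ j) (piT ℓ j) := by
  intro x y
  unfold dotp
  simp only [iotaT, piT, LinearMap.coe_mk, AddHom.coe_mk, Finset.sum_mul, LinearMap.funLeft_apply]
  rw [Finset.sum_comm]
  refine Finset.sum_congr rfl fun m _ => ?_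
  simp [ite_mul]

theorem pi_iota {n N : ℕ} (ℓ : ℕ) (j : Fin n → Fin N) (hj : Function.Injective j) (g : Vl n ℓ) :
    piT ℓ j (iotaT ℓ j g) = g := by
  funext m
  simp only [iotaT, piT, LinearMap.coe_mk, AddHom.coe_mk, LinearMap.funLeft_apply]
  have : ∀ m' : Fin ℓ → Fin n, j ∘ m' = j ∘ m ↔ m' = m := fun m' =>
    ⟨fun h => hj.comp_left h, fun h => by rw [h]⟩
  simp [this]

section trunc
variable {n N ℓ : ℕ} [NeZero n] [NeZero N] (ε : Fin n → Bool) (ε' : Fin N → Bool)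
  (j : Fin n → Fin N)

theorem j_pred (hj : ∀ p, (j p : ℕ) = p) (i : Fin n) (hi : i ≠ 0) (hi' : j i ≠ 0) :
    j i - 1 = j (i - 1) := by
  apply Fin.ext
  have h1 := pred_val hi
  have h2 := pred_val hi'
  rw [hj] at h2 ⊢
  omega

theorem qv_j (hε : ∀ p, ε' (j p) = ε p) (p : Fin n) : qv ε' (j p) = qv ε p := by
  unfold qv; rw [hε]

theorem pi_qh (hε : ∀ p, ε' (j p) = ε p) (h : Fin N → ℤ) (g : Vl N ℓ) :
    piT ℓ j (qhOpL N ℓ ε' h g) = qhOpL n ℓ ε (h ∘ j) (piT ℓ j g) := by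
  funext m
  change qhOpL N ℓ ε' h g (j ∘ m) = _
  rw [qh_apply, qh_apply]
  congr 1
  refine Finset.prod_congr rfl fun t _ => ?_
  simp only [qhEntry, Function.comp_apply, qv_j ε ε' j hε, sgn, hε]

theorem pi_f (hj : ∀ p, (j p : ℕ) = p) (hε : ∀ p, ε' (j p) = ε p) (i : Fin n) (hi : i ≠ 0)
    (g : Vl N ℓ) :
    piT ℓ j (fOpL N ℓ ε' (j i) g) = fOpL n ℓ ε i (piT ℓ j g) := by
  have hinj : Function.Injective j := fun a b h => Fin.ext (by rw [← hj a, ← hj b, h])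
  have hi' : j i ≠ 0 := fun h => hi (Fin.ext (by rw [← hj i, h]; simp))
  have hp := j_pred j hj i hi hi'
  funext m
  change fOpL N ℓ ε' (j i) g (j ∘ m) = _
  rw [f_apply, f_apply]
  refine Finset.sum_congr rfl fun t _ => ?_
  have h1 : Pf ε' (j i) (j ∘ m) t = Pf ε i m t := by
    unfold Pf
    refine Finset.prod_congr rfl fun s _ => ?_
    simp only [kEntry, Function.comp_apply, hp, hinj.eq_iff, qv_j ε ε' j hε]
  rw [h1, hp, ← Function.comp_update]
  simp only [Function.comp_apply, hinj.eq_iff]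
  rfl

theorem pi_f_zero (i : Fin N) (hi : ∀ p, j p ≠ i) (g : Vl N ℓ) :
    piT ℓ j (fOpL N ℓ ε' i g) = 0 := by
  funext m
  change fOpL N ℓ ε' i g (j ∘ m) = 0
  rw [f_apply]
  refine Finset.sum_eq_zero fun t _ => ?_
  rw [if_neg (show ¬ (j ∘ m) t = i from hi _), zero_mul]

theorem pi_Bm (hj : ∀ p, (j p : ℕ) = p) (hε : ∀ p, ε' (j p) = ε p)
    (b : Module.End K (Vl N ℓ)) (hb : b ∈ Bm N ℓ ε') :
    ∃ y ∈ UimageL n ℓ ε, ∀ g, piT ℓ j (b g) = y (piT ℓ j g) := by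
  unfold Bm at hb
  induction hb using Algebra.adjoin_induction with
  | mem x hx =>
    rcases hx with ⟨h, rfl⟩ | ⟨i, hi, rfl⟩
    · exact ⟨_, U_qh ε _, pi_qh ε ε' j hε h⟩
    · by_cases h : ∃ p, j p = i
      · obtain ⟨p, rfl⟩ := h
        have hp : p ≠ 0 := fun h => hi (Fin.ext (by rw [hj, h]; simp))
        exact ⟨_, U_f ε p hp, pi_f ε ε' j hj hε p hp⟩
      · push Not at h
        exact ⟨0, zero_mem _, fun g => by rw [pi_f_zero ε' j i h]; rfl⟩
  | algebraMap r =>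
    exact ⟨_, Subalgebra.algebraMap_mem _ r, fun g => by
      rw [Module.algebraMap_end_apply, Module.algebraMap_end_apply, map_smul]⟩
  | add x y _ _ hx hy =>
    obtain ⟨a, ha, h1⟩ := hx
    obtain ⟨a', ha', h2⟩ := hy
    exact ⟨_, add_mem ha ha', fun g => by
      rw [LinearMap.add_apply, map_add, h1, h2, LinearMap.add_apply]⟩
  | mul x y hx0 hy0 hx hy =>
    obtain ⟨a, ha, h1⟩ := hx
    obtain ⟨a', ha', h2⟩ := hy
    exact ⟨_, mul_mem ha ha', fun g => by
      rw [Module.End.mul_apply, h1, h2, Module.End.mul_apply]⟩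

theorem Bp_iota (hj : ∀ p, (j p : ℕ) = p) (hε : ∀ p, ε' (j p) = ε p)
    (b : Module.End K (Vl N ℓ)) (hb : b ∈ Bp N ℓ ε') :
    ∃ y ∈ UimageL n ℓ ε, ∀ g, b (iotaT ℓ j g) = iotaT ℓ j (y g) := by
  obtain ⟨b', hb', hbb⟩ := Bp_adj ε' b hb
  obtain ⟨y, hy, h1⟩ := pi_Bm ε ε' j hj hε b' hb'
  obtain ⟨y', hy', hyy⟩ := U_adj ε y hy
  refine ⟨y', hy', fun g => dotp_ext fun z => ?_⟩
  rw [hbb, iota_adj, h1, iota_adj]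
  exact (hyy.symm g _).symm

theorem trunc_U (hj : ∀ p, (j p : ℕ) = p) (hε : ∀ p, ε' (j p) = ε p)
    (x : Module.End K (Vl N ℓ)) (hx : x ∈ UimageL N ℓ ε') :
    ∃ y ∈ UimageL n ℓ ε, ∀ g, piT ℓ j (x (iotaT ℓ j g)) = y g := by
  have hinj : Function.Injective j := fun a b h => Fin.ext (by rw [← hj a, ← hj b, h])
  have hx' := triangular ε' x hx
  clear hx
  induction hx' using Submodule.mul_induction_on' with
  | mem_mul_mem b hb c hc =>
    obtain ⟨y, hy, h1⟩ := pi_Bm ε ε' j hj hε b hb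
    obtain ⟨z, hz, h2⟩ := Bp_iota ε ε' j hj hε c hc
    exact ⟨y * z, mul_mem hy hz, fun g => by
      rw [Module.End.mul_apply, h2, h1, pi_iota ℓ j hinj, Module.End.mul_apply]⟩
  | add x _ y _ hxx hyy =>
    obtain ⟨a, ha, h1⟩ := hxx
    obtain ⟨a', ha', h2⟩ := hyy
    exact ⟨_, add_mem ha ha', fun g => by
      rw [LinearMap.add_apply, map_add, h1, h2, LinearMap.add_apply]⟩

/-- `R` is compatible with truncation. -/
theorem pi_R (hj : ∀ p, (j p : ℕ) = p) (hε : ∀ p, ε' (j p) = ε p) (t0 t1 : Fin ℓ) (g : Vl N ℓ) :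
    piT ℓ j (Rgen ε' t0 t1 g) = Rgen ε t0 t1 (piT ℓ j g) := by
  have hinj : Function.Injective j := fun a b h => Fin.ext (by rw [← hj a, ← hj b, h])
  funext m
  change Rgen ε' t0 t1 g (j ∘ m) = _
  rw [Rgen_apply, Rgen_apply]
  have hlt : ∀ a b, j a < j b ↔ a < b := fun a b => by rw [Fin.lt_def, Fin.lt_def, hj, hj]
  simp only [r1, r2, Function.comp_apply, hinj.eq_iff, hlt, qv_j ε ε' j hε]
  rfl

theorem R_iota (hj : ∀ p, (j p : ℕ) = p) (hε : ∀ p, ε' (j p) = ε p) (t0 t1 : Fin ℓ) (g : Vl n ℓ) :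
    Rgen ε' t0 t1 (iotaT ℓ j g) = iotaT ℓ j (Rgen ε t0 t1 g) :=
  dotp_ext fun z => by
    rw [R_adj, iota_adj, pi_R ε ε' j hj hε, ← R_adj, iota_adj]

/-- extension by zero of an endomorphism commuting with `H` commutes with `H`. -/
theorem ext_comm (hj : ∀ p, (j p : ℕ) = p) (hε : ∀ p, ε' (j p) = ε p)
    (x : Module.End K (Vl n ℓ)) (hx : ∀ y ∈ HimageL n ℓ ε, y * x = x * y)
    (y : Module.End K (Vl N ℓ)) (hy : y ∈ HimageL N ℓ ε') :
    y * (iotaT ℓ j ∘ₗ x ∘ₗ piT ℓ j) = (iotaT ℓ j ∘ₗ x ∘ₗ piT ℓ j) * y := by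
  have h2 : HimageL N ℓ ε' ≤ Subalgebra.centralizer K {iotaT ℓ j ∘ₗ x ∘ₗ piT ℓ j} := by
    refine Algebra.adjoin_le ?_
    rintro a ⟨t, rfl⟩
    rw [SetLike.mem_coe, Subalgebra.mem_centralizer_iff]
    rintro _ rfl
    have h0 := hx _ (Algebra.subset_adjoin ⟨t, rfl⟩)
    rw [Rsite_eq ε t ⟨t.1, by have := t.isLt; omega⟩ ⟨t.1 + 1, by have := t.isLt; omega⟩
      rfl rfl] at h0
    rw [Rsite_eq ε' t ⟨t.1, by have := t.isLt; omega⟩ ⟨t.1 + 1, by have := t.isLt; omega⟩ rfl rfl]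
    apply LinearMap.ext
    intro g
    simp only [Module.End.mul_apply, LinearMap.comp_apply]
    rw [pi_R ε ε' j hj hε, R_iota ε ε' j hj hε]
    congr 1
    exact (LinearMap.congr_fun h0 _).symm
  exact ((Subalgebra.mem_centralizer_iff K).1 (h2 hy) _ rfl).symm
end trunc



/-! ### Action on basis vectors -/

/-- the basis vector indexed by a word -/
def bv {n ℓ : ℕ} (x : Fin ℓ → Fin n) : Vl n ℓ := fun m => if m = x then 1 else 0

theorem bv_decomp {n ℓ : ℕ} (g : Vl n ℓ) : g = ∑ x, g x • bv x := by
  funext m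
  simp [bv, Finset.sum_apply]

theorem e_bv {n ℓ : ℕ} [NeZero n] (ε : Fin n → Bool) (i : Fin n) (x : Fin ℓ → Fin n) :
    eOpL n ℓ ε i (bv x) =
      ∑ t, if x t = i then Pe ε i x t • bv (Function.update x t (i - 1)) else 0 := by
  funext m
  rw [e_apply, Finset.sum_apply]
  refine Finset.sum_congr rfl fun t _ => ?_
  by_cases h : m t = i - 1 ∧ Function.update m t i = x
  · obtain ⟨h1, rfl⟩ := h
    have h2 : Function.update m t (i - 1) = m := by rw [← h1, Function.update_eq_self]
    simp [bv, h1, h2, Pe_update]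
  · have h2 : ¬ (x t = i ∧ m = Function.update x t (i - 1)) := by
      rintro ⟨h1, rfl⟩
      apply h
      refine ⟨by simp, ?_⟩
      rw [← h1]; simp
    have e1 : (if m t = i - 1 then Pe ε i m t else 0) * bv x (Function.update m t i) = 0 := by
      by_cases h3 : m t = i - 1
      · have : ¬ Function.update m t i = x := fun h4 => h ⟨h3, h4⟩
        simp [bv, this]
      · simp [h3]
    rw [e1]
    by_cases h3 : x t = i
    · have : ¬ m = Function.update x t (i - 1) := fun h4 => h2 ⟨h3, h4⟩
      simp [bv, this, h3]
    · simp [h3]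

theorem f_bv {n ℓ : ℕ} [NeZero n] (ε : Fin n → Bool) (i : Fin n) (x : Fin ℓ → Fin n) :
    fOpL n ℓ ε i (bv x) =
      ∑ t, if x t = i - 1 then Pf ε i x t • bv (Function.update x t i) else 0 := by
  funext m
  rw [f_apply, Finset.sum_apply]
  refine Finset.sum_congr rfl fun t _ => ?_
  by_cases h : m t = i ∧ Function.update m t (i - 1) = x
  · obtain ⟨h1, rfl⟩ := h
    have h2 : Function.update m t i = m := by rw [← h1, Function.update_eq_self]
    simp [bv, h1, h2, Pf_update]
  · have h2 : ¬ (x t = i - 1 ∧ m = Function.update x t i) := by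
      rintro ⟨h1, rfl⟩
      apply h
      refine ⟨by simp, ?_⟩
      rw [← h1]; simp
    have e1 : (if m t = i then Pf ε i m t else 0) * bv x (Function.update m t (i - 1)) = 0 := by
      by_cases h3 : m t = i
      · have : ¬ Function.update m t (i - 1) = x := fun h4 => h ⟨h3, h4⟩
        simp [bv, this]
      · simp [h3]
    rw [e1]
    by_cases h3 : x t = i - 1
    · have : ¬ m = Function.update x t i := fun h4 => h2 ⟨h3, h4⟩
      simp [bv, this, h3]
    · simp [h3]

theorem e_bv_one {n ℓ : ℕ} [NeZero n] (ε : Fin n → Bool) (i : Fin n) (x : Fin ℓ → Fin n)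
    (t : Fin ℓ) (h : ∀ s, x s = i ↔ s = t) :
    eOpL n ℓ ε i (bv x) = Pe ε i x t • bv (Function.update x t (i - 1)) := by
  rw [e_bv]; simp [h]

theorem f_bv_one {n ℓ : ℕ} [NeZero n] (ε : Fin n → Bool) (i : Fin n) (x : Fin ℓ → Fin n)
    (t : Fin ℓ) (h : ∀ s, x s = i - 1 ↔ s = t) :
    fOpL n ℓ ε i (bv x) = Pf ε i x t • bv (Function.update x t i) := by
  rw [f_bv]; simp [h]

theorem R_bv {n ℓ : ℕ} (ε : Fin n → Bool) (t0 t1 : Fin ℓ) (x : Fin ℓ → Fin n) (h : x t0 ≠ x t1) :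
    Rgen ε t0 t1 (bv x) = r1 ε (x t0) (x t1) • bv x + qq⁻¹ • bv (x ∘ Equiv.swap t0 t1) := by
  funext m
  rw [Rgen_apply]
  have h3 : m ∘ Equiv.swap t0 t1 = x ↔ m = x ∘ Equiv.swap t0 t1 := by
    constructor <;> (rintro rfl; funext s; simp)
  simp only [Pi.add_apply, Pi.smul_apply, smul_eq_mul, bv, h3]
  congr 1
  · by_cases h1 : m = x
    · rw [h1]
    · simp [h1]
  · by_cases h1 : m = x ∘ Equiv.swap t0 t1
    · subst h1
      simp [r2, h.symm]
    · simp [h1]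

/-! ### Weights -/

theorem qh_two {n ℓ : ℕ} (ε : Fin n → Bool) (p : Fin n) (m : Fin ℓ → Fin n) :
    ∏ t, qhEntry ε (fun r => if r = p then 2 else 0) (m t) =
      qq ^ (2 * (Finset.univ.filter (fun t => m t = p)).card) := by
  have h : ∀ t, qhEntry ε (fun r => if r = p then 2 else 0) (m t) =
      if m t = p then qq ^ 2 else 1 := by
    intro t
    unfold qhEntry
    by_cases h : m t = p
    · simp only [h, if_true]
      unfold qv sgn
      have h2 := qq_ne
      split_ifs
      · rw [show ((-1 : ℤ) * 2) = -2 by norm_num, zpow_neg]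
        rw [show ((2 : ℤ)) = ((2 : ℕ) : ℤ) by norm_num, zpow_natCast]
        field_simp
      · rw [one_mul]; norm_cast
    · simp only [h, if_false, mul_zero, zpow_zero]
  rw [Finset.prod_congr rfl fun t _ => h t, Finset.prod_ite, Finset.prod_const, Finset.prod_const_one,
    mul_one, ← pow_mul]

theorem qq_pow_inj {a b : ℕ} (h : qq ^ a = qq ^ b) : a = b := by
  have h2 : algebraMap (Polynomial ℚ) K (Polynomial.X ^ a) =
      algebraMap (Polynomial ℚ) K (Polynomial.X ^ b) := by
    simpa [qq, RatFunc.algebraMap_X] using h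
  have h3 := RatFunc.algebraMap_injective ℚ h2
  simpa using congrArg Polynomial.natDegree h3

theorem wt {n ℓ : ℕ} [NeZero n] (ε : Fin n → Bool) (T : Module.End K (Vl n ℓ))
    (hT : ∀ a ∈ UimageL n ℓ ε, a * T = T * a) (x m : Fin ℓ → Fin n) (h : T (bv x) m ≠ 0)
    (p : Fin n) : (Finset.univ.filter (fun t => m t = p)).card =
      (Finset.univ.filter (fun t => x t = p)).card := by
  have h1 := congrFun (LinearMap.congr_fun
    (hT _ (U_qh ε (fun r => if r = p then 2 else 0))) (bv x)) m
  have h2 : qhOpL n ℓ ε (fun r => if r = p then 2 else 0) (bv x) =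
      qq ^ (2 * (Finset.univ.filter (fun t => x t = p)).card) • bv x := by
    funext m
    rw [qh_apply, Pi.smul_apply, smul_eq_mul]
    by_cases h : m = x
    · rw [h, qh_two]
    · simp [bv, h]
  rw [Module.End.mul_apply, Module.End.mul_apply, h2, map_smul, qh_apply, qh_two, Pi.smul_apply,
    smul_eq_mul] at h1
  have := qq_pow_inj (mul_right_cancel₀ h h1)
  omega

/-! ### The regular vector -/

theorem perm_induction {ℓ : ℕ} (P : Equiv.Perm (Fin ℓ) → Prop) (h1 : P 1)
    (hs : ∀ σ (s0 s1 : Fin ℓ), (s1 : ℕ) = s0 + 1 → P σ → P (σ * Equiv.swap s0 s1)) (σ) : P σ := by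
  rcases ℓ with _ | k
  · rwa [Subsingleton.elim σ 1]
  · have h := Equiv.Perm.mclosure_swap_castSucc_succ k
    have hm : σ ∈ Submonoid.closure
      (Set.range fun i : Fin k => Equiv.swap i.castSucc i.succ) := by rw [h]; trivial
    induction hm using Submonoid.closure_induction_right with
    | one => exact h1
    | mul_right x hx y hy ih =>
      obtain ⟨i, rfl⟩ := hy
      exact hs _ _ _ (by simp) (ih)

theorem reg_H {N ℓ : ℕ} [NeZero N] (ε : Fin N → Bool) (w : Fin ℓ → Fin N)
    (hw : Function.Injective w) (σ : Equiv.Perm (Fin ℓ)) :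
    ∃ h ∈ HimageL N ℓ ε, h (bv w) = bv (w ∘ σ) := by
  refine perm_induction (fun σ => ∃ h ∈ HimageL N ℓ ε, h (bv w) = bv (w ∘ σ))
    ⟨1, one_mem _, rfl⟩ ?_ σ
  rintro σ s0 s1 hs ⟨h, hh, h1⟩
  have hne : (w ∘ σ) s0 ≠ (w ∘ σ) s1 := fun h => by
    have := σ.injective (hw h)
    rw [this] at hs; omega
  have h2 := R_bv ε s0 s1 (w ∘ σ) hne
  have hR : Rgen ε s0 s1 ∈ HimageL N ℓ ε := by
    have := s1.isLt
    rw [← Rsite_eq ε ⟨s0, by omega⟩ s0 s1 rfl hs]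
    exact Algebra.subset_adjoin ⟨_, rfl⟩
  refine ⟨qq • (Rgen ε s0 s1 * h - r1 ε ((w ∘ σ) s0) ((w ∘ σ) s1) • h),
    Subalgebra.smul_mem _ (sub_mem (mul_mem hR hh) (Subalgebra.smul_mem _ hh _)) _, ?_⟩
  rw [LinearMap.smul_apply, LinearMap.sub_apply, LinearMap.smul_apply, Module.End.mul_apply, h1, h2,
    add_sub_cancel_left, smul_smul, mul_inv_cancel₀ qq_ne, one_smul]
  rfl

theorem reg_T {N ℓ : ℕ} [NeZero N] (ε : Fin N → Bool) (w : Fin ℓ → Fin N)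
    (hw : Function.Injective w) (T : Module.End K (Vl N ℓ))
    (hT : ∀ a ∈ UimageL N ℓ ε, a * T = T * a) :
    ∃ h ∈ HimageL N ℓ ε, T (bv w) = h (bv w) := by
  have key : ∀ m, T (bv w) m ≠ 0 → ∃ h ∈ HimageL N ℓ ε, h (bv w) = bv m := by
    intro m hm
    have h1 : ∀ s, ∃ t, m t = w s := by
      intro s
      have h2 := wt ε T hT w m hm (w s)
      have h3 : 0 < (Finset.univ.filter (fun t => m t = w s)).card := by
        rw [h2, Finset.card_pos]
        exact ⟨s, by simp⟩
      obtain ⟨t, ht⟩ := Finset.card_pos.1 h3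
      exact ⟨t, (Finset.mem_filter.1 ht).2⟩
    choose τ hτ using h1
    have hinj : Function.Injective τ := fun a b h => hw (by rw [← hτ, ← hτ, h])
    let e := Equiv.ofBijective τ (Finite.injective_iff_bijective.1 hinj)
    obtain ⟨h, hh, h1⟩ := reg_H ε w hw e.symm
    refine ⟨h, hh, h1.trans (congrArg bv ?_)⟩
    funext t
    change w (e.symm t) = m t
    rw [← hτ]
    change m (e (e.symm t)) = _
    rw [Equiv.apply_symm_apply]
  have key2 : ∀ m, ∃ h ∈ HimageL N ℓ ε, h (bv w) = T (bv w) m • bv m := by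
    intro m
    by_cases h0 : T (bv w) m = 0
    · exact ⟨0, zero_mem _, by rw [h0, zero_smul]; rfl⟩
    · obtain ⟨h, hh, h1⟩ := key m h0
      exact ⟨_, Subalgebra.smul_mem _ hh (T (bv w) m), by rw [LinearMap.smul_apply, h1]⟩
  choose h hh h1 using key2
  refine ⟨∑ m, h m, sum_mem fun m _ => hh m, ?_⟩
  rw [LinearMap.sum_apply, Finset.sum_congr rfl fun m _ => h1 m]
  exact bv_decomp _



theorem letter_swap {N ℓ : ℕ} [NeZero N] (ε : Fin N → Bool) (D : Module.End K (Vl N ℓ))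
    (hD : ∀ a ∈ UimageL N ℓ ε, a * D = D * a) (x : Fin ℓ → Fin N) (i : Fin N) (hi : i ≠ 0)
    (t0 t1 : Fin ℓ) (h0 : ∀ s, x s = i - 1 ↔ s = t0) (h1 : ∀ s, x s = i ↔ s = t1)
    (hx : D (bv x) = 0) : D (bv (x ∘ Equiv.swap t0 t1)) = 0 := by
  have hne : t0 ≠ t1 := by
    rintro rfl
    exact pred_ne hi (((h0 t0).2 rfl).symm.trans ((h1 t0).2 rfl))
  have hc := LinearMap.congr_fun (hD _ (mul_mem (U_e ε i hi) (U_f ε i hi))) (bv x)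
  rw [Module.End.mul_apply, hx, map_zero, Module.End.mul_apply, Module.End.mul_apply,
    f_bv_one ε i x t0 h0, map_smul, map_smul, e_bv] at hc
  have hc2 := (smul_eq_zero.1 hc.symm).resolve_left (Pf_ne _ _ _ _)
  have hz : ∀ s, Function.update x t0 i s = i ↔ s = t0 ∨ s = t1 := by
    intro s
    by_cases h : s = t0
    · subst h; simp
    · rw [Function.update_of_ne h, h1]; simp [h]
  have h2 : (∑ t, if Function.update x t0 i t = i then
      Pe ε i (Function.update x t0 i) t •
        bv (Function.update (Function.update x t0 i) t (i - 1)) else 0) =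
      Pe ε i (Function.update x t0 i) t0 • bv x +
      Pe ε i (Function.update x t0 i) t1 • bv (x ∘ Equiv.swap t0 t1) := by
    rw [← Finset.sum_subset (Finset.subset_univ {t0, t1}), Finset.sum_pair hne,
      if_pos ((hz _).2 (Or.inl rfl)), if_pos ((hz _).2 (Or.inr rfl))]
    · congr 3
      · rw [Function.update_idem, ← (h0 t0).2 rfl, Function.update_eq_self]
      · funext s
        by_cases e1 : s = t1
        · subst e1
          rw [Function.update_self, Function.comp_apply, Equiv.swap_apply_right, (h0 t0).2 rfl]
        · rw [Function.update_of_ne e1]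
          by_cases e0 : s = t0
          · subst e0
            rw [Function.update_self, Function.comp_apply, Equiv.swap_apply_left, (h1 t1).2 rfl]
          · rw [Function.update_of_ne e0, Function.comp_apply, Equiv.swap_apply_of_ne_of_ne e0 e1]
    · intro s _ hs
      rw [if_neg]
      rw [hz]
      simpa using hs
  rw [h2, map_add, map_smul, map_smul, hx, smul_zero, zero_add] at hc2
  exact (smul_eq_zero.1 hc2).resolve_left (Pe_ne _ _ _ _)

theorem natAdd_ne {n ℓ : ℕ} [NeZero n] [NeZero (n + ℓ)] (s : Fin ℓ) :
    (Fin.natAdd n s : Fin (n + ℓ)) ≠ 0 := by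
  intro h
  have := congrArg Fin.val h
  have h2 := NeZero.pos n
  simp at this
  omega

theorem kill_perm {n ℓ : ℕ} [NeZero n] [NeZero (n + ℓ)] (ε : Fin (n + ℓ) → Bool)
    (D : Module.End K (Vl (n + ℓ) ℓ))
    (hD : ∀ a ∈ UimageL (n + ℓ) ℓ ε, a * D = D * a) (h0 : D (bv (Fin.natAdd n)) = 0)
    (σ : Equiv.Perm (Fin ℓ)) : D (bv (Fin.natAdd n ∘ σ)) = 0 := by
  suffices h : ∀ σ : Equiv.Perm (Fin ℓ), D (bv (Fin.natAdd n ∘ (σ⁻¹ : Equiv.Perm (Fin ℓ)))) = 0 by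
    have := h σ⁻¹
    rwa [inv_inv] at this
  refine perm_induction _ h0 ?_
  intro σ s0 s1 hs ih
  have hi := natAdd_ne (n := n) s1
  have hp : (Fin.natAdd n s1 : Fin (n + ℓ)) - 1 = Fin.natAdd n s0 := by
    apply Fin.ext
    have := pred_val hi
    simp only [Fin.val_natAdd] at this ⊢
    omega
  have key := letter_swap ε D hD (Fin.natAdd n ∘ (σ⁻¹ : Equiv.Perm (Fin ℓ))) (Fin.natAdd n s1) hi
    (σ s0) (σ s1) ?_ ?_ ih
  · rw [← key]
    congr 2
    rw [mul_inv_rev, Equiv.swap_inv]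
    funext t
    simp only [Function.comp_apply, Equiv.Perm.mul_apply]
    congr 1
    have := Equiv.swap_mul_eq_mul_swap (σ⁻¹) s0 s1
    rw [inv_inv] at this
    exact DFunLike.congr_fun this t
  · intro s
    rw [hp, Function.comp_apply, (Fin.natAdd_injective ℓ n).eq_iff]
    exact Equiv.symm_apply_eq σ
  · intro s
    rw [Function.comp_apply, (Fin.natAdd_injective ℓ n).eq_iff]
    exact Equiv.symm_apply_eq σ

theorem kill_word {n ℓ : ℕ} [NeZero n] [NeZero (n + ℓ)] (ε : Fin (n + ℓ) → Bool)
    (D : Module.End K (Vl (n + ℓ) ℓ))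
    (hD : ∀ a ∈ UimageL (n + ℓ) ℓ ε, a * D = D * a) (h0 : D (bv (Fin.natAdd n)) = 0)
    (ρ : Equiv.Perm (Fin ℓ)) (x : Fin ℓ → Fin (n + ℓ)) (hm : Monotone (x ∘ ρ))
    (hb : ∀ k : Fin ℓ, (x (ρ k) : ℕ) ≤ n + k) : D (bv x) = 0 := by
  induction hd : ∑ t, (n + ℓ - (x t : ℕ)) using Nat.strong_induction_on generalizing x with
  | _ d ih =>
  by_cases htop : ∃ k : Fin ℓ, (x (ρ k) : ℕ) < n + k
  · obtain ⟨k, hk, hmax⟩ : ∃ k : Fin ℓ, (x (ρ k) : ℕ) < n + k ∧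
        ∀ k', k < k' → (x (ρ k') : ℕ) = n + k' := by
      let S := Finset.univ.filter (fun k : Fin ℓ => (x (ρ k) : ℕ) < n + k)
      have hS : S.Nonempty := by
        obtain ⟨k, hk⟩ := htop
        exact ⟨k, by simp [S, hk]⟩
      refine ⟨S.max' hS, (Finset.mem_filter.1 (S.max'_mem hS)).2, fun k' hk' => ?_⟩
      by_contra hne
      have : k' ∈ S := Finset.mem_filter.2 ⟨Finset.mem_univ _, lt_of_le_of_ne (hb k') hne⟩
      exact absurd (S.le_max' _ this) (not_le.2 hk')
    have hkl := k.isLt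
    let a : Fin (n + ℓ) := ⟨(x (ρ k) : ℕ) + 1, by omega⟩
    have ha0 : a ≠ 0 := by
      intro h
      have := congrArg Fin.val h
      simp [a] at this
    have ha1 : a - 1 = x (ρ k) := by
      apply Fin.ext
      have := pred_val ha0
      simp only [a] at this ⊢
      omega
    let y := Function.update x (ρ k) a
    have hy0 : y (ρ k) = a := Function.update_self ..
    have hyk : ∀ k', k' ≠ k → y (ρ k') = x (ρ k') := fun k' h =>
      Function.update_of_ne (fun h' => h (ρ.injective h')) _ _
    have hlt : ∀ k', k' < k → (x (ρ k') : ℕ) ≤ x (ρ k) := fun k' h => hm h.le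
    have hyD : D (bv y) = 0 := by
      refine ih _ ?_ y ?_ ?_ rfl
      · rw [← hd]
        refine Finset.sum_lt_sum (fun t _ => ?_) ⟨ρ k, Finset.mem_univ _, ?_⟩
        · by_cases h : t = ρ k
          · subst h
            rw [hy0]; simp only [a]; omega
          · simp only [y]
            rw [Function.update_of_ne h]
        · rw [hy0]; simp only [a]; omega
      · intro k1 k2 h12
        rcases h12.lt_or_eq with h12 | rfl
        · change (y (ρ k1) : ℕ) ≤ y (ρ k2)
          by_cases e1 : k1 = k
          · subst e1
            rw [hy0, hyk _ h12.ne', hmax _ h12]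
            have : (k1 : ℕ) < k2 := h12
            simp only [a]; omega
          · rw [hyk _ e1]
            by_cases e2 : k2 = k
            · subst e2
              rw [hy0]
              have := hlt _ h12
              simp only [a]; omega
            · rw [hyk _ e2]
              exact hm h12.le
        · exact le_rfl
      · intro k'
        by_cases e1 : k' = k
        · subst e1; rw [hy0]; simp only [a]; omega
        · rw [hyk _ e1]; exact hb k'
    have hone : ∀ s, y s = a ↔ s = ρ k := by
      intro s
      constructor
      · intro h
        by_contra hs
        obtain ⟨k', rfl⟩ := ρ.surjective s
        have hk' : k' ≠ k := fun h => hs (by rw [h])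
        rw [hyk _ hk'] at h
        have h := congrArg Fin.val h
        simp only [a] at h
        rcases lt_or_gt_of_ne hk' with h2 | h2
        · have := hlt _ h2; omega
        · have := hmax _ h2
          have h3 : (k : ℕ) < k' := h2
          omega
      · rintro rfl; exact hy0
    have hc := LinearMap.congr_fun (hD _ (U_e ε a ha0)) (bv y)
    rw [Module.End.mul_apply, Module.End.mul_apply, hyD, map_zero, e_bv_one ε a y (ρ k) hone,
      map_smul] at hc
    have hc2 := (smul_eq_zero.1 hc.symm).resolve_left (Pe_ne _ _ _ _)
    have : Function.update y (ρ k) (a - 1) = x := by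
      simp only [y]
      rw [Function.update_idem, ha1, Function.update_eq_self]
    rwa [this] at hc2
  · push Not at htop
    have : x = Fin.natAdd n ∘ (ρ⁻¹ : Equiv.Perm (Fin ℓ)) := by
      funext t
      apply Fin.ext
      have h1 := htop (ρ⁻¹ t)
      have h2 := hb (ρ⁻¹ t)
      have h3 : ρ (ρ⁻¹ t) = t := Equiv.apply_symm_apply ρ t
      rw [h3] at h1 h2
      simp only [Function.comp_apply, Fin.val_natAdd]
      omega
    rw [this]
    exact kill_perm ε D hD h0 _

theorem T_iota {n ℓ : ℕ} [NeZero n] [NeZero (n + ℓ)] (ε : Fin (n + ℓ) → Bool)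
    (T : Module.End K (Vl (n + ℓ) ℓ))
    (hT : ∀ a ∈ UimageL (n + ℓ) ℓ ε, a * T = T * a) :
    ∃ h ∈ HimageL (n + ℓ) ℓ ε, ∀ m : Fin ℓ → Fin n,
      T (bv (Fin.castAdd ℓ ∘ m)) = h (bv (Fin.castAdd ℓ ∘ m)) := by
  obtain ⟨h, hh, h1⟩ := reg_T ε (Fin.natAdd n) (Fin.natAdd_injective _ _) T hT
  refine ⟨h, hh, fun m => sub_eq_zero.1 ?_⟩
  rw [← LinearMap.sub_apply]
  refine kill_word ε (T - h) ?_ ?_ (Tuple.sort m) _ ?_ ?_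
  · intro a ha
    rw [mul_sub, sub_mul, hT a ha, U_comm_H ε a h ha hh]
  · rw [LinearMap.sub_apply, h1, sub_self]
  · intro a b hab
    exact Tuple.monotone_sort m hab
  · intro k
    simp only [Function.comp_apply, Fin.val_castAdd]
    omega

theorem iota_bv {n N ℓ : ℕ} (j : Fin n → Fin N) (m : Fin ℓ → Fin n) :
    iotaT ℓ j (bv m) = bv (j ∘ m) := by
  funext m'
  change (∑ m₁, if j ∘ m₁ = m' then (if m₁ = m then (1 : K) else 0) else 0) =
    if m' = j ∘ m then 1 else 0
  rw [Finset.sum_eq_single m (fun b _ hb => by simp [hb]) (fun h => absurd (Finset.mem_univ _) h)]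
  simp [eq_comm]

theorem cent_le {n ℓ : ℕ} [NeZero n] (ε : Fin n → Bool) (x : Module.End K (Vl n ℓ))
    (hx : ∀ y ∈ HimageL n ℓ ε, y * x = x * y) : x ∈ UimageL n ℓ ε := by
  have : NeZero (n + ℓ) := ⟨by have := NeZero.pos n; omega⟩
  let ε' : Fin (n + ℓ) → Bool := Fin.append ε (fun _ => false)
  let j : Fin n → Fin (n + ℓ) := Fin.castAdd ℓ
  have hj : ∀ p, (j p : ℕ) = p := fun p => rfl
  have hε : ∀ p, ε' (j p) = ε p := fun p => Fin.append_left _ _ _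
  have hinj : Function.Injective j := Fin.castAdd_injective _ _
  have hX : (iotaT ℓ j ∘ₗ x ∘ₗ piT ℓ j : Module.End K (Vl (n + ℓ) ℓ)) ∈ UimageL (n + ℓ) ℓ ε' := by
    refine double_centralizer _ (U_adj ε') _ fun T hT => ?_
    obtain ⟨h, hh, h1⟩ := T_iota ε' T hT
    have h2 : ∀ g, T (iotaT ℓ j g) = h (iotaT ℓ j g) := by
      intro g
      rw [bv_decomp g]
      simp only [map_sum, map_smul, iota_bv]
      exact Finset.sum_congr rfl fun m _ => by rw [h1 m]
    have h3 := ext_comm ε ε' j hj hε x hx h hh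
    have hb : ∀ z : Fin ℓ → Fin (n + ℓ), (T * (iotaT ℓ j ∘ₗ x ∘ₗ piT ℓ j)) (bv z) =
        ((iotaT ℓ j ∘ₗ x ∘ₗ piT ℓ j) * T) (bv z) := by
      intro z
      by_cases hz : ∃ m, z = j ∘ m
      · obtain ⟨m, rfl⟩ := hz
        have h4 := LinearMap.congr_fun h3 (bv (j ∘ m))
        simp only [Module.End.mul_apply, LinearMap.comp_apply] at h4 ⊢
        rw [h2, h4, h1 m]
      · have hp : ∀ m' : Fin ℓ → Fin n, z ≠ j ∘ m' := fun m' h => hz ⟨m', h⟩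
        have e1 : piT ℓ j (bv z) = 0 := by
          funext m'
          change bv z (j ∘ m') = 0
          simp [bv, (hp m').symm]
        have e2 : piT ℓ j (T (bv z)) = 0 := by
          funext m'
          change T (bv z) (j ∘ m') = 0
          by_contra hne
          have h5 := wt ε' T hT z (j ∘ m') hne
          apply hz
          have h6 : ∀ t, ∃ p, j p = z t := by
            intro t
            have h7 := h5 (z t)
            have h8 : 0 < (Finset.univ.filter (fun s => (j ∘ m') s = z t)).card := by
              rw [h7, Finset.card_pos]
              exact ⟨t, by simp⟩
            obtain ⟨s, hs⟩ := Finset.card_pos.1 h8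
            exact ⟨m' s, (Finset.mem_filter.1 hs).2⟩
          choose m hm using h6
          exact ⟨m, funext fun t => (hm t).symm⟩
        simp only [Module.End.mul_apply, LinearMap.comp_apply, e1, e2, map_zero]
    apply LinearMap.ext
    intro g
    rw [bv_decomp g, map_sum, map_sum]
    exact Finset.sum_congr rfl fun z _ => by rw [map_smul, map_smul, hb z]
  obtain ⟨y, hy, h1⟩ := trunc_U ε ε' j hj hε _ hX
  have : x = y := by
    apply LinearMap.ext
    intro g
    rw [← h1 g]
    simp only [LinearMap.comp_apply, pi_iota ℓ j hinj]
  rwa [this]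


/-- **Theorem 3.3 (Kwon–Yu), Schur–Weyl duality for `Ů(ε)`**: assume `ε_1 = 0` and `ℓ ≥ 2`;
then `End_{ℋ_ℓ(q^{-2})}(𝒱^{⊗ℓ}) = Φ_ℓ(Ů(ε))` and `End_{Ů(ε)}(𝒱^{⊗ℓ}) = Ψ_ℓ(ℋ_ℓ(q^{-2}))`,
i.e. the images of the two actions on `𝒱^{⊗ℓ}` are mutual centralizers in
`End_{ℚ(q)}(𝒱^{⊗ℓ})`. -/
theorem schur_weyl_duality (n ℓ : ℕ) [NeZero n] (hn : 4 ≤ n) (hℓ : 2 ≤ ℓ)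
    (ε : Fin n → Bool) (hε : ε 0 = false) :
    Subalgebra.centralizer K (HimageL n ℓ ε : Set (Module.End K (Vl n ℓ))) = UimageL n ℓ ε ∧
    Subalgebra.centralizer K (UimageL n ℓ ε : Set (Module.End K (Vl n ℓ))) = HimageL n ℓ ε := by
  have h1 : Subalgebra.centralizer K (HimageL n ℓ ε : Set (Module.End K (Vl n ℓ))) =
      UimageL n ℓ ε := by
    apply le_antisymm
    · intro x hx
      exact cent_le ε x fun y hy => (Subalgebra.mem_centralizer_iff K).1 hx y hy
    · intro x hx
      exact (Subalgebra.mem_centralizer_iff K).2 fun y hy => (U_comm_H ε x y hx hy).symm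
  refine ⟨h1, ?_⟩
  apply le_antisymm
  · intro x hx
    refine double_centralizer _ (H_adj ε) x fun C hC => ?_
    have hU : C ∈ UimageL n ℓ ε := by
      rw [← h1]
      exact (Subalgebra.mem_centralizer_iff K).2 hC
    exact (Subalgebra.mem_centralizer_iff K).1 hx C hU
  · intro x hx
    exact (Subalgebra.mem_centralizer_iff K).2 fun y hy => U_comm_H ε y x hy hx
end
end

section
/- (Folding homomorphism) Let ε′ = (ε′_1,…,ε′_{n−1}) be obtained from ε by removing ε_i for some i ∈ {1,…,n} (with ε′ homogeneous if n = 4). Then there exists a homomorphism of ℚ(q)-algebras φ : U(ε′) → U(ε) with φ(k′_j) = K_j, φ(e′_j) = E_j, φ(f′_j) = F_j for all j ∈ I′ = {0,…,n−2}, where, for 2 ≤ i ≤ n−1: K_j = k_j, E_j = e_j, F_j = f_j for j ≤ i−2; K_{i−1} = k_{i−1}k_i, E_{i−1} = e_{i−1}e_i − D_{i−1,i} e_i e_{i−1}, F_{i−1} = f_i f_{i−1} − D_{i−1,i}^{−1} f_{i−1} f_i; and K_j = k_{j+1}, E_j = e_{j+1}, F_j = f_{j+1} for j ≥ i; for i =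 n: K_0 = k_{n−1}k_0, E_0 = e_{n−1}e_0 − D_{n−1,0} e_0 e_{n−1}, F_0 = f_0 f_{n−1} − D_{n−1,0}^{−1} f_{n−1} f_0, and K_j = k_j, E_j = e_j, F_j = f_j for j ≠ 0; for i = 1: K_0 = k_0 k_1, E_0 = e_0 e_1 − D_{0,1} e_1 e_0, F_0 = f_1 f_0 − D_{0,1}^{−1} f_0 f_1, and K_j = k_{j+1}, E_j = e_{j+1}, F_j = f_{j+1} for j ≠ 0. -/
/-! Generalized quantum group of affine type A (Kwon–Yu), common definitions.

Conventions:
* The base field is `K = ℚ(q)` with `qq = q`.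
* The index set `𝕀 = {1,…,n}` is modeled 0-based by `Fin n`: the position `p : Fin n`
  represents the letter `p+1`; `ε : Fin n → Bool` with `ε p = true` meaning `ε_{p+1} = 1`.
* The affine index set `I = {0,1,…,n-1}` is modeled by `Fin n` (with cyclic arithmetic);
  for `i : Fin n`, the simple root is `α_i = δ_i - δ_{i+1}` (letters mod n), whose
  letters have 0-based positions `i - 1` and `i` (`Fin` subtraction is cyclic).
-/

noncomputable section
open scoped TensorProduct

/-! ### The presentation of the generalized quantum group `U(ε)` (Definition 2.1). -/

/-- Generators of `U(ε)`: `q^h` for `h ∈ P^∨ = ℤ^n`, and `e_i`, `f_i` for `i ∈ I`. -/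
inductive Gen (n : ℕ) : Type
  | w : (Fin n → ℤ) → Gen n
  | e : Fin n → Gen n
  | f : Fin n → Gen n

abbrev FA (n : ℕ) := FreeAlgebra K (Gen n)

def Wg {n : ℕ} (h : Fin n → ℤ) : FA n := FreeAlgebra.ι K (Gen.w h)
def Eg {n : ℕ} (i : Fin n) : FA n := FreeAlgebra.ι K (Gen.e i)
def Fg {n : ℕ} (i : Fin n) : FA n := FreeAlgebra.ι K (Gen.f i)

/-- The defining relations of `U(ε)` (Definition 2.1 of Kwon–Yu). -/
inductive URel {n : ℕ} [NeZero n] (ε : Fin n → Bool) : FA n → FA n → Prop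
  | wzero : URel ε (Wg 0) 1
  | wadd (h h' : Fin n → ℤ) : URel ε (Wg h * Wg h') (Wg (h + h'))
  | we (p i : Fin n) :
      URel ε (Wg (ωexp ε p) * Eg i) ((qv ε p ^ apair i p) • (Eg i * Wg (ωexp ε p)))
  | wf (p i : Fin n) :
      URel ε (Wg (ωexp ε p) * Fg i) ((qv ε p ^ (-apair i p)) • (Fg i * Wg (ωexp ε p)))
  | ef (i j : Fin n) : URel ε (Eg i * Fg j - Fg j * Eg i)
      (if i = j then (qq - qq⁻¹)⁻¹ • (Wg (κe ε i) - Wg (-κe ε i)) else 0)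
  | esq (i : Fin n) : oddI ε i → URel ε (Eg i * Eg i) 0
  | fsq (i : Fin n) : oddI ε i → URel ε (Fg i * Fg i) 0
  | ecomm (i j : Fin n) : i ≠ j → ¬ adjI i j → URel ε (Eg i * Eg j) (Eg j * Eg i)
  | fcomm (i j : Fin n) : i ≠ j → ¬ adjI i j → URel ε (Fg i * Fg j) (Fg j * Fg i)
  | eserre (i j : Fin n) : ¬ oddI ε i → adjI i j →
      URel ε (Eg i * Eg i * Eg j + Eg j * (Eg i * Eg i)) ((signI ε i * brk2) • (Eg i * Eg j * Eg i))
  | fserre (i j : Fin n) : ¬ oddI ε i → adjI i j →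
      URel ε (Fg i * Fg i * Fg j + Fg j * (Fg i * Fg i)) ((signI ε i * brk2) • (Fg i * Fg j * Fg i))
  | eserre2 (i : Fin n) : oddI ε i →
      URel ε (Eg i * Eg (i-1) * Eg i * Eg (i+1) + Eg (i+1) * Eg i * Eg (i-1) * Eg i
              + (signI ε i * brk2) • (Eg i * Eg (i-1) * Eg (i+1) * Eg i))
            (Eg i * Eg (i+1) * Eg i * Eg (i-1) + Eg (i-1) * Eg i * Eg (i+1) * Eg i)
  | fserre2 (i : Fin n) : oddI ε i →
      URel ε (Fg i * Fg (i-1) * Fg i * Fg (i+1) + Fg (i+1) * Fg i * Fg (i-1) * Fg i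
              + (signI ε i * brk2) • (Fg i * Fg (i-1) * Fg (i+1) * Fg i))
            (Fg i * Fg (i+1) * Fg i * Fg (i-1) + Fg (i-1) * Fg i * Fg (i+1) * Fg i)

/-- The generalized quantum group `U(ε)` of affine type A. -/
abbrev UU {n : ℕ} [NeZero n] (ε : Fin n → Bool) := RingQuot (URel ε)

def mkU {n : ℕ} [NeZero n] (ε : Fin n → Bool) : FA n →ₐ[K] UU ε :=
  RingQuot.mkAlgHom K (URel ε)

/-- `q^h ∈ U(ε)`. -/
def wgen {n : ℕ} [NeZero n] (ε : Fin n → Bool) (h : Fin n → ℤ) : UU ε := mkU ε (Wg h)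
/-- `e_i ∈ U(ε)`. -/
def ee {n : ℕ} [NeZero n] (ε : Fin n → Bool) (i : Fin n) : UU ε := mkU ε (Eg i)
/-- `f_i ∈ U(ε)`. -/
def ff {n : ℕ} [NeZero n] (ε : Fin n → Bool) (i : Fin n) : UU ε := mkU ε (Fg i)
/-- `k_i = ω_i ω_{i+1}^{-1} ∈ U(ε)`. -/
def kk {n : ℕ} [NeZero n] (ε : Fin n → Bool) (i : Fin n) : UU ε := mkU ε (Wg (κe ε i))
/-- `k_i^{-1} ∈ U(ε)`. -/
def kkinv {n : ℕ} [NeZero n] (ε : Fin n → Bool) (i : Fin n) : UU ε := mkU ε (Wg (-κe ε i))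
/-- `ω_{p+1} ∈ U(ε)` (0-based letter position `p`). -/
def ww {n : ℕ} [NeZero n] (ε : Fin n → Bool) (p : Fin n) : UU ε := mkU ε (Wg (ωexp ε p))

/-! ### The folding homomorphism (Theorem 4.3 of Kwon–Yu).

Here `n = n' + 1` and `ε' : Fin n' → Bool` is obtained from `ε` by deleting the entry at
(0-based) position `p`, i.e. the letter `i = p+1 ∈ 𝕀`.  The three cases `2 ≤ i ≤ n-1`,
`i = n`, `i = 1` of the statement correspond to `1 ≤ p ≤ n-2`, `p = n-1`, `p = 0`. -/

/-- The element `K_j ∈ U(ε)` (image of `k'_j`). -/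
def foldK {n' : ℕ} [NeZero n'] (ε : Fin (n' + 1) → Bool) (p : Fin (n' + 1)) (j : Fin n') :
    UU ε :=
  if (p : ℕ) = 0 then
    (if (j : ℕ) = 0 then kk ε 0 * kk ε 1 else kk ε j.succ)
  else if (p : ℕ) = n' then
    (if (j : ℕ) = 0 then kk ε (Fin.last n') * kk ε 0 else kk ε j.castSucc)
  else
    (if (j : ℕ) < (p : ℕ) then kk ε j.castSucc
     else if (j : ℕ) = (p : ℕ) then kk ε j.castSucc * kk ε j.succ
     else kk ε j.succ)

/-- The element `E_j ∈ U(ε)` (image of `e'_j`). -/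
def foldE {n' : ℕ} [NeZero n'] (ε : Fin (n' + 1) → Bool) (p : Fin (n' + 1)) (j : Fin n') :
    UU ε :=
  if (p : ℕ) = 0 then
    (if (j : ℕ) = 0 then ee ε 0 * ee ε 1 - Dc ε 0 1 • (ee ε 1 * ee ε 0) else ee ε j.succ)
  else if (p : ℕ) = n' then
    (if (j : ℕ) = 0 then
        ee ε (Fin.last n') * ee ε 0 - Dc ε (Fin.last n') 0 • (ee ε 0 * ee ε (Fin.last n'))
      else ee ε j.castSucc)
  else
    (if (j : ℕ) < (p : ℕ) then ee ε j.castSucc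
     else if (j : ℕ) = (p : ℕ) then
        ee ε j.castSucc * ee ε j.succ - Dc ε j.castSucc j.succ • (ee ε j.succ * ee ε j.castSucc)
     else ee ε j.succ)

/-- The element `F_j ∈ U(ε)` (image of `f'_j`). -/
def foldF {n' : ℕ} [NeZero n'] (ε : Fin (n' + 1) → Bool) (p : Fin (n' + 1)) (j : Fin n') :
    UU ε :=
  if (p : ℕ) = 0 then
    (if (j : ℕ) = 0 then ff ε 1 * ff ε 0 - (Dc ε 0 1)⁻¹ • (ff ε 0 * ff ε 1) else ff ε j.succ)
  else if (p : ℕ) = n' then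
    (if (j : ℕ) = 0 then
        ff ε 0 * ff ε (Fin.last n') - (Dc ε (Fin.last n') 0)⁻¹ • (ff ε (Fin.last n') * ff ε 0)
      else ff ε j.castSucc)
  else
    (if (j : ℕ) < (p : ℕ) then ff ε j.castSucc
     else if (j : ℕ) = (p : ℕ) then
        ff ε j.succ * ff ε j.castSucc - (Dc ε j.castSucc j.succ)⁻¹ • (ff ε j.castSucc * ff ε j.succ)
     else ff ε j.succ)

set_option linter.unusedVariables false
set_option linter.unusedSimpArgs false


section Abstract
variable {k A : Type*} [Field k] [Ring A] [Algebra k A]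

theorem fold_even_x (D c : k) (hD : D ≠ 0) (hD2 : 1 + D ^ 2 ≠ 0) (a b x : A)
    (hbx : b * x = x * b)
    (hax : a * a * x + x * (a * a) = (D + D⁻¹) • (a * x * a))
    (hab : a * a * b + b * (a * a) = (D + D⁻¹) • (a * b * a))
    (hba : b * b * a + a * (b * b) = (D + D⁻¹) • (b * a * b)) :
    (c • (a * b - D • (b * a))) * (c • (a * b - D • (b * a))) * x + x * ((c • (a * b - D • (b * a))) * (c • (a * b - D • (b * a))))
      = (D + D⁻¹) • ((c • (a * b - D • (b * a))) * x * (c • (a * b - D • (b * a)))) := by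
  have gbx : ∀ w : A, w * b * x = w * x * b := fun w => by rw [mul_assoc, hbx, ← mul_assoc]
  linear_combination (norm := skip) (-(D ^ 1 / (1 + D ^ 2)) * c ^ 2) • (a * hba * x)
    + (-(D ^ 1 / (1 + D ^ 2)) * c ^ 2) • (x * a * hba)
    + ((D ^ 1 / (1 + D ^ 2)) * c ^ 2) • (hax * b * b)
    + (-(D ^ 3 / (1 + D ^ 2)) * c ^ 2) • (x * hba * a)
    + (-(D ^ 3 / (1 + D ^ 2)) * c ^ 2) • (hba * a * x)
    + ((D ^ 2) * c ^ 2) • (hba * x * a)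
    + (-(D ^ 1) * c ^ 2) • (b * hax * b)
    + ((D ^ 0) * c ^ 2) • (a * x * hba)
    + ((D ^ 3 / (1 + D ^ 2)) * c ^ 2) • (b * b * hax)
  simp only [mul_add, add_mul, mul_sub, sub_mul, smul_mul_assoc, mul_smul_comm, smul_add, smul_sub,
    smul_smul, ← mul_assoc, mul_zero, zero_mul, smul_zero, hbx, gbx]
  match_scalars <;> field_simp <;> ring

theorem fold_odd_x (D c : k) (hD : D ≠ 0) (hD2 : 1 + D ^ 2 ≠ 0) (a b x : A)
    (hbx : b * x = x * b)
    (haa : a * a = 0)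
    (hbb : b * b = 0)
    (hqa : a * x * a * b + b * a * x * a + (-(D + D⁻¹)) • (a * x * b * a)
      = a * b * a * x + x * a * b * a) :
    (c • (a * b - D • (b * a))) * (c • (a * b - D • (b * a))) * x + x * ((c • (a * b - D • (b * a))) * (c • (a * b - D • (b * a))))
      = (-(D + D⁻¹)) • ((c • (a * b - D • (b * a))) * x * (c • (a * b - D • (b * a)))) := by
  have gbx : ∀ w : A, w * b * x = w * x * b := fun w => by rw [mul_assoc, hbx, ← mul_assoc]
  linear_combination (norm := skip) (-(D ^ 1) * c ^ 2) • (b * haa * b * x)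
    + (-(D ^ 1) * c ^ 2) • (b * x * haa * b)
    + (-(D ^ 1) * c ^ 2) • (a * hbb * a * x)
    + ((D ^ 2) * c ^ 2) • (hbb * a * x * a)
    + (-((1 + D ^ 2)) * c ^ 2) • (a * hbb * x * a)
    + ((D ^ 0) * c ^ 2) • (a * x * a * hbb)
    + (-(D ^ 1) * c ^ 2) • (x * a * hbb * a)
    + (-(D ^ 0) * c ^ 2) • (hqa * b)
    + (-(D ^ 2) * c ^ 2) • (b * hqa)
  simp only [mul_add, add_mul, mul_sub, sub_mul, smul_mul_assoc, mul_smul_comm, smul_add, smul_sub,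
    smul_smul, ← mul_assoc, mul_zero, zero_mul, smul_zero, hbx, gbx]
  match_scalars <;> field_simp <;> ring

theorem fold_even_y (D c : k) (hD : D ≠ 0) (hD2 : 1 + D ^ 2 ≠ 0) (a b y : A)
    (hya : y * a = a * y)
    (hby : b * b * y + y * (b * b) = (D + D⁻¹) • (b * y * b))
    (hab : a * a * b + b * (a * a) = (D + D⁻¹) • (a * b * a))
    (hba : b * b * a + a * (b * b) = (D + D⁻¹) • (b * a * b)) :
    (c • (a * b - D • (b * a))) * (c • (a * b - D • (b * a))) * y + y * ((c • (a * b - D • (b * a))) * (c • (a * b - D • (b * a))))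
      = (D + D⁻¹) • ((c • (a * b - D • (b * a))) * y * (c • (a * b - D • (b * a)))) := by
  have gya : ∀ w : A, w * y * a = w * a * y := fun w => by rw [mul_assoc, hya, ← mul_assoc]
  linear_combination (norm := skip) ((D ^ 3 / (1 + D ^ 2)) * c ^ 2) • (hby * a * a)
    + (-(D ^ 1) * c ^ 2) • (a * hby * a)
    + ((D ^ 1 / (1 + D ^ 2)) * c ^ 2) • (a * a * hby)
    + (-(D ^ 1 / (1 + D ^ 2)) * c ^ 2) • (hab * b * y)
    + (-(D ^ 3 / (1 + D ^ 2)) * c ^ 2) • (b * hab * y)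
    + ((D ^ 2) * c ^ 2) • (b * y * hab)
    + ((D ^ 0) * c ^ 2) • (hab * y * b)
    + (-(D ^ 1 / (1 + D ^ 2)) * c ^ 2) • (y * hab * b)
    + (-(D ^ 3 / (1 + D ^ 2)) * c ^ 2) • (y * b * hab)
  simp only [mul_add, add_mul, mul_sub, sub_mul, smul_mul_assoc, mul_smul_comm, smul_add, smul_sub,
    smul_smul, ← mul_assoc, mul_zero, zero_mul, smul_zero, hya, gya]
  match_scalars <;> field_simp <;> ring

theorem fold_odd_y (D c : k) (hD : D ≠ 0) (hD2 : 1 + D ^ 2 ≠ 0) (a b y : A)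
    (hya : y * a = a * y)
    (haa : a * a = 0)
    (hbb : b * b = 0)
    (hqb : b * a * b * y + y * b * a * b + (D + D⁻¹) • (b * a * y * b)
      = b * y * b * a + a * b * y * b) :
    (c • (a * b - D • (b * a))) * (c • (a * b - D • (b * a))) * y + y * ((c • (a * b - D • (b * a))) * (c • (a * b - D • (b * a))))
      = (-(D + D⁻¹)) • ((c • (a * b - D • (b * a))) * y * (c • (a * b - D • (b * a)))) := by
  have gya : ∀ w : A, w * y * a = w * a * y := fun w => by rw [mul_assoc, hya, ← mul_assoc]
  linear_combination (norm := skip) (-(D ^ 1) * c ^ 2) • (b * haa * b * y)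
    + ((D ^ 0) * c ^ 2) • (haa * b * y * b)
    + (-((1 + D ^ 2)) * c ^ 2) • (b * haa * y * b)
    + ((D ^ 2) * c ^ 2) • (b * y * b * haa)
    + (-(D ^ 1) * c ^ 2) • (y * b * haa * b)
    + (-(D ^ 1) * c ^ 2) • (a * hbb * a * y)
    + (-(D ^ 1) * c ^ 2) • (a * y * hbb * a)
    + ((D ^ 2) * c ^ 2) • (hqb * a)
    + ((D ^ 0) * c ^ 2) • (a * hqb)
  simp only [mul_add, add_mul, mul_sub, sub_mul, smul_mul_assoc, mul_smul_comm, smul_add, smul_sub,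
    smul_smul, ← mul_assoc, mul_zero, zero_mul, smul_zero, hya, gya]
  match_scalars <;> field_simp <;> ring

theorem fold_sq_a (D c : k) (hD : D ≠ 0) (hD2 : 1 + D ^ 2 ≠ 0) (a b : A)
    (haa : a * a = 0)
    (hba : b * b * a + a * (b * b) = (D + D⁻¹) • (b * a * b)) :
    (c • (a * b - D • (b * a))) * (c • (a * b - D • (b * a))) = 0 := by
  linear_combination (norm := skip) ((D ^ 1 / (1 + D ^ 2)) * c ^ 2) • (haa * b * b)
    + (-(D ^ 1) * c ^ 2) • (b * haa * b)
    + ((D ^ 3 / (1 + D ^ 2)) * c ^ 2) • (b * b * haa)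
    + (-(D ^ 3 / (1 + D ^ 2)) * c ^ 2) • (hba * a)
    + (-(D ^ 1 / (1 + D ^ 2)) * c ^ 2) • (a * hba)
  simp only [mul_add, add_mul, mul_sub, sub_mul, smul_mul_assoc, mul_smul_comm, smul_add, smul_sub,
    smul_smul, ← mul_assoc, mul_zero, zero_mul, smul_zero]
  match_scalars <;> field_simp <;> ring

theorem fold_sq_b (D c : k) (hD : D ≠ 0) (hD2 : 1 + D ^ 2 ≠ 0) (a b : A)
    (hbb : b * b = 0)
    (hab : a * a * b + b * (a * a) = (D + D⁻¹) • (a * b * a)) :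
    (c • (a * b - D • (b * a))) * (c • (a * b - D • (b * a))) = 0 := by
  linear_combination (norm := skip) ((D ^ 3 / (1 + D ^ 2)) * c ^ 2) • (hbb * a * a)
    + (-(D ^ 1) * c ^ 2) • (a * hbb * a)
    + ((D ^ 1 / (1 + D ^ 2)) * c ^ 2) • (a * a * hbb)
    + (-(D ^ 1 / (1 + D ^ 2)) * c ^ 2) • (hab * b)
    + (-(D ^ 3 / (1 + D ^ 2)) * c ^ 2) • (b * hab)
  simp only [mul_add, add_mul, mul_sub, sub_mul, smul_mul_assoc, mul_smul_comm, smul_add, smul_sub,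
    smul_smul, ← mul_assoc, mul_zero, zero_mul, smul_zero]
  match_scalars <;> field_simp <;> ring

theorem fold_q_a (D c : k) (hD : D ≠ 0) (hD2 : 1 + D ^ 2 ≠ 0) (a b x y : A)
    (hbx : b * x = x * b)
    (hya : y * a = a * y)
    (hyx : y * x = x * y)
    (haa : a * a = 0)
    (hba : b * b * a + a * (b * b) = (D + D⁻¹) • (b * a * b))
    (hby : b * b * y + y * (b * b) = (D + D⁻¹) • (b * y * b))
    (hqa : a * x * a * b + b * a * x * a + (-(D + D⁻¹)) • (a * x * b * a)
      = a * b * a * x + x * a * b * a) :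
    (c • (a * b - D • (b * a))) * x * (c • (a * b - D • (b * a))) * y + y * (c • (a * b - D • (b * a))) * x * (c • (a * b - D • (b * a)))
      + (-(D + D⁻¹)) • ((c • (a * b - D • (b * a))) * x * y * (c • (a * b - D • (b * a))))
      = (c • (a * b - D • (b * a))) * y * (c • (a * b - D • (b * a))) * x + x * (c • (a * b - D • (b * a))) * y * (c • (a * b - D • (b * a))) := by
  have gbx : ∀ w : A, w * b * x = w * x * b := fun w => by rw [mul_assoc, hbx, ← mul_assoc]
  have gya : ∀ w : A, w * y * a = w * a * y := fun w => by rw [mul_assoc, hya, ← mul_assoc]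
  have gyx : ∀ w : A, w * y * x = w * x * y := fun w => by rw [mul_assoc, hyx, ← mul_assoc]
  linear_combination (norm := skip) (-(D ^ 2 / (1 + D ^ 2)) * c ^ 2) • (haa * b * b * x * y)
    + ((D ^ 1) * c ^ 2) • (b * haa * x * y * b)
    + ((D ^ 1) * c ^ 2) • (b * x * haa * y * b)
    + (-(D ^ 2 / (1 + D ^ 2)) * c ^ 2) • (x * haa * b * b * y)
    + (-(D ^ 2 / (1 + D ^ 2)) * c ^ 2) • (haa * x * y * b * b)
    + (-(D ^ 2 / (1 + D ^ 2)) * c ^ 2) • (x * haa * y * b * b)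
    + ((D ^ 2 / (1 + D ^ 2)) * c ^ 2) • (a * hba * x * y)
    + ((D ^ 3 / (1 + D ^ 2)) * c ^ 2) • (a * x * hba * y)
    + ((D ^ 3 / (1 + D ^ 2)) * c ^ 2) • (a * x * y * hba)
    + ((D ^ 2 / (1 + D ^ 2)) * c ^ 2) • (a * y * hba * x)
    + (-(D ^ 3 / (1 + D ^ 2)) * c ^ 2) • (hba * x * a * y)
    + ((D ^ 2 / (1 + D ^ 2)) * c ^ 2) • (x * a * hba * y)
    + ((D ^ 2 / (1 + D ^ 2)) * c ^ 2) • (x * a * y * hba)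
    + (-(D ^ 3 / (1 + D ^ 2)) * c ^ 2) • (y * hba * x * a)
    + (-(D ^ 2 / (1 + D ^ 2)) * c ^ 2) • (a * hby * a * x)
    + ((D ^ 3 / (1 + D ^ 2)) * c ^ 2) • (hby * a * x * a)
    + (-(D ^ 1) * c ^ 2) • (a * hby * x * a)
    + ((D ^ 1 / (1 + D ^ 2)) * c ^ 2) • (a * x * a * hby)
    + (-(D ^ 2 / (1 + D ^ 2)) * c ^ 2) • (x * a * hby * a)
    + (-(D ^ 1) * c ^ 2) • (hqa * b * y)
    + ((D ^ 2) * c ^ 2) • (b * y * hqa)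
    + ((D ^ 0) * c ^ 2) • (hqa * y * b)
    + (-(D ^ 1) * c ^ 2) • (y * hqa * b)
  simp only [mul_add, add_mul, mul_sub, sub_mul, smul_mul_assoc, mul_smul_comm, smul_add, smul_sub,
    smul_smul, ← mul_assoc, mul_zero, zero_mul, smul_zero, hbx, gbx, hya, gya, hyx, gyx]
  match_scalars <;> field_simp <;> ring

theorem fold_q_b (D c : k) (hD : D ≠ 0) (hD2 : 1 + D ^ 2 ≠ 0) (a b x y : A)
    (hbx : b * x = x * b)
    (hya : y * a = a * y)
    (hyx : y * x = x * y)
    (hbb : b * b = 0)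
    (hab : a * a * b + b * (a * a) = (D + D⁻¹) • (a * b * a))
    (hax : a * a * x + x * (a * a) = (D + D⁻¹) • (a * x * a))
    (hqb : b * a * b * y + y * b * a * b + (D + D⁻¹) • (b * a * y * b)
      = b * y * b * a + a * b * y * b) :
    (c • (a * b - D • (b * a))) * x * (c • (a * b - D • (b * a))) * y + y * (c • (a * b - D • (b * a))) * x * (c • (a * b - D • (b * a)))
      + (D + D⁻¹) • ((c • (a * b - D • (b * a))) * x * y * (c • (a * b - D • (b * a))))
      = (c • (a * b - D • (b * a))) * y * (c • (a * b - D • (b * a))) * x + x * (c • (a * b - D • (b * a))) * y * (c • (a * b - D • (b * a))) := by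
  have gbx : ∀ w : A, w * b * x = w * x * b := fun w => by rw [mul_assoc, hbx, ← mul_assoc]
  have gya : ∀ w : A, w * y * a = w * a * y := fun w => by rw [mul_assoc, hya, ← mul_assoc]
  have gyx : ∀ w : A, w * y * x = w * x * y := fun w => by rw [mul_assoc, hyx, ← mul_assoc]
  linear_combination (norm := skip) ((D ^ 2 / (1 + D ^ 2)) * c ^ 2) • (hbb * a * a * x * y)
    + (-(D ^ 1) * c ^ 2) • (a * hbb * x * a * y)
    + (-(D ^ 1) * c ^ 2) • (a * x * y * hbb * a)
    + ((D ^ 2 / (1 + D ^ 2)) * c ^ 2) • (hbb * x * a * a * y)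
    + ((D ^ 2 / (1 + D ^ 2)) * c ^ 2) • (x * y * hbb * a * a)
    + ((D ^ 2 / (1 + D ^ 2)) * c ^ 2) • (y * hbb * a * a * x)
    + (-(D ^ 2 / (1 + D ^ 2)) * c ^ 2) • (b * hab * x * y)
    + (-(D ^ 2 / (1 + D ^ 2)) * c ^ 2) • (b * x * hab * y)
    + (-(D ^ 1 / (1 + D ^ 2)) * c ^ 2) • (b * x * y * hab)
    + (-(D ^ 1 / (1 + D ^ 2)) * c ^ 2) • (b * y * hab * x)
    + ((D ^ 1 / (1 + D ^ 2)) * c ^ 2) • (hab * x * y * b)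
    + ((D ^ 1 / (1 + D ^ 2)) * c ^ 2) • (x * hab * y * b)
    + (-(D ^ 2 / (1 + D ^ 2)) * c ^ 2) • (x * y * b * hab)
    + (-(D ^ 2 / (1 + D ^ 2)) * c ^ 2) • (y * b * hab * x)
    + ((D ^ 2 / (1 + D ^ 2)) * c ^ 2) • (b * hax * b * y)
    + (-(D ^ 1 / (1 + D ^ 2)) * c ^ 2) • (hax * b * y * b)
    + ((D ^ 1) * c ^ 2) • (b * hax * y * b)
    + (-(D ^ 3 / (1 + D ^ 2)) * c ^ 2) • (b * y * b * hax)
    + ((D ^ 2 / (1 + D ^ 2)) * c ^ 2) • (y * b * hax * b)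
    + (-(D ^ 1) * c ^ 2) • (hqb * a * x)
    + ((D ^ 0) * c ^ 2) • (a * x * hqb)
    + ((D ^ 2) * c ^ 2) • (hqb * x * a)
    + (-(D ^ 1) * c ^ 2) • (x * hqb * a)
  simp only [mul_add, add_mul, mul_sub, sub_mul, smul_mul_assoc, mul_smul_comm, smul_add, smul_sub,
    smul_smul, ← mul_assoc, mul_zero, zero_mul, smul_zero, hbx, gbx, hya, gya, hyx, gyx]
  match_scalars <;> field_simp <;> ring

end Abstract
section Abstract2
variable {k A : Type*} [Field k] [Ring A] [Algebra k A]

theorem fold_comm (D c : k) (a b z : A) (ha : a * z = z * a) (hb : b * z = z * b) :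
    (c • (a * b - D • (b * a))) * z = z * (c • (a * b - D • (b * a))) := by
  linear_combination (norm := skip) c • (a * hb) + c • (ha * b) - (c * D) • (b * ha)
    - (c * D) • (hb * a)
  simp only [mul_add, add_mul, mul_sub, sub_mul, smul_mul_assoc, mul_smul_comm, smul_add, smul_sub,
    smul_smul, ← mul_assoc]
  module

theorem fold_nb_x (D c u : k) (a b x : A) (hb : b * x = x * b)
    (h : x * x * a + a * (x * x) = u • (x * a * x)) :
    x * x * (c • (a * b - D • (b * a))) + (c • (a * b - D • (b * a))) * (x * x)
      = u • (x * (c • (a * b - D • (b * a))) * x) := by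
  have gb : ∀ w : A, w * b * x = w * x * b := fun w => by rw [mul_assoc, hb, ← mul_assoc]
  linear_combination (norm := skip) c • (h * b) - (c * D) • (b * h)
  simp only [mul_add, add_mul, mul_sub, sub_mul, smul_mul_assoc, mul_smul_comm, smul_add, smul_sub,
    smul_smul, ← mul_assoc, hb, gb]
  module

theorem fold_nb_y (D c u : k) (a b y : A) (ha : a * y = y * a)
    (h : y * y * b + b * (y * y) = u • (y * b * y)) :
    y * y * (c • (a * b - D • (b * a))) + (c • (a * b - D • (b * a))) * (y * y)
      = u • (y * (c • (a * b - D • (b * a))) * y) := by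
  have ga : ∀ w : A, w * a * y = w * y * a := fun w => by rw [mul_assoc, ha, ← mul_assoc]
  linear_combination (norm := skip) c • (a * h) - (c * D) • (h * a)
  simp only [mul_add, add_mul, mul_sub, sub_mul, smul_mul_assoc, mul_smul_comm, smul_add, smul_sub,
    smul_smul, ← mul_assoc, ha, ga]
  module

theorem fold_nbq_x (D c u : k) (a b x z : A) (hbx : b * x = x * b) (hbz : b * z = z * b)
    (h : x * z * x * a + a * x * z * x + u • (x * z * a * x) = x * a * x * z + z * x * a * x) :
    x * z * x * (c • (a * b - D • (b * a))) + (c • (a * b - D • (b * a))) * x * z * x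
      + u • (x * z * (c • (a * b - D • (b * a))) * x)
      = x * (c • (a * b - D • (b * a))) * x * z + z * x * (c • (a * b - D • (b * a))) * x := by
  have gx : ∀ w : A, w * b * x = w * x * b := fun w => by rw [mul_assoc, hbx, ← mul_assoc]
  have gz : ∀ w : A, w * b * z = w * z * b := fun w => by rw [mul_assoc, hbz, ← mul_assoc]
  linear_combination (norm := skip) c • (h * b) - (c * D) • (b * h)
  simp only [mul_add, add_mul, mul_sub, sub_mul, smul_mul_assoc, mul_smul_comm, smul_add, smul_sub,
    smul_smul, ← mul_assoc, hbx, gx, hbz, gz]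
  module

theorem fold_nbq_y (D c u : k) (a b y z : A) (hay : a * y = y * a) (haz : a * z = z * a)
    (h : y * b * y * z + z * y * b * y + u • (y * b * z * y) = y * z * y * b + b * y * z * y) :
    y * (c • (a * b - D • (b * a))) * y * z + z * y * (c • (a * b - D • (b * a))) * y
      + u • (y * (c • (a * b - D • (b * a))) * z * y)
      = y * z * y * (c • (a * b - D • (b * a))) + (c • (a * b - D • (b * a))) * y * z * y := by
  have gy : ∀ w : A, w * a * y = w * y * a := fun w => by rw [mul_assoc, hay, ← mul_assoc]
  have gz : ∀ w : A, w * a * z = w * z * a := fun w => by rw [mul_assoc, haz, ← mul_assoc]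
  linear_combination (norm := skip) c • (a * h) - (c * D) • (h * a)
  simp only [mul_add, add_mul, mul_sub, sub_mul, smul_mul_assoc, mul_smul_comm, smul_add, smul_sub,
    smul_smul, ← mul_assoc, hay, gy, haz, gz]
  module

theorem fold_ef (D c : k) (hD : D ≠ 0) (hD2 : 1 - D ^ 2 ≠ 0) (hc : c * (D⁻¹ - D) = 1)
    (a b fa fb ka la kb lb : A)
    (haa : a * fa - fa * a = c • (ka - la)) (hbb : b * fb - fb * b = c • (kb - lb))
    (hab : a * fb - fb * a = 0) (hba : b * fa - fa * b = 0)
    (h1 : kb * a = D • (a * kb)) (h2 : lb * a = D⁻¹ • (a * lb))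
    (h3 : ka * b = D • (b * ka)) (h4 : la * b = D⁻¹ • (b * la))
    (h5 : kb * fa = D⁻¹ • (fa * kb)) (h6 : la * fb = D • (fb * la))
    (h7 : kb * la = la * kb) (h8 : lb * la = la * lb) :
    (a * b - D • (b * a)) * (fb * fa - D⁻¹ • (fa * fb))
      - (fb * fa - D⁻¹ • (fa * fb)) * (a * b - D • (b * a)) = c • (ka * kb - la * lb) := by
  obtain rfl : c = D / (1 - D ^ 2) := by
    field_simp at hc ⊢
    linear_combination hc
  set c := D / (1 - D ^ 2) with hcdef
  have e1 : (a * b - D • (b * a)) * fb - fb * (a * b - D • (b * a))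
      = (c * (1 - D ^ 2)) • (a * kb) := by
    linear_combination (norm := skip) a * hbb + hab * b - D • (b * hab) - D • (hbb * a)
      - (D * c) • h1 + (D * c) • h2
    simp only [mul_add, add_mul, mul_sub, sub_mul, smul_mul_assoc, mul_smul_comm, smul_add,
      smul_sub, smul_smul, ← mul_assoc, mul_zero, zero_mul, smul_zero]
    match_scalars <;> field_simp <;> ring
  have e2 : (a * b - D • (b * a)) * fa - fa * (a * b - D • (b * a))
      = -(c * (D⁻¹ - D)) • (b * la) := by
    linear_combination (norm := skip) a * hba + haa * b - D • (b * haa) - D • (hba * a)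
      + c • h3 - c • h4
    simp only [mul_add, add_mul, mul_sub, sub_mul, smul_mul_assoc, mul_smul_comm, smul_add,
      smul_sub, smul_smul, ← mul_assoc, mul_zero, zero_mul, smul_zero]
    match_scalars <;> field_simp <;> ring
  linear_combination (norm := skip) e1 * fa + fb * e2 - D⁻¹ • (e2 * fb) - D⁻¹ • (fa * e1)
    + (c * (1 - D ^ 2)) • (a * h5) + (c * (D⁻¹ - D) * D⁻¹) • (b * h6)
    + (c * (1 - D ^ 2) * D⁻¹) • (haa * kb) + (c * (D⁻¹ - D)) • (hbb * la)
    + (c ^ 2 * (D⁻¹ - D)) • (h7 - h8)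
  simp only [mul_add, add_mul, mul_sub, sub_mul, smul_mul_assoc, mul_smul_comm, smul_add,
    smul_sub, smul_smul, ← mul_assoc, mul_zero, zero_mul, smul_zero]
  simp only [hcdef]
  match_scalars <;> field_simp <;> ring

end Abstract2
theorem qq_sq_add : qq ^ 2 + 1 ≠ 0 := by
  have h : (Polynomial.X ^ 2 + 1 : Polynomial ℚ) ≠ 0 :=
    (by monicity! : (Polynomial.X ^ 2 + 1 : Polynomial ℚ).Monic).ne_zero
  have := (map_ne_zero_iff _ (RatFunc.algebraMap_injective ℚ)).2 h
  simpa [qq] using this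

theorem qq_sq_sub : qq ^ 2 - 1 ≠ 0 := by
  have h : (Polynomial.X ^ 2 - 1 : Polynomial ℚ) ≠ 0 :=
    (by monicity! : (Polynomial.X ^ 2 - 1 : Polynomial ℚ).Monic).ne_zero
  have := (map_ne_zero_iff _ (RatFunc.algebraMap_injective ℚ)).2 h
  simpa [qq] using this

theorem D_add {n : ℕ} (ε : Fin n → Bool) (p : Fin n) : 1 + (qv ε p)⁻¹ ^ 2 ≠ 0 := by
  have := qq_ne
  have h2 := qq_sq_add
  unfold qv; split_ifs
  · simpa [add_comm] using h2
  · intro h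
    apply h2
    field_simp at h
    simpa using h

theorem D_sub {n : ℕ} (ε : Fin n → Bool) (p : Fin n) : 1 - (qv ε p)⁻¹ ^ 2 ≠ 0 := by
  have := qq_ne
  have h2 := qq_sq_sub
  unfold qv; split_ifs
  · intro h
    apply h2
    simp at h
    linear_combination -h
  · intro h
    apply h2
    field_simp at h
    simpa using h

theorem c_D {n : ℕ} (ε : Fin n → Bool) (p : Fin n) :
    (qq - qq⁻¹)⁻¹ * ((qv ε p)⁻¹⁻¹ - (qv ε p)⁻¹) = 1 := by
  have h0 := qq_ne
  have h2 := qq_sq_sub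
  have h3 : qq - qq⁻¹ ≠ 0 := by
    intro h
    apply h2
    field_simp at h
    linear_combination h
  have : (qv ε p)⁻¹⁻¹ - (qv ε p)⁻¹ = qq - qq⁻¹ := by
    unfold qv; split_ifs
    · rw [inv_inv, inv_neg, inv_inv]; ring
    · rw [inv_inv]
  rw [this, inv_mul_cancel₀ h3]

theorem sg_eq {n : ℕ} (ε : Fin n → Bool) (p r : Fin n) (h : ε r = ε p) :
    (if ε r then (-1 : K) else 1) * brk2 = (qv ε p)⁻¹ + (qv ε p)⁻¹⁻¹ := by
  unfold qv brk2; rw [h]; split_ifs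
  · rw [inv_neg, inv_neg, inv_inv]; ring
  · rw [inv_inv]; ring

theorem sg_ne {n : ℕ} (ε : Fin n → Bool) (p r : Fin n) (h : ε r ≠ ε p) :
    (if ε r then (-1 : K) else 1) * brk2 = -((qv ε p)⁻¹ + (qv ε p)⁻¹⁻¹) := by
  unfold qv brk2
  rcases hr : ε r <;> rcases hp : ε p <;> simp_all
  all_goals ring

/-! ### Indices -/

theorem val_add_one' {n : ℕ} [NeZero n] (hn : 2 ≤ n) (j : Fin n) :
    ((j + 1 : Fin n) : ℕ) = if (j : ℕ) + 1 = n then 0 else (j : ℕ) + 1 := by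
  have h1 : ((1 : Fin n) : ℕ) = 1 := by
    rw [Fin.val_one']; exact Nat.mod_eq_of_lt (by omega)
  rw [Fin.val_add, h1]
  split_ifs with h
  · rw [h, Nat.mod_self]
  · exact Nat.mod_eq_of_lt (by omega)

theorem lam_add {n' : ℕ} [NeZero n'] (hn : 3 ≤ n') (p : Fin (n' + 1)) (j : Fin n') :
    p.succAbove (j + 1) = if p.succAbove j + 1 = p then p + 1 else p.succAbove j + 1 := by
  have h1 := val_add_one' (by omega) j
  have h2 := val_add_one' (by omega) p
  have h3 := val_add_one' (by omega) (p.succAbove j)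
  have hs : ∀ i : Fin n', (p.succAbove i : ℕ) = if (i : ℕ) < p then (i : ℕ) else i + 1 := by
    intro i
    unfold Fin.succAbove
    simp only [Fin.lt_def, Fin.val_castSucc]
    split_ifs <;> simp
  have h4 := hs j
  have h5 := hs (j + 1)
  have := j.2
  have := p.2
  apply Fin.ext
  rw [h5, h1]
  have h6 : (p.succAbove j + 1 = p) ↔ ((p.succAbove j + 1 : Fin (n' + 1)) : ℕ) = p := Fin.ext_iff
  by_cases hc : p.succAbove j + 1 = p
  · rw [if_pos hc, h2]
    rw [h6, h3, h4] at hc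
    split_ifs at * <;> omega
  · rw [if_neg hc, h3, h4]
    rw [h6, h3, h4] at hc
    split_ifs at * <;> omega

theorem lam_nb {n' : ℕ} [NeZero n'] (hn : 3 ≤ n') (p : Fin (n' + 1)) (j : Fin n') :
    (p.succAbove (j + 1) = p + 1 ∧ p.succAbove j = p - 1) ∨
    (p.succAbove (j + 1) ≠ p + 1 ∧ p.succAbove (j + 1) = p.succAbove j + 1 ∧
      p.succAbove j = p.succAbove (j + 1) - 1) := by
  have h := lam_add hn p j
  by_cases hc : p.succAbove j + 1 = p
  · left
    rw [if_pos hc] at h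
    exact ⟨h, eq_sub_of_add_eq hc⟩
  · right
    rw [if_neg hc] at h
    refine ⟨?_, h, by rw [h]; simp⟩
    rw [h]
    intro h'
    exact Fin.succAbove_ne p j (add_right_cancel h')

theorem fin_nums {n : ℕ} [NeZero n] (hn : 4 ≤ n) :
    (1 : Fin n) ≠ 0 ∧ (1 + 1 : Fin n) ≠ 0 ∧ (1 + 1 + 1 : Fin n) ≠ 0 ∧
      (5 ≤ n → (1 + 1 + 1 + 1 : Fin n) ≠ 0) := by
  have h1 : ((1 : Fin n) : ℕ) = 1 := by
    rw [Fin.val_one']; exact Nat.mod_eq_of_lt (by omega)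
  have h2 := val_add_one' (by omega) (1 : Fin n)
  have h3 := val_add_one' (by omega) (1 + 1 : Fin n)
  have h4 := val_add_one' (by omega) (1 + 1 + 1 : Fin n)
  rw [h1, if_neg (by omega)] at h2
  rw [h2, if_neg (by omega)] at h3
  rw [h3] at h4
  refine ⟨?_, ?_, ?_, ?_⟩
  · intro h; have := congrArg Fin.val h; rw [h1] at this; simp at this
  · intro h; have := congrArg Fin.val h; rw [h2] at this; simp at this
  · intro h; have := congrArg Fin.val h; rw [h3] at this; simp at this
  · intro hn h
    rw [if_neg (by omega)] at h4
    have := congrArg Fin.val h; rw [h4] at this; simp at this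

theorem idx4 {G : Type*} [AddCommGroup G] (p u : G) (h1 : u ≠ 0) (h2 : u + u ≠ 0)
    (h3 : u + u + u ≠ 0) :
    (p + u ≠ p - u ∧ p - u ≠ p + u + u ∧ p + u ≠ p - u + u) ∧
    (p ≠ p + u + u ∧ p + u + u ≠ p + u ∧ p ≠ p + u + u + u) := by
  grind

theorem idx5 {G : Type*} [AddCommGroup G] (p u : G) (h1 : u ≠ 0) (h2 : u + u ≠ 0)
    (h3 : u + u + u ≠ 0) (h4 : u + u + u + u ≠ 0) :
    (p + u + u ≠ p - u ∧ p - u ≠ p + u + u + u ∧ p + u + u ≠ p - u + u) ∧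
    (p ≠ p + u + u + u ∧ p + u + u + u ≠ p + u ∧ p ≠ p + u + u + u + u) ∧
    (p + u ≠ p - u - u ∧ p - u - u ≠ p + u + u ∧ p + u ≠ p - u - u + u) := by
  grind
/-! ### The positive half -/

structure PosRel {n : ℕ} [NeZero n] (ε : Fin n → Bool) {A : Type*} [Ring A] [Algebra K A]
    (g : Fin n → A) : Prop where
  sq : ∀ i, oddI ε i → g i * g i = 0
  comm : ∀ i j, i ≠ j → ¬ adjI i j → g i * g j = g j * g i
  serre : ∀ i j, ¬ oddI ε i → adjI i j →
      g i * g i * g j + g j * (g i * g i) = (signI ε i * brk2) • (g i * g j * g i)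
  serre2 : ∀ i, oddI ε i →
      g i * g (i-1) * g i * g (i+1) + g (i+1) * g i * g (i-1) * g i
        + (signI ε i * brk2) • (g i * g (i-1) * g (i+1) * g i)
      = g i * g (i+1) * g i * g (i-1) + g (i-1) * g i * g (i+1) * g i

def foldG {n' : ℕ} [NeZero n'] {A : Type*} [Ring A] [Algebra K A] (D c : K)
    (g : Fin (n' + 1) → A) (p : Fin (n' + 1)) (j : Fin n') : A :=
  if p.succAbove j = p + 1 then c • (g p * g (p + 1) - D • (g (p + 1) * g p))
  else g (p.succAbove j)

theorem half {n' : ℕ} [NeZero n'] (hn : 3 ≤ n') {A : Type*} [Ring A] [Algebra K A]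
    (ε : Fin (n' + 1) → Bool) (p : Fin (n' + 1)) (ε' : Fin n' → Bool)
    (hε' : ∀ j : Fin n', ε' j = ε (p.succAbove j))
    (hhom : n' = 3 → ∀ j j' : Fin n', ε' j = ε' j') (c : K)
    (g : Fin (n' + 1) → A) (h : PosRel ε g) : PosRel ε' (foldG (qv ε p)⁻¹ c g p) := by
  have hD : (qv ε p)⁻¹ ≠ 0 := inv_ne_zero (qv_ne ε p)
  have hD2 := D_add ε p
  obtain ⟨n1, n2, n3, n4⟩ := fin_nums (n := n' + 1) (by omega)
  obtain ⟨⟨i1, i2, i3⟩, ⟨i4, i5, i6⟩⟩ := idx4 p 1 n1 n2 n3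
  have i7 := fun h5 : 5 ≤ n' + 1 => idx5 p 1 n1 n2 n3 (n4 h5)
  -- neighbours to the left
  have nbl : ∀ j : Fin n', (p.succAbove j = p + 1 ∧ p.succAbove (j - 1) = p - 1) ∨
    (p.succAbove j ≠ p + 1 ∧ p.succAbove j = p.succAbove (j - 1) + 1 ∧
      p.succAbove (j - 1) = p.succAbove j - 1) := by
    intro j
    have := lam_nb hn p (j - 1)
    rwa [sub_add_cancel] at this
  have hbx : g (p + 1) * g (p - 1) = g (p - 1) * g (p + 1) :=
    h.comm _ _ i1 (by rintro (h | h) <;> contradiction)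
  have hay : g p * g (p + 1 + 1) = g (p + 1 + 1) * g p :=
    h.comm _ _ i4 (by rintro (h | h) <;> contradiction)
  have inj : ∀ {i j : Fin n'}, p.succAbove i = p.succAbove j → i = j :=
    fun h => Fin.succAbove_right_injective h
  have hne := fun j : Fin n' => Fin.succAbove_ne p j
  -- parity and sign at a node
  have par : ∀ j : Fin n', p.succAbove j ≠ p + 1 →
      (oddI ε' j ↔ oddI ε (p.succAbove j)) ∧ signI ε' j = signI ε (p.succAbove j) := by
    intro j hj
    rcases nbl j with h1 | ⟨_, _, h1⟩
    · exact absurd h1.1 hj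
    · unfold oddI signI
      rw [hε', hε', h1]
      exact ⟨Iff.rfl, rfl⟩
  have par' : ∀ j : Fin n', p.succAbove j = p + 1 →
      (oddI ε' j ↔ ε (p - 1) ≠ ε (p + 1)) ∧ signI ε' j = if ε (p - 1) then -1 else 1 := by
    intro j hj
    rcases nbl j with h1 | h1
    · unfold oddI signI
      rw [hε', hε', h1.1, h1.2]
      exact ⟨Iff.rfl, rfl⟩
    · exact absurd hj h1.1
  -- the relations at the nodes `p` and `p + 1`
  have sa : ∀ j, ε (p - 1) = ε p → adjI p j → g p * g p * g j + g j * (g p * g p)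
      = ((qv ε p)⁻¹ + (qv ε p)⁻¹⁻¹) • (g p * g j * g p) := by
    intro j h1 h2
    have := h.serre p j (by unfold oddI; simpa using h1) h2
    unfold signI at this
    rwa [sg_eq ε p (p - 1) h1] at this
  have sb : ∀ j, ε (p + 1) = ε p → adjI (p + 1) j →
      g (p + 1) * g (p + 1) * g j + g j * (g (p + 1) * g (p + 1))
      = ((qv ε p)⁻¹ + (qv ε p)⁻¹⁻¹) • (g (p + 1) * g j * g (p + 1)) := by
    intro j h1 h2
    have := h.serre (p + 1) j (by unfold oddI; simpa using h1.symm) h2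
    unfold signI at this
    rwa [add_sub_cancel_right, sg_eq ε p p rfl] at this
  have qa : ε (p - 1) ≠ ε p → g p * g (p - 1) * g p * g (p + 1) + g (p + 1) * g p * g (p - 1) * g p
      + (-((qv ε p)⁻¹ + (qv ε p)⁻¹⁻¹)) • (g p * g (p - 1) * g (p + 1) * g p)
      = g p * g (p + 1) * g p * g (p - 1) + g (p - 1) * g p * g (p + 1) * g p := by
    intro h1
    have := h.serre2 p h1
    unfold signI at this
    rwa [sg_ne ε p (p - 1) h1] at this
  have qb : ε (p + 1) ≠ ε p →
      g (p + 1) * g p * g (p + 1) * g (p + 1 + 1) + g (p + 1 + 1) * g (p + 1) * g p * g (p + 1)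
      + ((qv ε p)⁻¹ + (qv ε p)⁻¹⁻¹) • (g (p + 1) * g p * g (p + 1 + 1) * g (p + 1))
      = g (p + 1) * g (p + 1 + 1) * g (p + 1) * g p + g p * g (p + 1) * g (p + 1 + 1) * g (p + 1) := by
    intro h1
    have := h.serre2 (p + 1) (by unfold oddI; simpa using h1.symm)
    unfold signI at this
    rwa [add_sub_cancel_right, sg_eq ε p p rfl] at this
  have aa : ε (p - 1) ≠ ε p → g p * g p = 0 := fun h1 => h.sq p h1
  have bb : ε (p + 1) ≠ ε p → g (p + 1) * g (p + 1) = 0 :=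
    fun h1 => h.sq _ (by unfold oddI; simpa using h1.symm)
  have ad1 : adjI p (p + 1) := Or.inl rfl
  have ad2 : adjI (p + 1) p := Or.inr rfl
  have ad3 : adjI p (p - 1) := Or.inr (by simp)
  have ad4 : adjI (p + 1) (p + 1 + 1) := Or.inl rfl
  constructor
  · -- squares
    intro j hj
    by_cases hm : p.succAbove j = p + 1
    · have hj' := (par' j hm).1.1 hj
      simp only [foldG, if_pos hm]
      by_cases hp : ε (p - 1) = ε p
      · have hp' : ε (p + 1) ≠ ε p := fun h => hj' (hp.trans h.symm)
        exact fold_sq_b _ c hD hD2 _ _ (bb hp') (sa _ hp ad1)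
      · have hp' : ε (p + 1) = ε p := by
          revert hp hj'
          cases ε (p - 1) <;> cases ε p <;> cases ε (p + 1) <;> simp
        exact fold_sq_a _ c hD hD2 _ _ (aa hp) (sb _ hp' ad2)
    · simp only [foldG, if_neg hm]
      exact h.sq _ ((par j hm).1.1 hj)
  · -- commutations
    have key : ∀ i j : Fin n', i ≠ j → ¬ adjI i j → p.succAbove i = p + 1 →
        foldG (qv ε p)⁻¹ c g p i * foldG (qv ε p)⁻¹ c g p j
          = foldG (qv ε p)⁻¹ c g p j * foldG (qv ε p)⁻¹ c g p i := by
      intro i j hij hadj hi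
      have hj : p.succAbove j ≠ p + 1 := fun h => hij (inj (hi.trans h.symm))
      simp only [foldG, if_pos hi, if_neg hj]
      have hj0 := hne j
      have hj1 : p.succAbove j ≠ p - 1 := by
        intro h1
        rcases nbl i with h2 | h2
        · exact hadj (Or.inr (by rw [inj (h1.trans h2.2.symm)]; simp))
        · exact h2.1 hi
      have hj2 : p.succAbove j ≠ p + 1 + 1 := by
        intro h1
        rcases lam_nb hn p i with h2 | h2
        · exact i1 (hi.symm.trans h2.2)
        · exact hadj (Or.inl (inj (by rw [h1, h2.2.1, hi])))
      apply fold_comm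
      · refine h.comm _ _ hj0.symm ?_
        rintro (h1 | h1)
        · exact hj h1
        · exact hj1 (eq_sub_of_add_eq h1.symm)
      · refine h.comm _ _ hj.symm ?_
        rintro (h1 | h1)
        · exact hj2 h1
        · exact hj0 (add_right_cancel h1).symm
    have adjsymm : ∀ i j : Fin n', adjI i j → adjI j i := fun i j h => h.symm
    intro i j hij hadj
    by_cases hi : p.succAbove i = p + 1
    · exact key i j hij hadj hi
    by_cases hj : p.succAbove j = p + 1
    · exact (key j i hij.symm (fun h => hadj h.symm) hj).symm
    simp only [foldG, if_neg hi, if_neg hj]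
    refine h.comm _ _ (fun h => hij (inj h)) ?_
    rintro (h1 | h1)
    · rcases nbl j with h2 | h2
      · exact hj h2.1
      · exact hadj (Or.inl (eq_add_of_sub_eq (inj (by rw [h2.2.2, h1]; simp))))
    · rcases nbl i with h2 | h2
      · exact hi h2.1
      · exact hadj (Or.inr (eq_add_of_sub_eq (inj (by rw [h2.2.2, h1]; simp))))
  · -- Serre
    intro i j hodd hadj
    by_cases hi : p.succAbove i = p + 1
    · have hij : p.succAbove j = p - 1 ∨ p.succAbove j = p + 1 + 1 := by
        rcases hadj with rfl | rfl
        · rcases lam_nb hn p i with h2 | h2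
          · exact absurd (hi.symm.trans h2.2) i1
          · right; rw [h2.2.1, hi]
        · rcases lam_nb hn p j with h2 | h2
          · exact Or.inl h2.2
          · exact absurd hi h2.1
      have he : ε (p - 1) = ε (p + 1) := by
        by_contra h1
        exact hodd ((par' i hi).1.2 h1)
      have hj : p.succAbove j ≠ p + 1 := by
        rcases hij with h1 | h1 <;> rw [h1]
        · exact i1.symm
        · exact i5
      rw [(par' i hi).2]
      simp only [foldG, if_pos hi, if_neg hj]
      by_cases hp : ε (p - 1) = ε p
      · have hp' : ε (p + 1) = ε p := he.symm.trans hp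
        rw [sg_eq ε p _ hp]
        rcases hij with h1 | h1 <;> rw [h1]
        · exact fold_even_x _ c hD hD2 _ _ _ hbx (sa _ hp ad3) (sa _ hp ad1) (sb _ hp' ad2)
        · exact fold_even_y _ c hD hD2 _ _ _ hay.symm (sb _ hp' ad4) (sa _ hp ad1) (sb _ hp' ad2)
      · have hp' : ε (p + 1) ≠ ε p := fun h => hp (he.trans h)
        rw [sg_ne ε p _ hp]
        rcases hij with h1 | h1 <;> rw [h1]
        · exact fold_odd_x _ c hD hD2 _ _ _ hbx (aa hp) (bb hp') (qa hp)
        · exact fold_odd_y _ c hD hD2 _ _ _ hay.symm (aa hp) (bb hp') (qb hp')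
    · rw [(par i hi).2]
      have hodd' : ¬ oddI ε (p.succAbove i) := fun h => hodd ((par i hi).1.2 h)
      by_cases hj : p.succAbove j = p + 1
      · have hij : p.succAbove i = p - 1 ∨ p.succAbove i = p + 1 + 1 := by
          rcases hadj with rfl | rfl
          · rcases lam_nb hn p i with h2 | h2
            · exact Or.inl h2.2
            · exact absurd hj h2.1
          · rcases lam_nb hn p j with h2 | h2
            · exact absurd (hj.symm.trans h2.2) i1
            · right; rw [h2.2.1, hj]
        simp only [foldG, if_neg hi, if_pos hj]
        rcases hij with h1 | h1 <;> rw [h1] at hodd' ⊢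
        · exact fold_nb_x _ c _ _ _ _ hbx (h.serre _ _ hodd' (Or.inl (by simp)))
        · exact fold_nb_y _ c _ _ _ _ hay (h.serre _ _ hodd' (Or.inr rfl))
      · simp only [foldG, if_neg hi, if_neg hj]
        refine h.serre _ _ hodd' ?_
        rcases hadj with rfl | rfl
        · rcases lam_nb hn p i with h2 | h2
          · exact absurd h2.1 hj
          · exact Or.inl h2.2.1
        · rcases lam_nb hn p j with h2 | h2
          · exact absurd h2.1 hi
          · exact Or.inr h2.2.1
  · -- quartic
    intro i hodd
    have h5 : 5 ≤ n' + 1 := by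
      by_contra h1
      exact hodd (hhom (by omega) _ _)
    obtain ⟨⟨a1, a2, a3⟩, ⟨a4, a5, a6⟩, ⟨a7, a8, a9⟩⟩ := i7 h5
    have hyx : g (p + 1 + 1) * g (p - 1) = g (p - 1) * g (p + 1 + 1) :=
      h.comm _ _ a1 (by rintro (h | h) <;> contradiction)
    have haz : g p * g (p + 1 + 1 + 1) = g (p + 1 + 1 + 1) * g p :=
      h.comm _ _ a4 (by rintro (h | h) <;> contradiction)
    have hbz : g (p + 1) * g (p - 1 - 1) = g (p - 1 - 1) * g (p + 1) :=
      h.comm _ _ a7 (by rintro (h | h) <;> contradiction)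
    have L := nbl i
    have R := lam_nb hn p i
    by_cases hi : p.succAbove i = p + 1
    · have hl : p.succAbove (i - 1) = p - 1 := by
        rcases L with h2 | h2
        · exact h2.2
        · exact absurd hi h2.1
      have hr : p.succAbove (i + 1) = p + 1 + 1 := by
        rcases R with h2 | h2
        · exact absurd (hi.symm.trans h2.2) i1
        · rw [h2.2.1, hi]
      have hl' : p.succAbove (i - 1) ≠ p + 1 := by rw [hl]; exact i1.symm
      have hr' : p.succAbove (i + 1) ≠ p + 1 := by rw [hr]; exact i5
      have hj' := (par' i hi).1.1 hodd
      rw [(par' i hi).2]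
      simp only [foldG, if_pos hi, if_neg hl', if_neg hr']
      rw [hl, hr]
      by_cases hp : ε (p - 1) = ε p
      · have hp' : ε (p + 1) ≠ ε p := fun h => hj' (hp.trans h.symm)
        rw [sg_eq ε p _ hp]
        exact fold_q_b _ c hD hD2 _ _ _ _ hbx hay.symm hyx (bb hp') (sa _ hp ad1) (sa _ hp ad3)
          (qb hp')
      · have hp' : ε (p + 1) = ε p := by
          revert hp hj'
          cases ε (p - 1) <;> cases ε p <;> cases ε (p + 1) <;> simp
        rw [sg_ne ε p _ hp]
        exact fold_q_a _ c hD hD2 _ _ _ _ hbx hay.symm hyx (aa hp) (sb _ hp' ad2) (sb _ hp' ad4)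
          (qa hp)
    · have hq := h.serre2 _ ((par i hi).1.1 hodd)
      rw [(par i hi).2]
      have hl : p.succAbove (i - 1) = p.succAbove i - 1 := by
        rcases L with h2 | h2
        · exact absurd h2.1 hi
        · exact h2.2.2
      rcases R with ⟨r1, r2⟩ | ⟨r1, r2, r3⟩
      · have hl' : p.succAbove (i - 1) ≠ p + 1 := by
          rw [hl, r2]; exact a7.symm
        simp only [foldG, if_neg hi, if_neg hl', if_pos r1]
        rw [hl]
        rw [r2] at hq ⊢
        rw [sub_add_cancel] at hq
        exact fold_nbq_x _ c _ _ _ _ _ hbx hbz hq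
      · by_cases hl' : p.succAbove (i - 1) = p + 1
        · have hi' : p.succAbove i = p + 1 + 1 := by
            rw [← hl', hl]; simp
          simp only [foldG, if_neg hi, if_pos hl', if_neg r1]
          rw [r2]
          rw [hi'] at hq ⊢
          rw [add_sub_cancel_right] at hq
          exact fold_nbq_y _ c _ _ _ _ _ hay haz hq
        · simp only [foldG, if_neg hi, if_neg hl', if_neg r1]
          rw [r2, hl]
          exact hq
/-! ### Relations in `U(ε)` -/

theorem fold_qc {k A : Type*} [Field k] [Ring A] [Algebra k A] (D c s t : k) (w a b : A)
    (H : w * a = s • (a * w)) (H' : w * b = t • (b * w)) :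
    w * (c • (a * b - D • (b * a))) = (s * t) • ((c • (a * b - D • (b * a))) * w) := by
  linear_combination (norm := skip) c • (H * b) + (c * s) • (a * H') - (c * D) • (H' * a)
    - (c * D * t) • (b * H)
  simp only [mul_add, add_mul, mul_sub, sub_mul, smul_mul_assoc, mul_smul_comm, smul_add, smul_sub,
    smul_smul, ← mul_assoc]
  module

section InU
variable {n : ℕ} [NeZero n] (ε : Fin n → Bool)

theorem mkU_rel {x y : FA n} (h : URel ε x y) : mkU ε x = mkU ε y :=
  RingQuot.mkAlgHom_rel K h

theorem wgen_zero : wgen ε 0 = 1 := by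
  have := mkU_rel ε URel.wzero
  rwa [map_one] at this

theorem wgen_mul (h h' : Fin n → ℤ) : wgen ε h * wgen ε h' = wgen ε (h + h') := by
  have := mkU_rel ε (URel.wadd h h')
  rwa [map_mul] at this

/-- `q^h z = s z q^h`. -/
def Qc (h : Fin n → ℤ) (z : UU ε) (s : K) : Prop := wgen ε h * z = s • (z * wgen ε h)

variable {ε}

theorem Qc.add {h h' : Fin n → ℤ} {z : UU ε} {s s' : K} (H : Qc ε h z s) (H' : Qc ε h' z s') :
    Qc ε (h + h') z (s * s') := by
  unfold Qc at *
  rw [← wgen_mul, mul_assoc, H', mul_smul_comm, ← mul_assoc, H, smul_mul_assoc, smul_smul,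
    mul_assoc, mul_comm s]

theorem Qc.neg {h : Fin n → ℤ} {z : UU ε} {s : K} (H : Qc ε h z s) (hs : s ≠ 0) :
    Qc ε (-h) z s⁻¹ := by
  unfold Qc at *
  have e1 : wgen ε (-h) * wgen ε h = 1 := by rw [wgen_mul, neg_add_cancel, wgen_zero]
  have e2 : wgen ε h * wgen ε (-h) = 1 := by rw [wgen_mul, add_neg_cancel, wgen_zero]
  have e3 : z = s • (wgen ε (-h) * z * wgen ε h) := by
    calc z = wgen ε (-h) * wgen ε h * z := by rw [e1, one_mul]
      _ = _ := by rw [mul_assoc, H, mul_smul_comm, mul_assoc]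
  calc wgen ε (-h) * z = s⁻¹ • (s • (wgen ε (-h) * z * wgen ε h) * wgen ε (-h)) := by
        rw [smul_mul_assoc, smul_smul, inv_mul_cancel₀ hs, one_smul, mul_assoc _ (wgen ε h), e2,
          mul_one]
    _ = _ := by rw [← e3]

theorem Qc.fold {h : Fin n → ℤ} {a b : UU ε} {s t : K} (D c : K) (H : Qc ε h a s)
    (H' : Qc ε h b t) : Qc ε h (c • (a * b - D • (b * a))) (s * t) := by
  exact fold_qc D c s t _ _ _ H H'

variable (ε)

theorem Qc_e (r i : Fin n) : Qc ε (ωexp ε r) (ee ε i) (qv ε r ^ apair i r) := by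
  have := mkU_rel ε (URel.we r i)
  rwa [map_mul, map_smul, map_mul] at this

theorem Qc_f (r i : Fin n) : Qc ε (ωexp ε r) (ff ε i) (qv ε r ^ (-apair i r)) := by
  have := mkU_rel ε (URel.wf r i)
  rwa [map_mul, map_smul, map_mul] at this

theorem Qk_e (i j : Fin n) : Qc ε (κe ε i) (ee ε j)
    (qv ε (i - 1) ^ apair j (i - 1) * (qv ε i ^ apair j i)⁻¹) := by
  unfold κe
  rw [sub_eq_add_neg]
  exact (Qc_e ε (i - 1) j).add ((Qc_e ε i j).neg (zpow_ne_zero _ (qv_ne ε i)))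

theorem Qk_f (i j : Fin n) : Qc ε (κe ε i) (ff ε j)
    (qv ε (i - 1) ^ (-apair j (i - 1)) * (qv ε i ^ (-apair j i))⁻¹) := by
  unfold κe
  rw [sub_eq_add_neg]
  exact (Qc_f ε (i - 1) j).add ((Qc_f ε i j).neg (zpow_ne_zero _ (qv_ne ε i)))

theorem ef_eq (i : Fin n) : ee ε i * ff ε i - ff ε i * ee ε i
    = (qq - qq⁻¹)⁻¹ • (wgen ε (κe ε i) - wgen ε (-κe ε i)) := by
  have := mkU_rel ε (URel.ef i i)
  rwa [if_pos rfl, map_sub, map_mul, map_mul, map_smul, map_sub] at this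

theorem ef_ne {i j : Fin n} (h : i ≠ j) : ee ε i * ff ε j - ff ε j * ee ε i = 0 := by
  have := mkU_rel ε (URel.ef i j)
  rwa [if_neg h, map_sub, map_mul, map_mul, map_zero] at this

theorem pos_e : PosRel ε (ee ε) := by
  constructor
  · intro i hi
    have := mkU_rel ε (URel.esq i hi)
    rwa [map_mul, map_zero] at this
  · intro i j hij ha
    have := mkU_rel ε (URel.ecomm i j hij ha)
    rwa [map_mul, map_mul] at this
  · intro i j hi ha
    have := mkU_rel ε (URel.eserre i j hi ha)
    simp only [map_add, map_mul, map_smul] at this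
    exact this
  · intro i hi
    have := mkU_rel ε (URel.eserre2 i hi)
    simp only [map_add, map_mul, map_smul] at this
    exact this

theorem pos_f : PosRel ε (ff ε) := by
  constructor
  · intro i hi
    have := mkU_rel ε (URel.fsq i hi)
    rwa [map_mul, map_zero] at this
  · intro i j hij ha
    have := mkU_rel ε (URel.fcomm i j hij ha)
    rwa [map_mul, map_mul] at this
  · intro i j hi ha
    have := mkU_rel ε (URel.fserre i j hi ha)
    simp only [map_add, map_mul, map_smul] at this
    exact this
  · intro i hi
    have := mkU_rel ε (URel.fserre2 i hi)
    simp only [map_add, map_mul, map_smul] at this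
    exact this

end InU

/-! ### Pairings -/

theorem apair_vals {n : ℕ} [NeZero n] (hn : 4 ≤ n) (p : Fin n) :
    apair (p + 1) (p - 1) = 0 ∧ apair (p + 1) p = 1 ∧ apair p p = -1 ∧ apair p (p + 1) = 0 := by
  obtain ⟨n1, n2, n3, n4⟩ := fin_nums (n := n) hn
  obtain ⟨⟨i1, i2, i3⟩, ⟨i4, i5, i6⟩⟩ := idx4 p 1 n1 n2 n3
  have j1 : p - 1 ≠ p := by simpa using n1
  have j2 : p ≠ p + 1 := by simpa using n1
  unfold apair
  rw [add_sub_cancel_right, if_neg j1, if_neg i1.symm, if_pos rfl, if_neg j2, if_neg j1.symm,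
    if_neg i1, if_neg j2.symm]
  norm_num

theorem Dc_eq {n : ℕ} [NeZero n] (hn : 4 ≤ n) (ε : Fin n → Bool) (p : Fin n) :
    Dc ε p (p + 1) = (qv ε p)⁻¹ := by
  obtain ⟨a1, a2, a3, a4⟩ := apair_vals hn p
  unfold Dc
  rw [a1, a2]
  simp

theorem foldG_pos {n' : ℕ} [NeZero n'] {A : Type*} [Ring A] [Algebra K A] (D c : K)
    (g : Fin (n' + 1) → A) (p : Fin (n' + 1)) (j : Fin n') (h : p.succAbove j = p + 1) :
    foldG D c g p j = c • (g p * g (p + 1) - D • (g (p + 1) * g p)) := if_pos h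

theorem foldG_neg {n' : ℕ} [NeZero n'] {A : Type*} [Ring A] [Algebra K A] (D c : K)
    (g : Fin (n' + 1) → A) (p : Fin (n' + 1)) (j : Fin n') (h : p.succAbove j ≠ p + 1) :
    foldG D c g p j = g (p.succAbove j) := if_neg h

theorem apair_neg {n' : ℕ} [NeZero n'] (hn : 3 ≤ n') (p : Fin (n' + 1)) (j l : Fin n')
    (h : p.succAbove j ≠ p + 1) : apair j l = apair (p.succAbove j) (p.succAbove l) := by
  have h1 := lam_nb hn p (j - 1)
  rw [sub_add_cancel] at h1
  have h2 : p.succAbove j - 1 = p.succAbove (j - 1) := by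
    rcases h1 with h1 | h1
    · exact absurd h1.1 h
    · exact h1.2.2.symm
  unfold apair
  rw [h2]
  simp only [Fin.succAbove_right_inj]

theorem apair_pos {n' : ℕ} [NeZero n'] (hn : 3 ≤ n') (p : Fin (n' + 1)) (j l : Fin n')
    (h : p.succAbove j = p + 1) :
    apair j l = apair p (p.succAbove l) + apair (p + 1) (p.succAbove l) := by
  have h1 := lam_nb hn p (j - 1)
  rw [sub_add_cancel] at h1
  have h2 : p - 1 = p.succAbove (j - 1) := by
    rcases h1 with h1 | h1
    · exact h1.2.symm
    · exact absurd h h1.1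
  unfold apair
  rw [add_sub_cancel_right, h2, ← h]
  simp only [Fin.succAbove_right_inj]
  rw [if_neg (Fin.succAbove_ne p l)]
  ring

/-- extension by zero of a coweight -/
def extw {n' : ℕ} (p : Fin (n' + 1)) (h : Fin n' → ℤ) : Fin (n' + 1) → ℤ :=
  Fin.insertNth (α := fun _ => ℤ) p 0 h

theorem extw_same {n' : ℕ} (p : Fin (n' + 1)) (h : Fin n' → ℤ) : extw p h p = 0 := by
  unfold extw; simp

theorem extw_lam {n' : ℕ} (p : Fin (n' + 1)) (h : Fin n' → ℤ) (l : Fin n') :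
    extw p h (p.succAbove l) = h l := by
  unfold extw; simp

theorem ext_fun {n' : ℕ} (p : Fin (n' + 1)) {u v : Fin (n' + 1) → ℤ} (h : u p = v p)
    (h' : ∀ l, u (p.succAbove l) = v (p.succAbove l)) : u = v := by
  funext r
  rcases eq_or_ne r p with rfl | hr
  · exact h
  · obtain ⟨l, rfl⟩ := Fin.exists_succAbove_eq hr
    exact h' l

theorem extw_zero {n' : ℕ} (p : Fin (n' + 1)) : extw p 0 = 0 :=
  ext_fun p (by simp [extw_same]) (fun l => by simp [extw_lam])

theorem extw_add {n' : ℕ} (p : Fin (n' + 1)) (h h' : Fin n' → ℤ) :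
    extw p h + extw p h' = extw p (h + h') :=
  ext_fun p (by simp [extw_same]) (fun l => by simp [extw_lam])

theorem extw_neg {n' : ℕ} (p : Fin (n' + 1)) (h : Fin n' → ℤ) :
    extw p (-h) = -extw p h :=
  ext_fun p (by simp [extw_same]) (fun l => by simp [extw_lam])

theorem extw_ω {n' : ℕ} (p : Fin (n' + 1)) (ε : Fin (n' + 1) → Bool) (ε' : Fin n' → Bool)
    (hε' : ∀ j : Fin n', ε' j = ε (p.succAbove j)) (l : Fin n') :
    extw p (ωexp ε' l) = ωexp ε (p.succAbove l) := by
  apply ext_fun p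
  · rw [extw_same]
    unfold ωexp
    rw [if_neg (Fin.succAbove_ne p l).symm]
  · intro m
    rw [extw_lam]
    unfold ωexp sgn
    rw [hε']
    simp only [Fin.succAbove_right_inj]

theorem extw_κ {n' : ℕ} [NeZero n'] (p : Fin (n' + 1)) (ε : Fin (n' + 1) → Bool)
    (ε' : Fin n' → Bool) (hε' : ∀ j : Fin n', ε' j = ε (p.succAbove j)) (j : Fin n') :
    extw p (κe ε' j) = ωexp ε (p.succAbove (j - 1)) - ωexp ε (p.succAbove j) := by
  unfold κe
  rw [sub_eq_add_neg (ωexp ε' _), ← extw_add, extw_neg, extw_ω p ε ε' hε', extw_ω p ε ε' hε',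
    ← sub_eq_add_neg]

theorem extw_κ_neg {n' : ℕ} [NeZero n'] (hn : 3 ≤ n') (p : Fin (n' + 1)) (ε : Fin (n' + 1) → Bool)
    (ε' : Fin n' → Bool) (hε' : ∀ j : Fin n', ε' j = ε (p.succAbove j)) (j : Fin n')
    (h : p.succAbove j ≠ p + 1) : extw p (κe ε' j) = κe ε (p.succAbove j) := by
  rw [extw_κ p ε ε' hε']
  have h1 := lam_nb hn p (j - 1)
  rw [sub_add_cancel] at h1
  rcases h1 with h1 | h1
  · exact absurd h1.1 h
  · rw [h1.2.2]; rfl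

theorem extw_κ_pos {n' : ℕ} [NeZero n'] (hn : 3 ≤ n') (p : Fin (n' + 1)) (ε : Fin (n' + 1) → Bool)
    (ε' : Fin n' → Bool) (hε' : ∀ j : Fin n', ε' j = ε (p.succAbove j)) (j : Fin n')
    (h : p.succAbove j = p + 1) : extw p (κe ε' j) = κe ε p + κe ε (p + 1) := by
  rw [extw_κ p ε ε' hε']
  have h1 := lam_nb hn p (j - 1)
  rw [sub_add_cancel] at h1
  rcases h1 with h1 | h1
  · rw [h1.2, h]
    unfold κe
    rw [add_sub_cancel_right]
    abel
  · exact absurd h h1.1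

theorem foldF_form {k A : Type*} [Field k] [Ring A] [Algebra k A] (D : k) (hD : D ≠ 0) (a b : A) :
    (-D⁻¹) • (a * b - D • (b * a)) = b * a - D⁻¹ • (a * b) := by
  rw [smul_sub, smul_smul, neg_mul, inv_mul_cancel₀ hD]
  module

theorem fold_ef_all {n' : ℕ} [NeZero n'] (hn : 3 ≤ n') (p : Fin (n' + 1))
    (ε : Fin (n' + 1) → Bool) (ε' : Fin n' → Bool)
    (hε' : ∀ j : Fin n', ε' j = ε (p.succAbove j)) (i j : Fin n') :
    foldG (qv ε p)⁻¹ 1 (ee ε) p i * foldG (qv ε p)⁻¹ (-(qv ε p)⁻¹⁻¹) (ff ε) p j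
      - foldG (qv ε p)⁻¹ (-(qv ε p)⁻¹⁻¹) (ff ε) p j * foldG (qv ε p)⁻¹ 1 (ee ε) p i
    = if i = j then (qq - qq⁻¹)⁻¹ • (wgen ε (extw p (κe ε' i)) - wgen ε (extw p (-κe ε' i)))
      else 0 := by
  have hD : (qv ε p)⁻¹ ≠ 0 := inv_ne_zero (qv_ne ε p)
  obtain ⟨n1, n2, n3, n4⟩ := fin_nums (n := n' + 1) (by omega)
  have hab : p ≠ p + 1 := by simpa using n1
  rw [extw_neg]
  have hne := Fin.succAbove_ne p
  by_cases hi : p.succAbove i = p + 1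
  · by_cases hj : p.succAbove j = p + 1
    · have hij : i = j := Fin.succAbove_right_injective (hi.trans hj.symm)
      rw [if_pos hij, foldG_pos _ _ _ _ _ hi, foldG_pos _ _ _ _ _ hj, one_smul,
        foldF_form _ hD, extw_κ_pos hn p ε ε' hε' i hi, neg_add, ← wgen_mul, ← wgen_mul]
      obtain ⟨a1, a2, a3, a4⟩ := apair_vals (n := n' + 1) (by omega) p
      have k1 := Qk_e ε (p + 1) p
      have k2 := Qk_e ε p (p + 1)
      have k3 := Qk_f ε (p + 1) p
      have k4 := Qk_f ε p (p + 1)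
      rw [add_sub_cancel_right] at k1 k3
      simp only [a1, a2, a3, a4, zpow_neg, zpow_one, zpow_zero, neg_zero, neg_neg, inv_one,
        mul_one, one_mul] at k1 k2 k3 k4
      have k4' := k4.neg (by simpa using qv_ne ε p)
      rw [inv_inv] at k4'
      refine fold_ef (qv ε p)⁻¹ _ hD (D_sub ε p) (c_D ε p) _ _ _ _ _ _ _ _ (ef_eq ε p)
        (ef_eq ε (p + 1)) (ef_ne ε hab) (ef_ne ε hab.symm) k1 (k1.neg hD) k2 (k2.neg hD) ?_ ?_ ?_ ?_
      · rw [inv_inv]; exact k3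
      · exact k4'
      · rw [wgen_mul, wgen_mul, add_comm (_ : Fin (n' + 1) → ℤ)]
      · rw [wgen_mul, wgen_mul, add_comm (_ : Fin (n' + 1) → ℤ)]
    · have hij : i ≠ j := by rintro rfl; exact hj hi
      rw [if_neg hij, foldG_pos _ _ _ _ _ hi, foldG_neg _ _ _ _ _ hj, sub_eq_zero]
      apply fold_comm
      · exact sub_eq_zero.1 (ef_ne ε (hne j).symm)
      · exact sub_eq_zero.1 (ef_ne ε (Ne.symm hj))
  · by_cases hj : p.succAbove j = p + 1
    · have hij : i ≠ j := by rintro rfl; exact hi hj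
      rw [if_neg hij, foldG_neg _ _ _ _ _ hi, foldG_pos _ _ _ _ _ hj, sub_eq_zero]
      symm
      apply fold_comm
      · exact (sub_eq_zero.1 (ef_ne ε (hne i))).symm
      · exact (sub_eq_zero.1 (ef_ne ε hi)).symm
    · rw [foldG_neg _ _ _ _ _ hi, foldG_neg _ _ _ _ _ hj]
      by_cases hij : i = j
      · subst hij
        rw [if_pos rfl, extw_κ_neg hn p ε ε' hε' i hi]
        exact ef_eq ε _
      · rw [if_neg hij]
        exact ef_ne ε (fun h => hij (Fin.succAbove_right_injective h))

/-! ### Comparison with the explicit formulas -/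

theorem lam_cases {n' : ℕ} [NeZero n'] (hn : 3 ≤ n') (p : Fin (n' + 1)) (j : Fin n') :
    (p.succAbove j = p + 1 ∧
      (((p : ℕ) = 0 ∧ (j : ℕ) = 0 ∧ p = 0) ∨
       ((p : ℕ) ≠ 0 ∧ (p : ℕ) = n' ∧ (j : ℕ) = 0 ∧ p = Fin.last n' ∧ p + 1 = 0) ∨
       ((p : ℕ) ≠ 0 ∧ (p : ℕ) ≠ n' ∧ (j : ℕ) = p ∧ j.castSucc = p ∧ j.succ = p + 1))) ∨
    (p.succAbove j ≠ p + 1 ∧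
      (((p : ℕ) = 0 ∧ (j : ℕ) ≠ 0 ∧ j.succ = p.succAbove j) ∨
       ((p : ℕ) ≠ 0 ∧ (p : ℕ) = n' ∧ (j : ℕ) ≠ 0 ∧ j.castSucc = p.succAbove j) ∨
       ((p : ℕ) ≠ 0 ∧ (p : ℕ) ≠ n' ∧ (j : ℕ) < p ∧ j.castSucc = p.succAbove j) ∨
       ((p : ℕ) ≠ 0 ∧ (p : ℕ) ≠ n' ∧ ¬ (j : ℕ) < p ∧ (j : ℕ) ≠ p ∧ j.succ = p.succAbove j))) := by
  have h2 := val_add_one' (by omega) p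
  have hs : (p.succAbove j : ℕ) = if (j : ℕ) < p then (j : ℕ) else j + 1 := by
    unfold Fin.succAbove
    simp only [Fin.lt_def, Fin.val_castSucc]
    split_ifs <;> simp
  have := j.2
  have := p.2
  simp only [ne_eq, Fin.ext_iff, h2, hs, Fin.val_castSucc, Fin.val_succ, Fin.val_last, Fin.val_zero]
  split_ifs <;> omega

theorem foldK_eq {n' : ℕ} [NeZero n'] (hn : 3 ≤ n') (p : Fin (n' + 1))
    (ε : Fin (n' + 1) → Bool) (ε' : Fin n' → Bool)
    (hε' : ∀ j : Fin n', ε' j = ε (p.succAbove j)) (j : Fin n') :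
    wgen ε (extw p (κe ε' j)) = foldK ε p j := by
  have hk : ∀ i, kk ε i = wgen ε (κe ε i) := fun i => rfl
  rcases lam_cases hn p j with ⟨h, h'⟩ | ⟨h, h'⟩
  · rw [extw_κ_pos hn p ε ε' hε' j h, ← wgen_mul, ← hk, ← hk]
    unfold foldK
    rcases h' with ⟨h1, h2, h3⟩ | ⟨h1, h2, h3, h4, h5⟩ | ⟨h1, h2, h3, h4, h5⟩
    · rw [if_pos h1, if_pos h2, h3, zero_add]
    · rw [if_neg h1, if_pos h2, if_pos h3, h5, ← h4]
    · rw [if_neg h1, if_neg h2, if_neg (by omega), if_pos h3, h4, h5]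
  · rw [extw_κ_neg hn p ε ε' hε' j h, ← hk]
    unfold foldK
    rcases h' with ⟨h1, h2, h3⟩ | ⟨h1, h2, h3, h4⟩ | ⟨h1, h2, h3, h4⟩ | ⟨h1, h2, h3, h4, h5⟩
    · rw [if_pos h1, if_neg h2, h3]
    · rw [if_neg h1, if_pos h2, if_neg h3, h4]
    · rw [if_neg h1, if_neg h2, if_pos h3, h4]
    · rw [if_neg h1, if_neg h2, if_neg h3, if_neg h4, h5]

theorem foldE_eq {n' : ℕ} [NeZero n'] (hn : 3 ≤ n') (p : Fin (n' + 1))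
    (ε : Fin (n' + 1) → Bool) (j : Fin n') :
    foldG (qv ε p)⁻¹ 1 (ee ε) p j = foldE ε p j := by
  rw [← Dc_eq (by omega)]
  rcases lam_cases hn p j with ⟨h, h'⟩ | ⟨h, h'⟩
  · rw [foldG_pos _ _ _ _ _ h, one_smul]
    unfold foldE
    rcases h' with ⟨h1, h2, h3⟩ | ⟨h1, h2, h3, h4, h5⟩ | ⟨h1, h2, h3, h4, h5⟩
    · rw [if_pos h1, if_pos h2, h3, zero_add]
    · rw [if_neg h1, if_pos h2, if_pos h3, h5, ← h4]
    · rw [if_neg h1, if_neg h2, if_neg (by omega), if_pos h3, h4, h5]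
  · rw [foldG_neg _ _ _ _ _ h]
    unfold foldE
    rcases h' with ⟨h1, h2, h3⟩ | ⟨h1, h2, h3, h4⟩ | ⟨h1, h2, h3, h4⟩ | ⟨h1, h2, h3, h4, h5⟩
    · rw [if_pos h1, if_neg h2, h3]
    · rw [if_neg h1, if_pos h2, if_neg h3, h4]
    · rw [if_neg h1, if_neg h2, if_pos h3, h4]
    · rw [if_neg h1, if_neg h2, if_neg h3, if_neg h4, h5]

theorem foldF_eq {n' : ℕ} [NeZero n'] (hn : 3 ≤ n') (p : Fin (n' + 1))
    (ε : Fin (n' + 1) → Bool) (j : Fin n') :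
    foldG (qv ε p)⁻¹ (-(qv ε p)⁻¹⁻¹) (ff ε) p j = foldF ε p j := by
  have hD : (qv ε p)⁻¹ ≠ 0 := inv_ne_zero (qv_ne ε p)
  rcases lam_cases hn p j with ⟨h, h'⟩ | ⟨h, h'⟩
  · rw [foldG_pos _ _ _ _ _ h, foldF_form _ hD, ← Dc_eq (by omega)]
    unfold foldF
    rcases h' with ⟨h1, h2, h3⟩ | ⟨h1, h2, h3, h4, h5⟩ | ⟨h1, h2, h3, h4, h5⟩
    · rw [if_pos h1, if_pos h2, h3, zero_add]
    · rw [if_neg h1, if_pos h2, if_pos h3, h5, ← h4]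
    · rw [if_neg h1, if_neg h2, if_neg (by omega), if_pos h3, h4, h5]
  · rw [foldG_neg _ _ _ _ _ h]
    unfold foldF
    rcases h' with ⟨h1, h2, h3⟩ | ⟨h1, h2, h3, h4⟩ | ⟨h1, h2, h3, h4⟩ | ⟨h1, h2, h3, h4, h5⟩
    · rw [if_pos h1, if_neg h2, h3]
    · rw [if_neg h1, if_pos h2, if_neg h3, h4]
    · rw [if_neg h1, if_neg h2, if_pos h3, h4]
    · rw [if_neg h1, if_neg h2, if_neg h3, if_neg h4, h5]

/-! ### The homomorphism -/

def genMap {n' : ℕ} [NeZero n'] (ε : Fin (n' + 1) → Bool) (p : Fin (n' + 1)) : Gen n' → UU ε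
  | Gen.w h => wgen ε (extw p h)
  | Gen.e i => foldG (qv ε p)⁻¹ 1 (ee ε) p i
  | Gen.f i => foldG (qv ε p)⁻¹ (-(qv ε p)⁻¹⁻¹) (ff ε) p i

def liftMap {n' : ℕ} [NeZero n'] (ε : Fin (n' + 1) → Bool) (p : Fin (n' + 1)) :
    FA n' →ₐ[K] UU ε := FreeAlgebra.lift K (genMap ε p)

theorem liftMap_W {n' : ℕ} [NeZero n'] (ε : Fin (n' + 1) → Bool) (p : Fin (n' + 1))
    (h : Fin n' → ℤ) : liftMap ε p (Wg h) = wgen ε (extw p h) :=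
  FreeAlgebra.lift_ι_apply _ _

theorem liftMap_E {n' : ℕ} [NeZero n'] (ε : Fin (n' + 1) → Bool) (p : Fin (n' + 1))
    (i : Fin n') : liftMap ε p (Eg i) = foldG (qv ε p)⁻¹ 1 (ee ε) p i :=
  FreeAlgebra.lift_ι_apply _ _

theorem liftMap_F {n' : ℕ} [NeZero n'] (ε : Fin (n' + 1) → Bool) (p : Fin (n' + 1))
    (i : Fin n') : liftMap ε p (Fg i) = foldG (qv ε p)⁻¹ (-(qv ε p)⁻¹⁻¹) (ff ε) p i :=
  FreeAlgebra.lift_ι_apply _ _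

theorem liftMap_rel {n' : ℕ} [NeZero n'] (hn : 3 ≤ n') (ε : Fin (n' + 1) → Bool)
    (p : Fin (n' + 1)) (ε' : Fin n' → Bool) (hε' : ∀ j : Fin n', ε' j = ε (p.succAbove j))
    (hhom : n' = 3 → ∀ j j' : Fin n', ε' j = ε' j') {x y : FA n'} (hxy : URel ε' x y) :
    liftMap ε p x = liftMap ε p y := by
  have hE := half hn ε p ε' hε' hhom 1 _ (pos_e ε)
  have hF := half hn ε p ε' hε' hhom (-(qv ε p)⁻¹⁻¹) _ (pos_f ε)
  have hq : ∀ l, qv ε' l = qv ε (p.succAbove l) := fun l => by unfold qv; rw [hε']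
  cases hxy with
  | wzero => rw [liftMap_W, extw_zero, wgen_zero, map_one]
  | wadd h h' => rw [map_mul, liftMap_W, liftMap_W, liftMap_W, wgen_mul, extw_add]
  | we l i =>
    rw [map_mul, map_smul, map_mul, liftMap_W, liftMap_E, extw_ω p ε ε' hε', hq]
    by_cases hi : p.succAbove i = p + 1
    · rw [foldG_pos _ _ _ _ _ hi, apair_pos hn p i l hi, zpow_add₀ (qv_ne _ _)]
      exact (Qc_e ε _ _).fold _ _ (Qc_e ε _ _)
    · rw [foldG_neg _ _ _ _ _ hi, apair_neg hn p i l hi]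
      exact Qc_e ε _ _
  | wf l i =>
    rw [map_mul, map_smul, map_mul, liftMap_W, liftMap_F, extw_ω p ε ε' hε', hq]
    by_cases hi : p.succAbove i = p + 1
    · rw [foldG_pos _ _ _ _ _ hi, apair_pos hn p i l hi, neg_add, zpow_add₀ (qv_ne _ _)]
      exact (Qc_f ε _ _).fold _ _ (Qc_f ε _ _)
    · rw [foldG_neg _ _ _ _ _ hi, apair_neg hn p i l hi]
      exact Qc_f ε _ _
  | ef i j =>
    rw [map_sub, map_mul, map_mul, liftMap_E, liftMap_F, fold_ef_all hn p ε ε' hε' i j]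
    split_ifs
    · rw [map_smul, map_sub, liftMap_W, liftMap_W]
    · rw [map_zero]
  | esq i hi =>
    rw [map_mul, map_zero, liftMap_E]
    exact hE.sq i hi
  | fsq i hi =>
    rw [map_mul, map_zero, liftMap_F]
    exact hF.sq i hi
  | ecomm i j hij ha =>
    rw [map_mul, map_mul, liftMap_E, liftMap_E]
    exact hE.comm i j hij ha
  | fcomm i j hij ha =>
    rw [map_mul, map_mul, liftMap_F, liftMap_F]
    exact hF.comm i j hij ha
  | eserre i j hi ha =>
    simp only [map_add, map_mul, map_smul, liftMap_E]
    exact hE.serre i j hi ha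
  | fserre i j hi ha =>
    simp only [map_add, map_mul, map_smul, liftMap_F]
    exact hF.serre i j hi ha
  | eserre2 i hi =>
    simp only [map_add, map_mul, map_smul, liftMap_E]
    exact hE.serre2 i hi
  | fserre2 i hi =>
    simp only [map_add, map_mul, map_smul, liftMap_F]
    exact hF.serre2 i hi

/-- **Theorem 4.3 (Kwon–Yu)**: there is a homomorphism of `ℚ(q)`-algebras
`φ : U(ε') → U(ε)` with `φ(k'_j) = K_j`, `φ(e'_j) = E_j`, `φ(f'_j) = F_j` for all
`j ∈ I' = {0,…,n-2}`. -/
theorem folding_homomorphism (n' : ℕ) [NeZero n'] (hn : 4 ≤ n' + 1)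
    (ε : Fin (n' + 1) → Bool) (p : Fin (n' + 1)) (ε' : Fin n' → Bool)
    (hε' : ∀ j : Fin n', ε' j = ε (if (j : ℕ) < (p : ℕ) then j.castSucc else j.succ))
    (hhom : n' + 1 = 4 → ∀ j j' : Fin n', ε' j = ε' j') :
    ∃ φ : UU ε' →ₐ[K] UU ε,
      ∀ j : Fin n',
        φ (kk ε' j) = foldK ε p j ∧ φ (ee ε' j) = foldE ε p j ∧ φ (ff ε' j) = foldF ε p j := by
  have hn3 : 3 ≤ n' := by omega
  have hε : ∀ j : Fin n', ε' j = ε (p.succAbove j) := by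
    intro j
    rw [hε' j]
    rfl
  have hrel := fun {x y : FA n'} (h : URel ε' x y) =>
    liftMap_rel hn3 ε p ε' hε (fun h => hhom (by omega)) h
  refine ⟨RingQuot.liftAlgHom K ⟨liftMap ε p, fun x y h => hrel h⟩, fun j => ⟨?_, ?_, ?_⟩⟩
  · unfold kk mkU
    rw [RingQuot.liftAlgHom_mkAlgHom_apply, liftMap_W]
    exact foldK_eq hn3 p ε ε' hε j
  · unfold ee mkU
    rw [RingQuot.liftAlgHom_mkAlgHom_apply, liftMap_E]
    exact foldE_eq hn3 p ε j
  · unfold ff mkU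
    rw [RingQuot.liftAlgHom_mkAlgHom_apply, liftMap_F]
    exact foldF_eq hn3 p ε j
end
end
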